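/- The coradical filtration of the connected coalgebra Ū = U/K⁺U coincides with the filtration F₁: for every k, the k-th term of the coradical filtration equals Ū_k, the span of the basis monomials ∏(F_{β_i})^{n_i}∏(E_{β'_j})^{m_j} with Σn_i + Σm_j ≤ k. -/

import Mathlib

noncomputable section

open scoped TensorProduct

/-- Cartan integers of `sl_N`. -/
def cartanSL (i j : ℕ) : ℤ :=
  if i = j then 2 else if ((i : ℤ) - j).natAbs = 1 then -1 else 0

/-- The defining relations of `U_q(sl_N)` for a candidate family of generators. -/
def UqslRels (q : ℝ) (N : ℕ) {V : Type} [Ring V] [Algebra ℂ V]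
    (e f kg ki : ℕ → V) : Prop :=
  (∀ i ∈ Finset.Icc 1 (N - 1), kg i * ki i = 1 ∧ ki i * kg i = 1) ∧
  (∀ i ∈ Finset.Icc 1 (N - 1), ∀ j ∈ Finset.Icc 1 (N - 1),
      kg i * kg j = kg j * kg i) ∧
  (∀ i ∈ Finset.Icc 1 (N - 1), ∀ j ∈ Finset.Icc 1 (N - 1),
      kg i * e j = ((q : ℂ) ^ (cartanSL i j)) • (e j * kg i)) ∧
  (∀ i ∈ Finset.Icc 1 (N - 1), ∀ j ∈ Finset.Icc 1 (N - 1),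
      kg i * f j = ((q : ℂ) ^ (-cartanSL i j)) • (f j * kg i)) ∧
  (∀ i ∈ Finset.Icc 1 (N - 1), ∀ j ∈ Finset.Icc 1 (N - 1),
      e i * f j - f j * e i =
        if i = j then (((q : ℂ) - (q : ℂ)⁻¹)⁻¹) • (kg i - ki i) else 0) ∧
  (∀ i ∈ Finset.Icc 1 (N - 1), ∀ j ∈ Finset.Icc 1 (N - 1), ((i : ℤ) - j).natAbs = 1 →
      e i * e i * e j - ((q : ℂ) + (q : ℂ)⁻¹) • (e i * e j * e i) + e j * e i * e i = 0) ∧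
  (∀ i ∈ Finset.Icc 1 (N - 1), ∀ j ∈ Finset.Icc 1 (N - 1), 2 ≤ ((i : ℤ) - j).natAbs →
      e i * e j = e j * e i) ∧
  (∀ i ∈ Finset.Icc 1 (N - 1), ∀ j ∈ Finset.Icc 1 (N - 1), ((i : ℤ) - j).natAbs = 1 →
      f i * f i * f j - ((q : ℂ) + (q : ℂ)⁻¹) • (f i * f j * f i) + f j * f i * f i = 0) ∧
  (∀ i ∈ Finset.Icc 1 (N - 1), ∀ j ∈ Finset.Icc 1 (N - 1), 2 ≤ ((i : ℤ) - j).natAbs →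
      f i * f j = f j * f i)

/-- The quantized enveloping algebra `U_q(sl_N)` together with its Hopf algebra
structure, generators, defining relations and universal property. -/
structure UqslData (q : ℝ) (N : ℕ) where
  U : Type
  [instRing : Ring U]
  [instHopf : HopfAlgebra ℂ U]
  E : ℕ → U
  F : ℕ → U
  Kg : ℕ → U
  Ki : ℕ → U
  rels : UqslRels q N E F Kg Ki
  comul_E : ∀ i ∈ Finset.Icc 1 (N - 1),
    Coalgebra.comul (R := ℂ) (E i) = E i ⊗ₜ[ℂ] 1 + Kg i ⊗ₜ[ℂ] E i
  comul_F : ∀ i ∈ Finset.Icc 1 (N - 1),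
    Coalgebra.comul (R := ℂ) (F i) = F i ⊗ₜ[ℂ] Ki i + 1 ⊗ₜ[ℂ] F i
  comul_Kg : ∀ i ∈ Finset.Icc 1 (N - 1),
    Coalgebra.comul (R := ℂ) (Kg i) = Kg i ⊗ₜ[ℂ] Kg i
  comul_Ki : ∀ i ∈ Finset.Icc 1 (N - 1),
    Coalgebra.comul (R := ℂ) (Ki i) = Ki i ⊗ₜ[ℂ] Ki i
  counit_E : ∀ i ∈ Finset.Icc 1 (N - 1), Coalgebra.counit (R := ℂ) (E i) = 0
  counit_F : ∀ i ∈ Finset.Icc 1 (N - 1), Coalgebra.counit (R := ℂ) (F i) = 0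
  counit_Kg : ∀ i ∈ Finset.Icc 1 (N - 1), Coalgebra.counit (R := ℂ) (Kg i) = 1
  counit_Ki : ∀ i ∈ Finset.Icc 1 (N - 1), Coalgebra.counit (R := ℂ) (Ki i) = 1
  gen : Algebra.adjoin ℂ
      {x : U | ∃ i ∈ Finset.Icc 1 (N - 1), x = E i ∨ x = F i ∨ x = Kg i ∨ x = Ki i} = ⊤
  univ : ∀ (V : Type) [Ring V] [Algebra ℂ V] (e f kg ki : ℕ → V),
      UqslRels q N e f kg ki → ∃ φ : U →ₐ[ℂ] V,
        ∀ i ∈ Finset.Icc 1 (N - 1),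
          φ (E i) = e i ∧ φ (F i) = f i ∧ φ (Kg i) = kg i ∧ φ (Ki i) = ki i

attribute [instance] UqslData.instRing UqslData.instHopf

namespace UqslData

variable {q : ℝ} {N : ℕ} (D : UqslData q N)

/-- Root vectors `E_{α_{i,i+d}}` (iterated `q`-commutators with respect to the
standard reduced decomposition of the longest Weyl group element). -/
def Ev : ℕ → ℕ → D.U
  | 0, i => D.E i
  | d + 1, i => D.E i * Ev d (i + 1) - (q : ℂ)⁻¹ • (Ev d (i + 1) * D.E i)

/-- Root vectors `F_{α_{i,i+d}}`. -/
def Fv : ℕ → ℕ → D.U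
  | 0, i => D.F i
  | d + 1, i => Fv d (i + 1) * D.F i - (q : ℂ)⁻¹ • (D.F i * Fv d (i + 1))

/-- The Hopf subalgebra `K` generated by `E_i, F_i (i ≠ r)` and all `K_j^{±1}`. -/
def Ksub (r : ℕ) : Subalgebra ℂ D.U :=
  Algebra.adjoin ℂ
    ({x : D.U | ∃ i ∈ Finset.Icc 1 (N - 1), i ≠ r ∧ (x = D.E i ∨ x = D.F i)} ∪
     {x : D.U | ∃ j ∈ Finset.Icc 1 (N - 1), x = D.Kg j ∨ x = D.Ki j})

/-- The subspace `K⁺U ⊆ U`. -/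
def Jsub (r : ℕ) : Submodule ℂ D.U :=
  Submodule.span ℂ
    {x : D.U | ∃ k ∈ D.Ksub r, Coalgebra.counit (R := ℂ) k = 0 ∧ ∃ u : D.U, x = k * u}

/-- The subspace `K⁺U ⊗ U + U ⊗ K⁺U` of `U ⊗ U`, i.e. the kernel of `π ⊗ π` where
`π : U → U/K⁺U` is the canonical projection. -/
def JUU (r : ℕ) : Submodule ℂ (D.U ⊗[ℂ] D.U) :=
  LinearMap.range (TensorProduct.map (D.Jsub r).subtype LinearMap.id) ⊔
  LinearMap.range (TensorProduct.map LinearMap.id (D.Jsub r).subtype)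

/-- `x ∈ U` represents a primitive element of the quotient coalgebra `Ū = U/K⁺U`. -/
def IsPrimitiveMod (r : ℕ) (x : D.U) : Prop :=
  Coalgebra.comul (R := ℂ) x - x ⊗ₜ[ℂ] 1 - 1 ⊗ₜ[ℂ] x ∈ D.JUU r

end UqslData

/-- Membership of the pair `(i,j)` in (the index set of) `Φ⁺_r`, the set of positive
roots `α_{ij} = α_i + ⋯ + α_j` of `sl_N` with `i ≤ r ≤ j`. -/
def inPhiR (N r : ℕ) (p : ℕ × ℕ) : Prop :=
  1 ≤ p.1 ∧ p.1 ≤ r ∧ r ≤ p.2 ∧ p.2 ≤ N - 1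



/-- The coradical filtration of `Ū = U/K⁺U`, written on representatives:
`corad 0` is the preimage in `U` of the coradical `ℂ·1` of the connected coalgebra `Ū`,
and `corad (k+1)` is the preimage of `Δ̄⁻¹(Ū ⊗ C_k + C₀ ⊗ Ū)`. -/
noncomputable def coradSeq {q : ℝ} {N : ℕ} (D : UqslData q N) (r : ℕ) :
    ℕ → Submodule ℂ D.U
  | 0 => Submodule.span ℂ {(1 : D.U)} ⊔ D.Jsub r
  | k + 1 =>
      Submodule.comap (Coalgebra.comul (R := ℂ))
        (LinearMap.range (TensorProduct.map LinearMap.id (coradSeq D r k).subtype) ⊔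
         LinearMap.range (TensorProduct.map
           (Submodule.span ℂ {(1 : D.U)} ⊔ D.Jsub r).subtype LinearMap.id))

/-- The span in `U` (together with `K⁺U`) of the monomials
`∏ F_{β_i}^{n_i} ∏ E_{β'_j}^{m_j}` of total degree `Σ n_i + Σ m_j ≤ k`; its image in
`Ū = U/K⁺U` is the term `Ū_k` of the filtration `F₁`. -/
noncomputable def monSpanLe {q : ℝ} {N : ℕ} (D : UqslData q N)
    (lF lE : List (ℕ × ℕ)) (k : ℕ) : Submodule ℂ D.U :=
  Submodule.span ℂ
    {x : D.U | ∃ n m : (ℕ × ℕ) → ℕ,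
      (lF.map n).sum + (lE.map m).sum ≤ k ∧
      x = (lF.map fun p => D.Fv (p.2 - p.1) p.1 ^ n p).prod *
          (lE.map fun p => D.Ev (p.2 - p.1) p.1 ^ m p).prod}

/-! ### Quantum root vectors of type `A` in an arbitrary algebra -/

/-- Iterated `q`-commutators of a family `e`, for the letters `e i, …, e (i + d)`. -/
def rootVec {A : Type*} [Ring A] [Algebra ℂ A] (Q : ℂ) (e : ℕ → A) : ℕ → ℕ → A
  | 0, i => e i
  | d + 1, i => e i * rootVec Q e d (i + 1) - Q⁻¹ • (rootVec Q e d (i + 1) * e i)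

/-- The quantum root vector attached to the positive root `ε_i - ε_k`, for `i < k`. -/
def rootBr {A : Type*} [Ring A] [Algebra ℂ A] (Q : ℂ) (e : ℕ → A) (i k : ℕ) : A :=
  rootVec Q e (k - i - 1) i

/-- The `q`-Serre relations of type `A_{N-1}`. -/
structure SerreFamily {A : Type*} [Ring A] [Algebra ℂ A] (Q : ℂ) (N : ℕ) (e : ℕ → A) : Prop where
  serre : ∀ i ∈ Finset.Icc 1 (N - 1), ∀ j ∈ Finset.Icc 1 (N - 1), ((i : ℤ) - j).natAbs = 1 →
      e i * e i * e j - (Q + Q⁻¹) • (e i * e j * e i) + e j * e i * e i = 0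
  far : ∀ i ∈ Finset.Icc 1 (N - 1), ∀ j ∈ Finset.Icc 1 (N - 1), 2 ≤ ((i : ℤ) - j).natAbs →
      e i * e j = e j * e i

section RootBr

variable {A : Type*} [Ring A] [Algebra ℂ A] {Q : ℂ} {N : ℕ} {e : ℕ → A}

lemma rootBr_self (i : ℕ) : rootBr Q e i (i + 1) = e i := by
  simp [rootBr, rootVec]

lemma rootBr_step {i k : ℕ} (h : i + 1 < k) :
    rootBr Q e i k = e i * rootBr Q e (i + 1) k - Q⁻¹ • (rootBr Q e (i + 1) k * e i) := by
  obtain ⟨d, rfl⟩ := Nat.exists_eq_add_of_lt h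
  have h1 : i + 1 + d + 1 - i - 1 = d + 1 := by omega
  have h2 : i + 1 + d + 1 - (i + 1) - 1 = d := by omega
  simp only [rootBr, h1, h2, rootVec]

/-- Induction on the length of an interval `i < k`, peeling off the left end. -/
@[elab_as_elim]
lemma interval_induction {k : ℕ} {P : (i : ℕ) → i < k → Prop}
    (base : ∀ i (h : i < k), i + 1 = k → P i h)
    (step : ∀ i (h : i < k) (h' : i + 1 < k), P (i + 1) h' → P i h) (i : ℕ) (h : i < k) :
    P i h := by
  obtain ⟨d, hd⟩ := Nat.exists_eq_add_of_lt h
  induction d generalizing i with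
  | zero => exact base _ h (by omega)
  | succ d ih => exact step _ h (by omega) (ih (i + 1) (by omega) (by omega))

lemma commute_rootBr {x : A} {i k : ℕ} (hik : i < k)
    (h : ∀ s, i ≤ s → s < k → Commute x (e s)) : Commute x (rootBr Q e i k) := by
  induction i, hik using interval_induction with
  | base i _ hi => subst hi; rw [rootBr_self]; exact h _ le_rfl (by omega)
  | step i _ hi ih =>
    have h1 := ih fun s hs hs' => h s (by omega) hs'
    have h2 := h i le_rfl (by omega)
    rw [rootBr_step hi]
    exact (h2.mul_right h1).sub_right ((h1.mul_right h2).smul_right _)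

lemma rootBr_split {i j k : ℕ} (hS : SerreFamily Q N e) (hi : 1 ≤ i) (hij : i < j) (hjk : j < k)
    (hk : k ≤ N) : rootBr Q e i k
      = rootBr Q e i j * rootBr Q e j k - Q⁻¹ • (rootBr Q e j k * rootBr Q e i j) := by
  induction i, hij using interval_induction with
  | base i _ h => subst h; rw [rootBr_self, rootBr_step hjk]
  | step i _ h ih =>
    have hc : Commute (e i) (rootBr Q e j k) := commute_rootBr hjk fun s hs hs' =>
      hS.far _ (by simp; omega) _ (by simp; omega) (by omega)
    have h1 := hc.eq
    have h2 := congrArg (rootBr Q e (i + 1) j * ·) h1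
    have h3 := congrArg (· * rootBr Q e (i + 1) j) h1
    rw [rootBr_step (by omega : i + 1 < k), rootBr_step h, ih (by omega)]
    simp only [mul_sub, sub_mul, smul_mul_assoc, mul_smul_comm, mul_assoc, smul_sub,
      smul_smul] at h2 h3 ⊢
    linear_combination (norm := (match_scalars <;> field_simp <;> ring_nf))
      Q⁻¹ • h2 - (Q⁻¹) • h3

lemma commute_rootBr_far {i j k l : ℕ} (hS : SerreFamily Q N e) (hi : 1 ≤ i) (hij : i < j)
    (hjk : j < k) (hkl : k < l) (hl : l ≤ N) : Commute (rootBr Q e i j) (rootBr Q e k l) :=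
  commute_rootBr hkl fun s hs hs' => (commute_rootBr hij fun t ht ht' =>
      hS.far _ (by simp; omega) _ (by simp; omega) (by omega)).symm

lemma simple_mul_rootBr {i k : ℕ} (hQ : Q ≠ 0) (hS : SerreFamily Q N e) (hi : 1 ≤ i)
    (hik : i + 1 < k) (hk : k ≤ N) : e i * rootBr Q e i k = Q • (rootBr Q e i k * e i) := by
  have base : e i * rootBr Q e i (i + 2) = Q • (rootBr Q e i (i + 2) * e i) := by
    have h1 := hS.serre i (by simp; omega) (i + 1) (by simp; omega) (by omega)
    rw [rootBr_step (by omega), rootBr_self]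
    simp only [mul_sub, sub_mul, smul_mul_assoc, mul_smul_comm, mul_assoc, smul_sub,
      smul_smul] at h1 ⊢
    linear_combination (norm := (match_scalars <;> field_simp <;> ring_nf)) h1
  rcases eq_or_lt_of_le (Nat.succ_le_of_lt hik) with rfl | h
  · exact base
  have hc : Commute (e i) (rootBr Q e (i + 2) k) := commute_rootBr h fun s hs hs' =>
      hS.far _ (by simp; omega) _ (by simp; omega) (by omega)
  have h2 := congrArg (rootBr Q e i (i + 2) * ·) hc.eq
  have h3 := congrArg (· * rootBr Q e i (i + 2)) hc.eq
  have h4 := congrArg (· * rootBr Q e (i + 2) k) base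
  have h5 := congrArg (rootBr Q e (i + 2) k * ·) base
  rw [rootBr_split hS hi (by omega : i < i + 2) h hk]
  simp only [mul_sub, sub_mul, smul_mul_assoc, mul_smul_comm, mul_assoc, smul_sub,
    smul_smul] at h2 h3 h4 h5 ⊢
  linear_combination (norm := (match_scalars <;> field_simp <;> ring_nf))
    h4 - Q⁻¹ • h3 + Q • h2 - Q⁻¹ • h5

lemma rootBr_mul_simple {i j : ℕ} (hQ : Q ≠ 0) (hS : SerreFamily Q N e) (hi : 1 ≤ i)
    (hij : i < j) (hk : j + 1 ≤ N) :
    rootBr Q e i (j + 1) * e j = Q • (e j * rootBr Q e i (j + 1)) := by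
  obtain ⟨m, rfl⟩ : ∃ m, j = m + 1 := ⟨j - 1, by omega⟩
  have base : rootBr Q e m (m + 2) * e (m + 1) = Q • (e (m + 1) * rootBr Q e m (m + 2)) := by
    rcases Nat.eq_zero_or_pos m with rfl | hm
    · omega
    have h1 := hS.serre (m + 1) (by simp; omega) m (by simp; omega) (by omega)
    rw [rootBr_step (by omega), rootBr_self]
    simp only [mul_sub, sub_mul, smul_mul_assoc, mul_smul_comm, mul_assoc, smul_sub,
      smul_smul] at h1 ⊢
    linear_combination (norm := (match_scalars <;> field_simp <;> ring_nf)) h1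
  rcases eq_or_lt_of_le (Nat.le_of_lt_succ hij) with rfl | h
  · exact base
  have hc : Commute (e (m + 1)) (rootBr Q e i m) := commute_rootBr h fun s hs hs' =>
      hS.far _ (by simp; omega) _ (by simp; omega) (by omega)
  have h2 := congrArg (rootBr Q e m (m + 2) * ·) hc.eq
  have h3 := congrArg (· * rootBr Q e m (m + 2)) hc.eq
  have h4 := congrArg (· * rootBr Q e i m) base
  have h5 := congrArg (rootBr Q e i m * ·) base
  rw [rootBr_split hS hi h (by omega : m < m + 1 + 1) hk]
  simp only [mul_sub, sub_mul, smul_mul_assoc, mul_smul_comm, mul_assoc, smul_sub,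
    smul_smul] at h2 h3 h4 h5 ⊢
  linear_combination (norm := (match_scalars <;> field_simp <;> ring_nf))
    h5 - Q • h3 + Q⁻¹ • h2 - Q⁻¹ • h4

end RootBr

section RootBr

variable {A : Type*} [Ring A] [Algebra ℂ A] {Q : ℂ} {N : ℕ} {e : ℕ → A}

/-- Swapping two overlapping `q`-commutators, expanding the left one. -/
lemma qcomm_overlap_left {a b ab bc x : A} (hQ : Q ≠ 0) (hx : x = a * bc - Q⁻¹ • (bc * a))
    (hab : ab = a * b - Q⁻¹ • (b * a)) (h : b * bc = Q • (bc * b)) :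
    ab * bc = bc * ab + Q • (x * b) - Q⁻¹ • (b * x) := by
  have h1 := congrArg (a * ·) h
  have h2 := congrArg (· * a) h
  subst hx hab
  simp only [mul_sub, sub_mul, smul_mul_assoc, mul_smul_comm, mul_assoc, smul_sub,
    smul_smul] at h1 h2 ⊢
  linear_combination (norm := (match_scalars <;> field_simp <;> ring_nf)) h1 - (Q⁻¹ * Q⁻¹) • h2

/-- Swapping two overlapping `q`-commutators, expanding the right one. -/
lemma qcomm_overlap_right {b c ab bc x : A} (hQ : Q ≠ 0) (hx : x = ab * c - Q⁻¹ • (c * ab))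
    (hbc : bc = b * c - Q⁻¹ • (c * b)) (h : ab * b = Q • (b * ab)) :
    ab * bc = bc * ab + Q • (b * x) - Q⁻¹ • (x * b) := by
  have h1 := congrArg (· * c) h
  have h2 := congrArg (c * ·) h
  subst hx hbc
  simp only [mul_sub, sub_mul, smul_mul_assoc, mul_smul_comm, mul_assoc, smul_sub,
    smul_smul] at h1 h2 ⊢
  linear_combination (norm := (match_scalars <;> field_simp <;> ring_nf)) h1 - (Q⁻¹ * Q⁻¹) • h2

lemma commute_simple_rootBr {i j k : ℕ} (hQ : Q ≠ 0) (hQ' : Q + Q⁻¹ ≠ 0)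
    (hS : SerreFamily Q N e) (hi : 1 ≤ i) (hij : i < j) (hjk : j + 1 < k) (hk : k ≤ N) :
    Commute (e j) (rootBr Q e i k) := by
  obtain ⟨m, rfl⟩ : ∃ m, j = m + 1 := ⟨j - 1, by omega⟩
  have hm : 1 ≤ m := by omega
  have base : Commute (e (m + 1)) (rootBr Q e m (m + 3)) := by
    have hx := rootBr_step (Q := Q) (e := e) (by omega : m + 1 < m + 3)
    have hx' := rootBr_split hS hm (by omega : m < m + 2) (by omega : m + 2 < m + 3) (by omega)
    have hab := rootBr_split hS hm (by omega : m < m + 1) (by omega : m + 1 < m + 2) (by omega)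
    have hbc := rootBr_split hS (by omega) (by omega : m + 1 < m + 2) (by omega : m + 2 < m + 3)
      (by omega)
    have h1 := simple_mul_rootBr hQ hS (by omega : 1 ≤ m + 1) (by omega : m + 1 + 1 < m + 3)
      (by omega)
    have h2 := rootBr_mul_simple hQ hS hm (by omega : m < m + 1) (by omega)
    simp only [rootBr_self] at hx hx' hab hbc h1 h2
    have e1 := qcomm_overlap_left hQ hx hab h1
    have e2 := qcomm_overlap_right hQ hx' hbc h2
    have e3 : (Q + Q⁻¹) • (e (m + 1) * rootBr Q e m (m + 3)) =
        (Q + Q⁻¹) • (rootBr Q e m (m + 3) * e (m + 1)) := by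
      rw [e1] at e2
      linear_combination (norm := module) - e2
    exact smul_right_injective A hQ' e3
  have base' : Commute (e (m + 1)) (rootBr Q e i (m + 3)) := by
    rcases eq_or_lt_of_le (Nat.le_of_lt_succ hij) with rfl | h
    · exact base
    have hc : Commute (e (m + 1)) (rootBr Q e i m) := commute_rootBr h fun s hs hs' =>
      hS.far _ (by simp; omega) _ (by simp; omega) (by omega)
    rw [rootBr_split hS hi h (by omega : m < m + 3) (by omega)]
    exact (hc.mul_right base).sub_right ((base.mul_right hc).smul_right _)
  rcases eq_or_lt_of_le (Nat.succ_le_of_lt hjk) with rfl | h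
  · exact base'
  have hc : Commute (e (m + 1)) (rootBr Q e (m + 3) k) := commute_rootBr h fun s hs hs' =>
      hS.far _ (by simp; omega) _ (by simp; omega) (by omega)
  rw [rootBr_split hS hi (by omega : i < m + 3) h hk]
  exact (base'.mul_right hc).sub_right ((hc.mul_right base').smul_right _)

lemma commute_rootBr_nested {i j k l : ℕ} (hQ : Q ≠ 0) (hQ' : Q + Q⁻¹ ≠ 0)
    (hS : SerreFamily Q N e) (hi : 1 ≤ i) (hij : i < j) (hjk : j < k) (hkl : k < l) (hl : l ≤ N) :
    Commute (rootBr Q e i l) (rootBr Q e j k) :=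
  commute_rootBr hjk fun s hs hs' =>
    (commute_simple_rootBr hQ hQ' hS hi (by omega) (by omega) hl).symm

lemma rootBr_mul_same_start {i k l : ℕ} (hQ : Q ≠ 0) (hQ' : Q + Q⁻¹ ≠ 0)
    (hS : SerreFamily Q N e) (hi : 1 ≤ i) (hik : i < k) (hkl : k < l) (hl : l ≤ N) :
    rootBr Q e i k * rootBr Q e i l = Q • (rootBr Q e i l * rootBr Q e i k) := by
  have h0 := simple_mul_rootBr hQ hS hi (by omega : i + 1 < l) hl
  rcases eq_or_lt_of_le (Nat.succ_le_of_lt hik) with rfl | h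
  · rwa [Nat.succ_eq_add_one, rootBr_self]
  have hc := (commute_rootBr_nested hQ hQ' hS hi (by omega : i < i + 1) h hkl hl).eq
  have h1 := congrArg (· * rootBr Q e (i + 1) k) h0
  have h2 := congrArg (rootBr Q e (i + 1) k * ·) h0
  have h3 := congrArg (e i * ·) hc
  have h4 := congrArg (· * e i) hc
  rw [rootBr_step h]
  simp only [mul_sub, sub_mul, smul_mul_assoc, mul_smul_comm, mul_assoc, smul_sub,
    smul_smul] at h1 h2 h3 h4 ⊢
  linear_combination (norm := (match_scalars <;> field_simp <;> ring_nf))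
    h1 - Q⁻¹ • h2 - h3 + h4

lemma rootBr_mul_same_end {i j k : ℕ} (hQ : Q ≠ 0) (hQ' : Q + Q⁻¹ ≠ 0)
    (hS : SerreFamily Q N e) (hi : 1 ≤ i) (hij : i < j) (hjk : j < k) (hk : k ≤ N) :
    rootBr Q e i k * rootBr Q e j k = Q • (rootBr Q e j k * rootBr Q e i k) := by
  obtain ⟨l, rfl⟩ : ∃ l, k = l + 1 := ⟨k - 1, by omega⟩
  have h0 := rootBr_mul_simple hQ hS hi (by omega : i < l) hk
  rcases eq_or_lt_of_le (Nat.le_of_lt_succ hjk) with rfl | h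
  · rwa [rootBr_self]
  have hc := (commute_rootBr_nested hQ hQ' hS hi hij h (by omega : l < l + 1) hk).eq
  have h1 := congrArg (· * rootBr Q e j l) h0
  have h2 := congrArg (rootBr Q e j l * ·) h0
  have h3 := congrArg (e l * ·) hc
  have h4 := congrArg (· * e l) hc
  rw [rootBr_split hS (by omega : 1 ≤ j) h (by omega : l < l + 1) hk, rootBr_self]
  simp only [mul_sub, sub_mul, smul_mul_assoc, mul_smul_comm, mul_assoc, smul_sub,
    smul_smul] at h1 h2 h3 h4 ⊢
  linear_combination (norm := (match_scalars <;> field_simp <;> ring_nf))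
    h2 - Q⁻¹ • h1 - h3 + h4

lemma rootBr_mul_overlap {i j k l : ℕ} (hQ : Q ≠ 0) (hQ' : Q + Q⁻¹ ≠ 0)
    (hS : SerreFamily Q N e) (hi : 1 ≤ i) (hij : i < j) (hjk : j < k) (hkl : k < l) (hl : l ≤ N) :
    rootBr Q e i k * rootBr Q e j l =
      rootBr Q e j l * rootBr Q e i k + (Q - Q⁻¹) • (rootBr Q e i l * rootBr Q e j k) := by
  rw [qcomm_overlap_left hQ (rootBr_split hS hi hij (hjk.trans hkl) hl)
    (rootBr_split hS hi hij hjk (by omega))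
    (rootBr_mul_same_start hQ hQ' hS (by omega) hjk hkl hl),
    ← (commute_rootBr_nested hQ hQ' hS hi hij hjk hkl hl).eq]
  module

lemma rootBr_scale {x : A} {i k : ℕ} (hik : i < k) (c : ℕ → ℂ)
    (h : ∀ s, i ≤ s → s < k → x * e s = c s • (e s * x)) :
    x * rootBr Q e i k = (∏ s ∈ Finset.Ico i k, c s) • (rootBr Q e i k * x) := by
  induction i, hik using interval_induction with
  | base i _ hi => subst hi; simpa [rootBr_self] using h i le_rfl (by omega)
  | step i _ hi ih =>
    have h1 := ih fun s hs hs' => h s (by omega) hs'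
    have h2 := h i le_rfl (by omega)
    rw [Finset.prod_eq_prod_Ico_succ_bot (by omega : i < k), rootBr_step hi]
    set C := ∏ s ∈ Finset.Ico (i + 1) k, c s
    have h3 := congrArg (e i * ·) h1
    have h4 := congrArg (· * e i) h1
    have h5 := congrArg (rootBr Q e (i + 1) k * ·) h2
    have h6 := congrArg (· * rootBr Q e (i + 1) k) h2
    simp only [mul_sub, sub_mul, smul_mul_assoc, mul_smul_comm, mul_assoc, smul_sub,
      smul_smul] at h3 h4 h5 h6 ⊢
    linear_combination (norm := module) h6 + c i • h3 - Q⁻¹ • h4 - (Q⁻¹ * C) • h5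

end RootBr

section Relations

variable {V : Type} [Ring V] [Algebra ℂ V] {q : ℝ} {N : ℕ} {e f kg ki : ℕ → V}

lemma UqslRels.serre (h : UqslRels q N e f kg ki) : SerreFamily (q : ℂ) N e :=
  ⟨h.2.2.2.2.2.1, h.2.2.2.2.2.2.1⟩

/-- The Chevalley anti-automorphism exchanging `e` and `f`. -/
lemma UqslRels.op (hq : (q : ℂ) ≠ 0) (h : UqslRels q N e f kg ki) :
    UqslRels q N (fun i => MulOpposite.op (f i)) (fun i => MulOpposite.op (e i))
      (fun i => MulOpposite.op (kg i)) (fun i => MulOpposite.op (ki i)) := by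
  obtain ⟨h1, h2, h3, h4, h5, h6, h7, h8, h9⟩ := h
  simp only [UqslRels, ← MulOpposite.op_mul, ← MulOpposite.op_smul, ← MulOpposite.op_sub,
    ← MulOpposite.op_add, ← MulOpposite.op_one, ← MulOpposite.op_zero, MulOpposite.op_inj]
  refine ⟨fun i hi => (h1 i hi).symm, fun i hi j hj => (h2 i hi j hj).symm, fun i hi j hj => ?_,
    fun i hi j hj => ?_, fun i hi j hj => ?_, fun i hi j hj hij => ?_,
    fun i hi j hj hij => (h9 i hi j hj hij).symm, fun i hi j hj hij => ?_,
    fun i hi j hj hij => (h7 i hi j hj hij).symm⟩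
  · rw [h4 i hi j hj, smul_smul, ← zpow_add₀ hq]; simp
  · rw [h3 i hi j hj, smul_smul, ← zpow_add₀ hq]; simp
  · have := h5 j hj i hi
    rw [this]
    by_cases hij : i = j
    · subst hij; simp
    · simp [hij, Ne.symm hij]
  · rw [← h8 i hi j hj hij]; simp only [mul_assoc]; abel
  · rw [← h6 i hi j hj hij]; simp only [mul_assoc]; abel

lemma UqslRels.ki_mul (hq : (q : ℂ) ≠ 0) (h : UqslRels q N e f kg ki) {i j : ℕ}
    (hi : i ∈ Finset.Icc 1 (N - 1)) (hj : j ∈ Finset.Icc 1 (N - 1)) :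
    ki i * e j = ((q : ℂ) ^ (-cartanSL i j)) • (e j * ki i) := by
  obtain ⟨h1, h2, h3, -⟩ := h
  have a := congrArg (fun x => (q : ℂ) ^ (-cartanSL i j) • (ki i * x * ki i)) (h3 i hi j hj)
  have b1 := (h1 i hi).1
  have b2 := (h1 i hi).2
  simp only [mul_smul_comm, smul_mul_assoc, smul_smul, ← zpow_add₀ hq, neg_add_cancel, zpow_zero,
    one_smul, mul_assoc, b1, mul_one] at a
  simp only [← mul_assoc, b2, one_mul] at a
  exact a.symm

lemma UqslRels.rootBr_mul_f_self (hq : (q : ℂ) ≠ 0) (hq' : (q : ℂ) - (q : ℂ)⁻¹ ≠ 0)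
    (h : UqslRels q N e f kg ki) {i k : ℕ} (hi : 1 ≤ i) (hik : i + 1 < k) (hk : k ≤ N) :
    rootBr (q : ℂ) e i k * f i =
      f i * rootBr (q : ℂ) e i k - rootBr (q : ℂ) e (i + 1) k * ki i := by
  have hi' : i ∈ Finset.Icc 1 (N - 1) := by simp; omega
  have hc : Commute (f i) (rootBr (q : ℂ) e (i + 1) k) := commute_rootBr hik fun s hs hs' => by
    have := h.2.2.2.2.1 s (by simp; omega) i hi'
    rw [if_neg (by omega), sub_eq_zero] at this
    exact this.symm
  have h1 := hc.eq
  have h2 := h.2.2.2.2.1 i hi' i hi'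
  rw [if_pos rfl] at h2
  have hprod : ∀ c : ℂ, (∏ s ∈ Finset.Ico (i + 1) k, if s = i + 1 then c else 1) = c := by
    intro c
    rw [Finset.prod_ite_eq', if_pos (by simp; omega)]
  have hkg : kg i * rootBr (q : ℂ) e (i + 1) k
      = (q : ℂ)⁻¹ • (rootBr (q : ℂ) e (i + 1) k * kg i) := by
    rw [rootBr_scale hik (fun s => if s = i + 1 then (q : ℂ)⁻¹ else 1) _, hprod]
    intro s hs hs'
    rw [h.2.2.1 i hi' s (by simp; omega), cartanSL, if_neg (by omega)]
    by_cases hsi : s = i + 1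
    · rw [if_pos (by omega), if_pos hsi, zpow_neg_one]
    · rw [if_neg (by omega), if_neg hsi, zpow_zero]
  have hki : ki i * rootBr (q : ℂ) e (i + 1) k
      = (q : ℂ) • (rootBr (q : ℂ) e (i + 1) k * ki i) := by
    rw [rootBr_scale hik (fun s => if s = i + 1 then (q : ℂ) else 1) _, hprod]
    intro s hs hs'
    rw [h.ki_mul hq hi' (by simp; omega : s ∈ _), cartanSL, if_neg (by omega)]
    by_cases hsi : s = i + 1
    · rw [if_pos (by omega), if_pos hsi, neg_neg, zpow_one]
    · rw [if_neg (by omega), if_neg hsi, neg_zero, zpow_zero]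
  rw [rootBr_step hik]
  have h3 := congrArg (e i * ·) h1
  have h4 := congrArg (· * e i) h1
  have h5 := congrArg (rootBr (q : ℂ) e (i + 1) k * ·) h2
  have h6 := congrArg (· * rootBr (q : ℂ) e (i + 1) k) h2
  simp only [mul_sub, sub_mul, smul_mul_assoc, mul_smul_comm, mul_assoc, smul_sub]
    at h3 h4 h5 h6 ⊢
  set x := rootBr (q : ℂ) e (i + 1) k
  set Q : ℂ := (q : ℂ)
  have hu : (Q - Q⁻¹)⁻¹ * (Q - Q⁻¹) = 1 := inv_mul_cancel₀ hq'
  set u := (Q - Q⁻¹)⁻¹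
  linear_combination (norm := skip) - h3 + h6 + u • hkg - u • hki + Q⁻¹ • h4 - Q⁻¹ • h5
    - hu • (x * ki i)
  module

lemma UqslRels.rootBr_mul_f_last (hq : (q : ℂ) ≠ 0) (hq' : (q : ℂ) - (q : ℂ)⁻¹ ≠ 0)
    (h : UqslRels q N e f kg ki) {i j : ℕ} (hi : 1 ≤ i) (hij : i < j) (hk : j + 1 ≤ N) :
    rootBr (q : ℂ) e i (j + 1) * f j =
      f j * rootBr (q : ℂ) e i (j + 1) + kg j * rootBr (q : ℂ) e i j := by
  have hj' : j ∈ Finset.Icc 1 (N - 1) := by simp; omega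
  have hc : Commute (f j) (rootBr (q : ℂ) e i j) := commute_rootBr hij fun s hs hs' => by
    have := h.2.2.2.2.1 s (by simp; omega) j hj'
    rw [if_neg (by omega), sub_eq_zero] at this
    exact this.symm
  have h1 := hc.eq
  have h2 := h.2.2.2.2.1 j hj' j hj'
  rw [if_pos rfl] at h2
  have hprod : ∀ c : ℂ, (∏ s ∈ Finset.Ico i j, if s = j - 1 then c else 1) = c := by
    intro c
    rw [Finset.prod_ite_eq', if_pos (by simp; omega)]
  have hkg : kg j * rootBr (q : ℂ) e i j = (q : ℂ)⁻¹ • (rootBr (q : ℂ) e i j * kg j) := by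
    rw [rootBr_scale hij (fun s => if s = j - 1 then (q : ℂ)⁻¹ else 1) _, hprod]
    intro s hs hs'
    rw [h.2.2.1 j hj' s (by simp; omega), cartanSL, if_neg (by omega)]
    by_cases hsi : s = j - 1
    · rw [if_pos (by omega), if_pos hsi, zpow_neg_one]
    · rw [if_neg (by omega), if_neg hsi, zpow_zero]
  have hki : ki j * rootBr (q : ℂ) e i j = (q : ℂ) • (rootBr (q : ℂ) e i j * ki j) := by
    rw [rootBr_scale hij (fun s => if s = j - 1 then (q : ℂ) else 1) _, hprod]
    intro s hs hs'
    rw [h.ki_mul hq hj' (by simp; omega : s ∈ _), cartanSL, if_neg (by omega)]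
    by_cases hsi : s = j - 1
    · rw [if_pos (by omega), if_pos hsi, neg_neg, zpow_one]
    · rw [if_neg (by omega), if_neg hsi, neg_zero, zpow_zero]
  rw [rootBr_split h.serre hi hij (by omega : j < j + 1) hk, rootBr_self]
  have h3 := congrArg (e j * ·) h1
  have h4 := congrArg (· * e j) h1
  have h5 := congrArg (rootBr (q : ℂ) e i j * ·) h2
  have h6 := congrArg (· * rootBr (q : ℂ) e i j) h2
  simp only [mul_sub, sub_mul, smul_mul_assoc, mul_smul_comm, mul_assoc, smul_sub]
    at h3 h4 h5 h6 ⊢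
  set x := rootBr (q : ℂ) e i j
  set Q : ℂ := (q : ℂ)
  have hu : (Q - Q⁻¹)⁻¹ * (Q - Q⁻¹) = 1 := inv_mul_cancel₀ hq'
  have hQ : Q * Q⁻¹ = 1 := mul_inv_cancel₀ hq
  set u := (Q - Q⁻¹)⁻¹
  linear_combination (norm := skip) h5 - h4 - Q⁻¹ • h6 + Q⁻¹ • h3
    - (u * Q) • hkg  + (u * Q⁻¹) • hki + hu • (kg j * x) - (u * hQ) • (x * kg j - x * ki j)
  module

end Relations

section Straightening

variable {V : Type} [Ring V] [Algebra ℂ V] {q : ℝ} {N : ℕ} {e f kg ki : ℕ → V}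

lemma UqslRels.commute_e_f (h : UqslRels q N e f kg ki) {i j : ℕ} (hi : i ∈ Finset.Icc 1 (N - 1))
    (hj : j ∈ Finset.Icc 1 (N - 1)) (hij : i ≠ j) : Commute (e i) (f j) := by
  have := h.2.2.2.2.1 i hi j hj
  rwa [if_neg hij, sub_eq_zero] at this

lemma UqslRels.commute_rootBr_f (h : UqslRels q N e f kg ki) {i k j : ℕ} (hi : 1 ≤ i) (hik : i < k)
    (hk : k ≤ N) (hj : j ∈ Finset.Icc 1 (N - 1)) (hj' : j < i ∨ k ≤ j) :
    Commute (rootBr (q : ℂ) e i k) (f j) :=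
  (commute_rootBr hik fun s _ _ =>
    (h.commute_e_f (by simp; omega) hj (by omega)).symm).symm

lemma UqslRels.kg_scale (hq : (q : ℂ) ≠ 0) (h : UqslRels q N e f kg ki) {i k j : ℕ} (hi : 1 ≤ i)
    (hik : i < k) (hk : k ≤ N) (hj : j ∈ Finset.Icc 1 (N - 1)) :
    ∃ s : ℂ, s ≠ 0 ∧ kg j * rootBr (q : ℂ) e i k = s • (rootBr (q : ℂ) e i k * kg j) :=
  ⟨_, Finset.prod_ne_zero_iff.2 fun _ _ => zpow_ne_zero _ hq, rootBr_scale hik _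
    fun s _ _ => h.2.2.1 j hj s (by simp; omega)⟩

lemma UqslRels.ki_scale (hq : (q : ℂ) ≠ 0) (h : UqslRels q N e f kg ki) {i k j : ℕ} (hi : 1 ≤ i)
    (hik : i < k) (hk : k ≤ N) (hj : j ∈ Finset.Icc 1 (N - 1)) :
    ∃ s : ℂ, s ≠ 0 ∧ ki j * rootBr (q : ℂ) e i k = s • (rootBr (q : ℂ) e i k * ki j) :=
  ⟨_, Finset.prod_ne_zero_iff.2 fun _ _ => zpow_ne_zero _ hq, rootBr_scale hik _
    fun s _ _ => h.ki_mul hq hj (by simp; omega)⟩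

lemma UqslRels.commute_rootBr_f_interior (hq : (q : ℂ) ≠ 0) (hq' : (q : ℂ) - (q : ℂ)⁻¹ ≠ 0)
    (h : UqslRels q N e f kg ki) {i j k : ℕ} (hi : 1 ≤ i) (hij : i < j) (hjk : j + 1 < k)
    (hk : k ≤ N) : Commute (rootBr (q : ℂ) e i k) (f j) := by
  have hj : j ∈ Finset.Icc 1 (N - 1) := by simp; omega
  have h1 := h.rootBr_mul_f_last hq hq' hi hij (by omega)
  have h2 := (h.commute_rootBr_f (by omega) hjk hk hj (by omega)).eq
  have h3 : kg j * rootBr (q : ℂ) e (j + 1) k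
      = (q : ℂ)⁻¹ • (rootBr (q : ℂ) e (j + 1) k * kg j) := by
    rw [rootBr_scale hjk (fun s => if s = j + 1 then (q : ℂ)⁻¹ else 1) _, Finset.prod_ite_eq',
      if_pos (by simp; omega)]
    intro s hs hs'
    rw [h.2.2.1 j hj s (by simp; omega), cartanSL, if_neg (by omega)]
    by_cases hsi : s = j + 1
    · rw [if_pos (by omega), if_pos hsi, zpow_neg_one]
    · rw [if_neg (by omega), if_neg hsi, zpow_zero]
  have h4 := (commute_rootBr_far h.serre hi hij (by omega : j < j + 1) hjk hk).eq
  have a1 := congrArg (· * rootBr (q : ℂ) e (j + 1) k) h1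
  have a2 := congrArg (rootBr (q : ℂ) e (j + 1) k * ·) h1
  have a3 := congrArg (rootBr (q : ℂ) e i (j + 1) * ·) h2
  have a4 := congrArg (· * rootBr (q : ℂ) e i (j + 1)) h2
  have a5 := congrArg (· * rootBr (q : ℂ) e i j) h3
  have a6 := congrArg (kg j * ·) h4
  rw [commute_iff_eq, rootBr_split h.serre hi (by omega : i < j + 1) hjk hk]
  simp only [mul_sub, sub_mul, mul_add, add_mul, smul_mul_assoc, mul_smul_comm, mul_assoc]
    at a1 a2 a3 a4 a5 a6 ⊢
  linear_combination (norm := module) a1 + a3 - (q : ℂ)⁻¹ • a2 - (q : ℂ)⁻¹ • a4 + a6 + a5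

/-- Torus letters: `1` and the generators `kg j`, `ki j`. -/
def IsTorusLetter (N : ℕ) (kg ki : ℕ → V) (t : V) : Prop :=
  t = 1 ∨ ∃ j ∈ Finset.Icc 1 (N - 1), t = kg j ∨ t = ki j

/-- Letters generating the Levi part `K`. -/
def IsLeviLetter (N r : ℕ) (e f kg ki : ℕ → V) (x : V) : Prop :=
  (∃ i ∈ Finset.Icc 1 (N - 1), i ≠ r ∧ (x = e i ∨ x = f i)) ∨
    ∃ j ∈ Finset.Icc 1 (N - 1), x = kg j ∨ x = ki j

lemma UqslRels.straighten (hq : (q : ℂ) ≠ 0) (hq' : (q : ℂ) - (q : ℂ)⁻¹ ≠ 0)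
    (hQ' : (q : ℂ) + (q : ℂ)⁻¹ ≠ 0) (h : UqslRels q N e f kg ki) {r i k : ℕ} {x : V}
    (hx : IsLeviLetter N r e f kg ki x) (hi : 1 ≤ i) (hir : i ≤ r) (hrk : r < k) (hk : k ≤ N) :
    ∃ (c d s : ℂ) (t : V) (i' k' : ℕ), c ≠ 0 ∧ s ≠ 0 ∧ IsTorusLetter N kg ki t ∧
      1 ≤ i' ∧ i' ≤ r ∧ r < k' ∧ k' ≤ N ∧
      rootBr (q : ℂ) e i k * x = c • (x * rootBr (q : ℂ) e i k)
        + d • (t * rootBr (q : ℂ) e i' k') ∧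
      t * rootBr (q : ℂ) e i' k' = s • (rootBr (q : ℂ) e i' k' * t) := by
  have hcomm : ∀ c : ℂ, c ≠ 0 → rootBr (q : ℂ) e i k * x = c • (x * rootBr (q : ℂ) e i k) →
      ∃ (c d s : ℂ) (t : V) (i' k' : ℕ), c ≠ 0 ∧ s ≠ 0 ∧ IsTorusLetter N kg ki t ∧
      1 ≤ i' ∧ i' ≤ r ∧ r < k' ∧ k' ≤ N ∧
      rootBr (q : ℂ) e i k * x = c • (x * rootBr (q : ℂ) e i k)
        + d • (t * rootBr (q : ℂ) e i' k') ∧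
      t * rootBr (q : ℂ) e i' k' = s • (rootBr (q : ℂ) e i' k' * t) := fun c hc hx =>
    ⟨c, 0, 1, 1, i, k, hc, one_ne_zero, Or.inl rfl, hi, hir, hrk, hk, by rw [hx]; simp, by simp⟩
  have hS := h.serre
  have hqi := inv_ne_zero hq
  rcases hx with ⟨j, hj, hjr, rfl | rfl⟩ | ⟨j, hj, rfl | rfl⟩
  · have hj' := Finset.mem_Icc.1 hj
    by_cases h1 : j + 1 < i ∨ k < j
    · refine hcomm 1 one_ne_zero ?_
      rw [one_smul]
      exact (commute_rootBr (by omega : i < k) fun s hs hs' =>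
        hS.far j hj s (by simp; omega) (by omega)).eq.symm
    by_cases h2 : j + 1 = i
    · subst h2
      refine ⟨q, -q, 1, 1, j, k, hq, one_ne_zero, Or.inl rfl, by omega, by omega, hrk, hk, ?_,
        by simp⟩
      rw [rootBr_step (by omega : j + 1 < k), one_mul, smul_sub, smul_smul]
      simp [hq]
    by_cases h3 : j = i
    · subst h3
      refine hcomm _ hqi ?_
      rw [simple_mul_rootBr hq hS hi (by omega) hk, smul_smul, inv_mul_cancel₀ hq, one_smul]
    by_cases h4 : j + 1 = k
    · subst h4
      exact hcomm _ hq (rootBr_mul_simple hq hS hi (by omega) hk)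
    by_cases h5 : j = k
    · subst h5
      refine ⟨(q : ℂ)⁻¹, 1, 1, 1, i, j + 1, hqi, one_ne_zero, Or.inl rfl, hi, hir, by omega,
        by omega, ?_, by simp⟩
      rw [rootBr_split hS hi (by omega : i < j) (by omega : j < j + 1) (by omega), rootBr_self]
      simp
    · refine hcomm 1 one_ne_zero ?_
      rw [one_smul]
      exact (commute_simple_rootBr hq hQ' hS hi (by omega) (by omega) hk).eq.symm
  · have hj' := Finset.mem_Icc.1 hj
    by_cases h1 : j < i ∨ k ≤ j
    · refine hcomm 1 one_ne_zero ?_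
      rw [one_smul]
      exact (h.commute_rootBr_f hi (by omega) hk hj h1).eq
    by_cases h2 : j = i
    · subst h2
      obtain ⟨s, hs, hs'⟩ := h.ki_scale hq (i := j + 1) (k := k) (by omega) (by omega) hk hj
      refine ⟨1, -s⁻¹, s, ki j, j + 1, k, one_ne_zero, hs, Or.inr ⟨j, hj, Or.inr rfl⟩, by omega,
        by omega, hrk, hk, ?_, hs'⟩
      rw [h.rootBr_mul_f_self hq hq' hi (by omega) hk, hs', smul_smul, neg_mul,
        inv_mul_cancel₀ hs]
      module
    by_cases h3 : j + 1 = k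
    · subst h3
      obtain ⟨s, hs, hs'⟩ := h.kg_scale hq hi (by omega : i < j) (by omega) hj
      refine ⟨1, 1, s, kg j, i, j, one_ne_zero, hs, Or.inr ⟨j, hj, Or.inl rfl⟩, by omega,
        by omega, by omega, by omega, ?_, hs'⟩
      rw [h.rootBr_mul_f_last hq hq' hi (by omega) hk]
      module
    · refine hcomm 1 one_ne_zero ?_
      rw [one_smul]
      exact (h.commute_rootBr_f_interior hq hq' hi (by omega) (by omega) hk).eq
  · obtain ⟨s, hs, hs'⟩ := h.kg_scale hq hi (by omega : i < k) hk hj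
    refine hcomm s⁻¹ (inv_ne_zero hs) ?_
    rw [hs', smul_smul, inv_mul_cancel₀ hs, one_smul]
  · obtain ⟨s, hs, hs'⟩ := h.ki_scale hq hi (by omega : i < k) hk hj
    refine hcomm s⁻¹ (inv_ne_zero hs) ?_
    rw [hs', smul_smul, inv_mul_cancel₀ hs, one_smul]

/-- Reordering of two root vectors of `Φ⁺_r`; the correction term has smaller total weight. -/
lemma SerreFamily.reorder {A : Type*} [Ring A] [Algebra ℂ A] {e : ℕ → A} {Q : ℂ} (hQ : Q ≠ 0)
    (hQ' : Q + Q⁻¹ ≠ 0) (hS : SerreFamily Q N e) {r i k j l : ℕ} (hi : 1 ≤ i) (hir : i ≤ r)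
    (hrk : r < k) (hk : k ≤ N) (hj : 1 ≤ j) (hjr : j ≤ r) (hrl : r < l) (hl : l ≤ N) :
    ∃ c d : ℂ, rootBr Q e i k * rootBr Q e j l = c • (rootBr Q e j l * rootBr Q e i k)
      + d • (rootBr Q e (min i j) (max k l) * rootBr Q e (max i j) (min k l)) ∧
      (d = 0 ∨ min i j * (max k l - 1) + max i j * (min k l - 1) < i * (k - 1) + j * (l - 1)) := by
  have hcomm : ∀ c : ℂ, rootBr Q e i k * rootBr Q e j l = c • (rootBr Q e j l * rootBr Q e i k) →
      ∃ c d : ℂ, rootBr Q e i k * rootBr Q e j l = c • (rootBr Q e j l * rootBr Q e i k)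
      + d • (rootBr Q e (min i j) (max k l) * rootBr Q e (max i j) (min k l)) ∧
      (d = 0 ∨ min i j * (max k l - 1) + max i j * (min k l - 1) < i * (k - 1) + j * (l - 1)) :=
    fun c hc => ⟨c, 0, by rw [hc]; simp, Or.inl rfl⟩
  have hlt : ∀ a b c d : ℕ, a < b → 0 < c → c < d →
      a * (d - 1) + b * (c - 1) < a * (c - 1) + b * (d - 1) := by
    intro a b c d h1 h0 h2
    obtain ⟨x, rfl⟩ := Nat.exists_eq_add_of_lt h1
    obtain ⟨z, rfl⟩ := Nat.exists_eq_add_of_lt h0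
    obtain ⟨y, rfl⟩ := Nat.exists_eq_add_of_lt h2
    rw [show 0 + z + 1 + y + 1 - 1 = z + y + 1 by omega, show 0 + z + 1 - 1 = z by omega]
    nlinarith
  rcases lt_trichotomy i j with h1 | rfl | h1 <;> rcases lt_trichotomy k l with h2 | rfl | h2
  · refine ⟨1, Q - Q⁻¹, ?_, Or.inr ?_⟩ <;>
      rw [min_eq_left h1.le, max_eq_right h1.le, min_eq_left h2.le, max_eq_right h2.le]
    · rw [one_smul]
      exact rootBr_mul_overlap hQ hQ' hS hi h1 (by omega) h2 hl
    · exact hlt _ _ _ _ h1 (by omega) h2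
  · exact hcomm _ (rootBr_mul_same_end hQ hQ' hS hi h1 (by omega) hk)
  · exact hcomm 1 (by
      rw [one_smul]
      exact (commute_rootBr_nested hQ hQ' hS hi h1 (by omega) h2 hk).eq)
  · exact hcomm _ (rootBr_mul_same_start hQ hQ' hS hi (by omega) h2 hl)
  · exact hcomm 1 (by rw [one_smul])
  · refine hcomm Q⁻¹ ?_
    rw [rootBr_mul_same_start hQ hQ' hS hi (by omega) h2 hk, smul_smul, inv_mul_cancel₀ hQ,
      one_smul]
  · exact hcomm 1 (by
      rw [one_smul]
      exact (commute_rootBr_nested hQ hQ' hS hj h1 (by omega) h2 hl).eq.symm)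
  · refine hcomm Q⁻¹ ?_
    rw [rootBr_mul_same_end hQ hQ' hS hj h1 (by omega) hk, smul_smul, inv_mul_cancel₀ hQ, one_smul]
  · refine ⟨1, -(Q - Q⁻¹), ?_, Or.inr ?_⟩ <;>
      rw [min_eq_right h1.le, max_eq_left h1.le, min_eq_right h2.le, max_eq_left h2.le]
    · rw [rootBr_mul_overlap hQ hQ' hS hj h1 (by omega) h2 hk]
      module
    · have := hlt _ _ _ _ h1 (by omega) h2
      omega

end Straightening

lemma exists_perm_sorted {ι V : Type*} [Ring V] {y : ι → V} {l : List ι} (hl : l.Nodup)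
    (w : List ι) (hw : ∀ p ∈ w, p ∈ l) :
    ∃ (w' : List ι) (c : ι → ℕ), w.Perm w' ∧ (l.map c).sum = w.length ∧
      (w'.map y).prod = (l.map fun p => y p ^ c p).prod := by
  classical
  have hperm : w.Perm (l.flatMap fun p => List.replicate (w.count p) p) := by
    rw [List.perm_iff_count]
    intro a
    rw [List.count_flatMap, List.sum_map_eq_nsmul_single a]
    · by_cases ha : a ∈ l
      · simp [List.count_eq_one_of_mem hl ha]
      · simp [List.count_eq_zero_of_not_mem ha,
          List.count_eq_zero_of_not_mem fun h => ha (hw a h)]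
    · intro a' ha' _
      simp [List.count_replicate, ha']
  refine ⟨_, fun p => w.count p, hperm, ?_, ?_⟩
  · rw [hperm.length_eq, List.length_flatMap]; simp
  · clear hperm hw hl
    induction l with
    | nil => simp
    | cons a l ih => simp [ih]

section Reordering

variable {ι V : Type*} [Ring V] [Algebra ℂ V]

/-- A family `y` of elements indexed by `Φ` can be reordered, up to scalars and corrections of
smaller weight. -/
def Reorderable (Φ : Set ι) (stat : ι → ℕ) (y : ι → V) : Prop :=
  ∀ p ∈ Φ, ∀ p' ∈ Φ, ∃ (c d : ℂ) (s t : ι), s ∈ Φ ∧ t ∈ Φ ∧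
    y p * y p' = c • (y p' * y p) + d • (y s * y t) ∧ (d = 0 ∨ stat s + stat t < stat p + stat p')

/-- Span of the words of length `n` in the letters `y p`, `p ∈ Φ`. -/
def wordSpan (Φ : Set ι) (y : ι → V) (n : ℕ) : Submodule ℂ V :=
  Submodule.span ℂ {x | ∃ v : List ι, (∀ p ∈ v, p ∈ Φ) ∧ v.length = n ∧ x = (v.map y).prod}

/-- Span of the words of length `n` and weight `< m`. -/
def lowSpan (Φ : Set ι) (stat : ι → ℕ) (y : ι → V) (n m : ℕ) : Submodule ℂ V :=
  Submodule.span ℂ {x | ∃ v : List ι, (∀ p ∈ v, p ∈ Φ) ∧ v.length = n ∧ (v.map stat).sum < m ∧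
    x = (v.map y).prod}

/-- Span of the ordered monomials of degree `n` in the letters `y p`, `p ∈ l`. -/
def sortedSpan (y : ι → V) (l : List ι) (n : ℕ) : Submodule ℂ V :=
  Submodule.span ℂ {x | ∃ c : ι → ℕ, (l.map c).sum = n ∧ x = (l.map fun p => y p ^ c p).prod}

variable {Φ : Set ι} {stat : ι → ℕ} {y : ι → V}

lemma mul_mem_lowSpan {p : ι} (hp : p ∈ Φ) {n m : ℕ} {x : V} (hx : x ∈ lowSpan Φ stat y n m) :
    y p * x ∈ lowSpan Φ stat y (n + 1) (stat p + m) := by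
  induction hx using Submodule.span_induction with
  | mem x hx =>
    obtain ⟨v, hv, hn, hm, rfl⟩ := hx
    exact Submodule.subset_span ⟨p :: v, by simpa using ⟨hp, hv⟩, by simp [hn], by simpa using hm,
      by simp⟩
  | zero => simp
  | add a b _ _ ha hb => rw [mul_add]; exact add_mem ha hb
  | smul c a _ ha => rw [mul_smul_comm]; exact Submodule.smul_mem _ _ ha

lemma exists_sub_mem_lowSpan_of_perm (hR : Reorderable Φ stat y) {w w' : List ι}
    (h : w.Perm w') (hw : ∀ p ∈ w, p ∈ Φ) :
    ∃ c : ℂ, (w.map y).prod - c • (w'.map y).prod ∈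
      lowSpan Φ stat y w.length (w.map stat).sum := by
  induction h with
  | nil => exact ⟨1, by simp⟩
  | cons x _ ih =>
    obtain ⟨c, hc⟩ := ih fun p hp => hw p (by simp [hp])
    refine ⟨c, ?_⟩
    have := mul_mem_lowSpan (hw x (by simp)) hc
    simpa [mul_sub, mul_smul_comm] using this
  | swap a b l =>
    obtain ⟨c, d, s, t, hs, ht, h, h'⟩ := hR b (hw b (by simp)) a (hw a (by simp))
    refine ⟨c, ?_⟩
    have h1 := congrArg (· * (l.map y).prod) h
    have h2 : ((b :: a :: l).map y).prod - c • ((a :: b :: l).map y).prod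
        = d • ((s :: t :: l).map y).prod := by
      simp only [List.map_cons, List.prod_cons, ← mul_assoc]
      simp only [add_mul, smul_mul_assoc] at h1
      rw [h1]; abel
    rw [h2]
    rcases h' with rfl | h'
    · simp
    · refine Submodule.smul_mem _ _ (Submodule.subset_span ⟨s :: t :: l, ?_, by simp, ?_, rfl⟩)
      · intro p hp
        simp only [List.mem_cons] at hp
        rcases hp with rfl | rfl | hp
        exacts [hs, ht, hw p (by simp [hp])]
      · simp only [List.map_cons, List.sum_cons]; omega
  | trans h1 _ ih1 ih2 =>
    obtain ⟨c, hc⟩ := ih1 hw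
    obtain ⟨c', hc'⟩ := ih2 fun p hp => hw p (h1.mem_iff.2 hp)
    rw [← h1.length_eq, ← (h1.map stat).sum_eq] at hc'
    refine ⟨c * c', ?_⟩
    have := add_mem hc (Submodule.smul_mem _ c hc')
    rwa [smul_sub, smul_smul, sub_add_sub_cancel] at this

theorem wordSpan_le_sortedSpan (hR : Reorderable Φ stat y) {l : List ι} (hl : l.Nodup)
    (hlΦ : ∀ p, p ∈ l ↔ p ∈ Φ) (n : ℕ) : wordSpan Φ y n ≤ sortedSpan y l n := by
  have key : ∀ (m : ℕ) (w : List ι), (∀ p ∈ w, p ∈ Φ) → w.length = n → (w.map stat).sum = m →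
      (w.map y).prod ∈ sortedSpan y l n := by
    intro m
    induction m using Nat.strong_induction_on with
    | _ m ih =>
    intro w hw hn hm
    obtain ⟨w', c, hp, hc, hprod⟩ := exists_perm_sorted (y := y) hl w
      fun p hp => (hlΦ p).2 (hw p hp)
    obtain ⟨a, ha⟩ := exists_sub_mem_lowSpan_of_perm hR hp hw
    have hlow : lowSpan Φ stat y w.length (w.map stat).sum ≤ sortedSpan y l n := by
      refine Submodule.span_le.2 ?_
      rintro _ ⟨v, hv, hvn, hvm, rfl⟩
      exact ih _ (hm ▸ hvm) v hv (hvn.trans hn) rfl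
    rw [← sub_add_cancel (w.map y).prod (a • (w'.map y).prod)]
    exact add_mem (hlow ha) (Submodule.smul_mem _ _
      (Submodule.subset_span ⟨c, hc.trans hn, hprod⟩))
  refine Submodule.span_le.2 ?_
  rintro _ ⟨w, hw, hn, rfl⟩
  exact key _ w hw hn rfl

lemma span_pow_le_wordSpan (n : ℕ) : Submodule.span ℂ (y '' Φ) ^ n ≤ wordSpan Φ y n := by
  induction n with
  | zero =>
    rw [pow_zero, Submodule.one_eq_span]
    exact Submodule.span_mono (by rintro _ rfl; exact ⟨[], by simp⟩)
  | succ n ih =>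
    rw [pow_succ']
    refine (mul_le_mul' le_rfl ih).trans ?_
    rw [wordSpan, Submodule.span_mul_span, wordSpan]
    refine Submodule.span_mono ?_
    rintro _ ⟨_, ⟨p, hp, rfl⟩, _, ⟨v, hv, hn, rfl⟩, rfl⟩
    exact ⟨p :: v, by simpa using ⟨hp, hv⟩, by simp [hn], by simp⟩

end Reordering

section Levi

variable {V : Type*} [Ring V] [Algebra ℂ V]

/-- `LeviWord K a b n x`: the element `x` is a product of elements of `K` and of exactly `n`
letters `a`, `b`. -/
inductive LeviWord (K : Subalgebra ℂ V) (a b : V) : ℕ → V → Prop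
  | one : LeviWord K a b 0 1
  | levi {n x k} : LeviWord K a b n x → k ∈ K → LeviWord K a b n (x * k)
  | left {n x} : LeviWord K a b n x → LeviWord K a b (n + 1) (x * a)
  | right {n x} : LeviWord K a b n x → LeviWord K a b (n + 1) (x * b)

/-- `K B₋^a B₊^b`, summed over `a + b ≤ k`. -/
def triSpan (K Bm Bp : Submodule ℂ V) (k : ℕ) : Submodule ℂ V :=
  ⨆ (p : ℕ × ℕ), ⨆ (_ : p.1 + p.2 ≤ k), K * Bm ^ p.1 * Bp ^ p.2

lemma le_triSpan {K Bm Bp : Submodule ℂ V} {k : ℕ} (a b : ℕ) (h : a + b ≤ k) :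
    K * Bm ^ a * Bp ^ b ≤ triSpan K Bm Bp k :=
  le_iSup₂_of_le (a, b) h le_rfl

lemma triSpan_mul_le {K Bm Bp M P : Submodule ℂ V} {k : ℕ}
    (h : ∀ a b, a + b ≤ k → K * Bm ^ a * Bp ^ b * M ≤ P) : triSpan K Bm Bp k * M ≤ P := by
  simp only [triSpan, Submodule.iSup_mul]
  exact iSup₂_le fun p hp => h p.1 p.2 hp

lemma pow_mul_le_of_mul_le {K B : Submodule ℂ V} (h : B * K ≤ K * B) (n : ℕ) :
    B ^ n * K ≤ K * B ^ n := by
  induction n with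
  | zero => simp
  | succ n ih =>
    calc B ^ (n + 1) * K = B ^ n * (B * K) := by rw [pow_succ, mul_assoc]
      _ ≤ B ^ n * (K * B) := mul_le_mul' le_rfl h
      _ = B ^ n * K * B := by rw [mul_assoc]
      _ ≤ K * B ^ n * B := mul_le_mul' ih le_rfl
      _ = K * B ^ (n + 1) := by rw [pow_succ, mul_assoc]

lemma mem_triSpan_of_leviWord {K : Subalgebra ℂ V} {Bm Bp : Submodule ℂ V} {a b : V}
    (ha : a ∈ Bp) (hb : b ∈ Bm)
    (hp : Bp * K.toSubmodule ≤ K.toSubmodule * Bp) (hm : Bm * K.toSubmodule ≤ K.toSubmodule * Bm)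
    (hpb : Bp * Submodule.span ℂ {b} ≤ Submodule.span ℂ {b} * Bp ⊔ K.toSubmodule)
    {n : ℕ} {x : V} (hx : LeviWord K a b n x) : x ∈ triSpan K.toSubmodule Bm Bp n := by
  have hKK : K.toSubmodule * K.toSubmodule = K.toSubmodule := K.isIdempotentElem_toSubmodule
  have hp' := pow_mul_le_of_mul_le hp
  have hm' := pow_mul_le_of_mul_le hm
  set L := K.toSubmodule
  have hpb' : ∀ n, Bp ^ (n + 1) * Submodule.span ℂ {b} ≤
      Submodule.span ℂ {b} * Bp ^ (n + 1) ⊔ L * Bp ^ n := by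
    intro n
    induction n with
    | zero => simpa using hpb
    | succ n ih =>
      calc Bp ^ (n + 1 + 1) * Submodule.span ℂ {b}
          = Bp ^ (n + 1) * (Bp * Submodule.span ℂ {b}) := by rw [pow_succ, mul_assoc]
        _ ≤ Bp ^ (n + 1) * (Submodule.span ℂ {b} * Bp ⊔ L) := mul_le_mul' le_rfl hpb
        _ = Bp ^ (n + 1) * Submodule.span ℂ {b} * Bp ⊔ Bp ^ (n + 1) * L := by
            rw [Submodule.mul_sup, mul_assoc]
        _ ≤ (Submodule.span ℂ {b} * Bp ^ (n + 1) ⊔ L * Bp ^ n) * Bp ⊔ L * Bp ^ (n + 1) :=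
            sup_le_sup (mul_le_mul' ih le_rfl) (hp' (n + 1))
        _ ≤ _ := by
            rw [Submodule.sup_mul, mul_assoc, mul_assoc, ← pow_succ, ← pow_succ]
            exact sup_le (sup_le le_sup_left le_sup_right) le_sup_right
  have hb' : Submodule.span ℂ {b} ≤ Bm := by simpa using hb
  have ha' : Submodule.span ℂ {a} ≤ Bp := by simpa using ha
  induction hx with
  | one =>
    refine le_triSpan 0 0 le_rfl ?_
    rw [pow_zero, pow_zero, mul_one, mul_one]
    exact K.one_mem
  | @levi n x k _ hk ih =>
    refine triSpan_mul_le (M := L) (fun c d hcd => ?_) (Submodule.mul_mem_mul ih hk)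
    refine le_trans ?_ (le_triSpan c d hcd)
    calc L * Bm ^ c * Bp ^ d * L = L * Bm ^ c * (Bp ^ d * L) := by rw [mul_assoc]
      _ ≤ L * Bm ^ c * (L * Bp ^ d) := mul_le_mul' le_rfl (hp' d)
      _ = L * (Bm ^ c * L) * Bp ^ d := by simp only [mul_assoc]
      _ ≤ L * (L * Bm ^ c) * Bp ^ d :=
        mul_le_mul' (mul_le_mul' le_rfl (hm' c)) le_rfl
      _ = L * Bm ^ c * Bp ^ d := by rw [← mul_assoc, hKK]
  | @left n x _ ih =>
    refine triSpan_mul_le (M := Submodule.span ℂ {a}) (fun c d hcd => ?_)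
      (Submodule.mul_mem_mul ih (Submodule.mem_span_singleton_self a))
    refine le_trans ?_ (le_triSpan c (d + 1) (by omega))
    rw [pow_succ, ← mul_assoc]
    exact mul_le_mul' le_rfl ha'
  | @right n x _ ih =>
    refine triSpan_mul_le (M := Submodule.span ℂ {b}) (fun c d hcd => ?_)
      (Submodule.mul_mem_mul ih (Submodule.mem_span_singleton_self b))
    have hbm : L * Bm ^ c * Submodule.span ℂ {b} ≤ L * Bm ^ (c + 1) := by
      rw [pow_succ, ← mul_assoc]
      exact mul_le_mul' le_rfl hb'
    rcases d with _ | d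
    · rw [pow_zero, mul_one]
      refine hbm.trans (le_trans ?_ (le_triSpan (c + 1) 0 (by omega)))
      rw [pow_zero, mul_one]
    · calc L * Bm ^ c * Bp ^ (d + 1) * Submodule.span ℂ {b}
          = L * Bm ^ c * (Bp ^ (d + 1) * Submodule.span ℂ {b}) := by rw [mul_assoc]
        _ ≤ L * Bm ^ c * (Submodule.span ℂ {b} * Bp ^ (d + 1) ⊔ L * Bp ^ d) :=
          mul_le_mul' le_rfl (hpb' d)
        _ = L * Bm ^ c * Submodule.span ℂ {b} * Bp ^ (d + 1) ⊔ L * (Bm ^ c * L) * Bp ^ d := by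
          rw [Submodule.mul_sup]; simp only [mul_assoc]
        _ ≤ L * Bm ^ (c + 1) * Bp ^ (d + 1) ⊔ L * (L * Bm ^ c) * Bp ^ d :=
          sup_le_sup (mul_le_mul' hbm le_rfl)
            (mul_le_mul' (mul_le_mul' le_rfl (hm' c)) le_rfl)
        _ ≤ _ := by
          rw [← mul_assoc L L, hKK]
          exact sup_le (le_triSpan _ _ (by omega)) (le_triSpan _ _ (by omega))

end Levi

section Parameter

variable {q : ℝ}

lemma qc_ne_zero (hq : Transcendental ℚ q) : (q : ℂ) ≠ 0 := by
  rw [Complex.ofReal_ne_zero]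
  rintro rfl
  exact hq isAlgebraic_zero

lemma qc_sub_inv_ne_zero (hq : Transcendental ℚ q) : (q : ℂ) - (q : ℂ)⁻¹ ≠ 0 := by
  have h0 : q ≠ 0 := by exact_mod_cast qc_ne_zero hq
  rw [← Complex.ofReal_inv, ← Complex.ofReal_sub, Complex.ofReal_ne_zero, sub_ne_zero]
  intro h
  have h1 : q ^ 2 = 1 := by
    rw [sq]; nth_rewrite 2 [h]; exact mul_inv_cancel₀ h0
  rcases sq_eq_one_iff.1 h1 with rfl | rfl
  · exact hq isAlgebraic_one
  · exact hq isAlgebraic_one.neg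

lemma qc_add_inv_ne_zero (hq : Transcendental ℚ q) : (q : ℂ) + (q : ℂ)⁻¹ ≠ 0 := by
  have h0 : q ≠ 0 := by exact_mod_cast qc_ne_zero hq
  rw [← Complex.ofReal_inv, ← Complex.ofReal_add, Complex.ofReal_ne_zero]
  intro h
  have h1 : q * q + 1 = 0 := by
    have := congrArg (q * ·) h
    simpa [mul_add, h0] using this
  nlinarith [mul_self_nonneg q]

end Parameter

namespace UqslData

variable {q : ℝ} {N : ℕ} (D : UqslData q N)

lemma Ev_eq_rootVec (d i : ℕ) : D.Ev d i = rootVec (q : ℂ) D.E d i := by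
  induction d generalizing i with
  | zero => rfl
  | succ d ih => simp only [Ev, rootVec, ih]

lemma op_Fv_eq_rootVec (d i : ℕ) :
    MulOpposite.op (D.Fv d i) = rootVec (q : ℂ) (fun i => MulOpposite.op (D.F i)) d i := by
  induction d generalizing i with
  | zero => rfl
  | succ d ih => simp only [Fv, rootVec, ← ih, MulOpposite.op_sub, MulOpposite.op_smul,
      MulOpposite.op_mul]

/-- The root vector `E_{i,k}` of the root `ε_i - ε_k`. -/
def Eb (i k : ℕ) : D.U := D.Ev (k - i - 1) i

/-- The root vector `F_{i,k}` of the root `ε_i - ε_k`. -/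
def Fb (i k : ℕ) : D.U := D.Fv (k - i - 1) i

lemma Eb_eq (i k : ℕ) : D.Eb i k = rootBr (q : ℂ) D.E i k := D.Ev_eq_rootVec _ _

lemma op_Fb_eq (i k : ℕ) :
    MulOpposite.op (D.Fb i k) = rootBr (q : ℂ) (fun i => MulOpposite.op (D.F i)) i k :=
  D.op_Fv_eq_rootVec _ _

lemma Fb_eq (i k : ℕ) :
    D.Fb i k = (rootBr (q : ℂ) (fun i => MulOpposite.op (D.F i)) i k).unop := by
  rw [← op_Fb_eq, MulOpposite.unop_op]

/-- The quantum root vector `E_β`, for `β = α_i + ⋯ + α_j` encoded by `(i, j)`. -/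
def Ep (p : ℕ × ℕ) : D.U := D.Ev (p.2 - p.1) p.1

/-- The quantum root vector `F_β`, for `β = α_i + ⋯ + α_j` encoded by `(i, j)`. -/
def Fp (p : ℕ × ℕ) : D.U := D.Fv (p.2 - p.1) p.1

lemma Ep_eq (p : ℕ × ℕ) : D.Ep p = D.Eb p.1 (p.2 + 1) := by
  rw [Ep, Eb, Nat.sub_right_comm, Nat.add_sub_cancel]

lemma Fp_eq (p : ℕ × ℕ) : D.Fp p = D.Fb p.1 (p.2 + 1) := by
  rw [Fp, Fb, Nat.sub_right_comm, Nat.add_sub_cancel]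

variable {D}

lemma reorderable_Ep (hq : Transcendental ℚ q) (r : ℕ) :
    Reorderable {p | inPhiR N r p} (fun p => p.1 * p.2) D.Ep := by
  rintro ⟨i, k⟩ ⟨h1, h2, h3, h4⟩ ⟨j, l⟩ ⟨h5, h6, h7, h8⟩
  simp only at h1 h2 h3 h4 h5 h6 h7 h8
  obtain ⟨c, d, h, h'⟩ := D.rels.serre.reorder (qc_ne_zero hq) (qc_add_inv_ne_zero hq) h1 h2
    (by omega : r < k + 1) (by omega) h5 h6 (by omega : r < l + 1) (by omega)
  refine ⟨c, d, (min i j, max k l), (max i j, min k l), ?_, ?_, ?_, ?_⟩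
  · simp only [Set.mem_ofPred_eq, inPhiR]; omega
  · simp only [Set.mem_ofPred_eq, inPhiR]; omega
  · simpa only [Ep_eq, Eb_eq, ← max_add_add_right, ← min_add_add_right] using h
  · simpa only [max_add_add_right, min_add_add_right, Nat.add_sub_cancel] using h'

lemma reorderable_Fp (hq : Transcendental ℚ q) (r : ℕ) :
    Reorderable {p | inPhiR N r p} (fun p => p.1 * p.2) D.Fp := by
  rintro ⟨i, k⟩ ⟨h1, h2, h3, h4⟩ ⟨j, l⟩ ⟨h5, h6, h7, h8⟩
  simp only at h1 h2 h3 h4 h5 h6 h7 h8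
  obtain ⟨c, d, h, h'⟩ := (D.rels.op (qc_ne_zero hq)).serre.reorder (qc_ne_zero hq)
    (qc_add_inv_ne_zero hq) h5 h6 (by omega : r < l + 1) (by omega) h1 h2
    (by omega : r < k + 1) (by omega)
  refine ⟨c, d, (max j i, min l k), (min j i, max l k), ?_, ?_, ?_, ?_⟩
  · simp only [Set.mem_ofPred_eq, inPhiR]; omega
  · simp only [Set.mem_ofPred_eq, inPhiR]; omega
  · have h1 := congrArg MulOpposite.unop h
    simp only [MulOpposite.unop_mul, MulOpposite.unop_add, MulOpposite.unop_smul, ← Fb_eq] at h1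
    simpa only [Fp_eq, ← max_add_add_right, ← min_add_add_right] using h1
  · simp only [max_add_add_right, min_add_add_right, Nat.add_sub_cancel] at h'
    exact h'.imp_right fun h' => by simp only; omega

lemma isLeviLetter_mem_Ksub {r : ℕ} {x : D.U} (hx : IsLeviLetter N r D.E D.F D.Kg D.Ki x) :
    x ∈ D.Ksub r :=
  Algebra.subset_adjoin hx

lemma isTorusLetter_mem_Ksub {r : ℕ} {x : D.U} (hx : IsTorusLetter N D.Kg D.Ki x) :
    x ∈ D.Ksub r := by
  rcases hx with rfl | hx
  · exact one_mem _
  · exact isLeviLetter_mem_Ksub (Or.inr hx)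

/-- A submodule whose product with every generator of `K` stays in `K * B` satisfies
`B * K ≤ K * B`. -/
lemma mul_Ksub_le {r : ℕ} {B : Submodule ℂ D.U}
    (h : ∀ x, IsLeviLetter N r D.E D.F D.Kg D.Ki x → ∀ b ∈ B,
      b * x ∈ (D.Ksub r).toSubmodule * B) :
    B * (D.Ksub r).toSubmodule ≤ (D.Ksub r).toSubmodule * B := by
  set L := (D.Ksub r).toSubmodule
  have hLL : L * L = L := (D.Ksub r).isIdempotentElem_toSubmodule
  have key : ∀ k ∈ D.Ksub r, ∀ b ∈ L * B, b * k ∈ L * B := by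
    intro k hk
    induction hk using Algebra.adjoin_induction with
    | mem x hx =>
      intro b hb
      induction hb using Submodule.mul_induction_on' with
      | mem_mul_mem m hm n hn =>
        rw [mul_assoc, ← hLL, mul_assoc L]
        exact Submodule.mul_mem_mul hm (h x hx n hn)
      | add x _ y _ hx hy => rw [add_mul]; exact add_mem hx hy
    | algebraMap c =>
      intro b hb
      rw [← Algebra.commutes, ← Algebra.smul_def]
      exact Submodule.smul_mem _ _ hb
    | add x y _ _ hx hy => intro b hb; rw [mul_add]; exact add_mem (hx b hb) (hy b hb)
    | mul x y _ _ hx hy => intro b hb; rw [← mul_assoc]; exact hy _ (hx b hb)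
  refine Submodule.mul_le.2 fun b hb k hk => key k hk b ?_
  rw [← one_mul b]
  exact Submodule.mul_mem_mul (D.Ksub r).one_mem hb

lemma span_Ep_mul_Ksub_le (hq : Transcendental ℚ q) (r : ℕ) :
    Submodule.span ℂ (D.Ep '' {p | inPhiR N r p}) * (D.Ksub r).toSubmodule ≤
      (D.Ksub r).toSubmodule * Submodule.span ℂ (D.Ep '' {p | inPhiR N r p}) := by
  refine mul_Ksub_le fun x hx b hb => ?_
  induction hb using Submodule.span_induction with
  | mem b hb =>
    obtain ⟨⟨i, k⟩, ⟨h1, h2, h3, h4⟩, rfl⟩ := hb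
    simp only at h1 h2 h3 h4
    obtain ⟨c, d, s, t, i', k', -, -, ht, h1', h2', h3', h4', he, -⟩ := D.rels.straighten
      (qc_ne_zero hq) (qc_sub_inv_ne_zero hq) (qc_add_inv_ne_zero hq) hx h1 h2
      (by omega : r < k + 1) (by omega)
    rw [Ep_eq, Eb_eq, he]
    refine add_mem (Submodule.smul_mem _ _ (Submodule.mul_mem_mul (isLeviLetter_mem_Ksub hx) ?_))
      (Submodule.smul_mem _ _ (Submodule.mul_mem_mul (isTorusLetter_mem_Ksub ht) ?_))
    · exact Submodule.subset_span ⟨(i, k), ⟨h1, h2, h3, h4⟩, by rw [Ep_eq, Eb_eq]⟩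
    · refine Submodule.subset_span ⟨(i', k' - 1), ?_, ?_⟩
      · simp only [Set.mem_ofPred_eq, inPhiR]; omega
      · rw [Ep_eq, Eb_eq, Nat.sub_add_cancel (by omega)]
  | zero => simp
  | add a b _ _ ha hb => rw [add_mul]; exact add_mem ha hb
  | smul c a _ ha => rw [smul_mul_assoc]; exact Submodule.smul_mem _ _ ha

lemma span_Fp_mul_Ksub_le (hq : Transcendental ℚ q) (r : ℕ) :
    Submodule.span ℂ (D.Fp '' {p | inPhiR N r p}) * (D.Ksub r).toSubmodule ≤
      (D.Ksub r).toSubmodule * Submodule.span ℂ (D.Fp '' {p | inPhiR N r p}) := by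
  refine mul_Ksub_le fun x hx b hb => ?_
  induction hb using Submodule.span_induction with
  | mem b hb =>
    obtain ⟨⟨i, k⟩, ⟨h1, h2, h3, h4⟩, rfl⟩ := hb
    simp only at h1 h2 h3 h4
    have hx' : IsLeviLetter N r (fun i => MulOpposite.op (D.F i)) (fun i => MulOpposite.op (D.E i))
        (fun i => MulOpposite.op (D.Kg i)) (fun i => MulOpposite.op (D.Ki i))
        (MulOpposite.op x) := by
      simpa only [IsLeviLetter, MulOpposite.op_inj, or_comm (a := x = D.F _)] using hx
    obtain ⟨c, d, s, t, i', k', hc, hs, ht, h1', h2', h3', h4', he, he'⟩ :=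
      (D.rels.op (qc_ne_zero hq)).straighten
      (qc_ne_zero hq) (qc_sub_inv_ne_zero hq) (qc_add_inv_ne_zero hq) hx' h1 h2
      (by omega : r < k + 1) (by omega)
    have ht' : t.unop ∈ D.Ksub r := by
      refine isTorusLetter_mem_Ksub ?_
      rcases ht with rfl | ⟨j, hj, rfl | rfl⟩
      exacts [Or.inl rfl, Or.inr ⟨j, hj, Or.inl rfl⟩, Or.inr ⟨j, hj, Or.inr rfl⟩]
    rw [he'] at he
    have h := congrArg MulOpposite.unop he
    simp only [MulOpposite.unop_mul, MulOpposite.unop_add, MulOpposite.unop_smul,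
      MulOpposite.unop_op, ← Fb_eq] at h
    have h' : D.Fp (i, k) * x =
        c⁻¹ • (x * D.Fp (i, k)) - (c⁻¹ * d * s) • (t.unop * D.Fb i' k') := by
      rw [Fp_eq, h, smul_add, smul_smul, smul_smul, smul_smul, inv_mul_cancel₀ hc]
      module
    rw [h']
    refine sub_mem (Submodule.smul_mem _ _ (Submodule.mul_mem_mul (isLeviLetter_mem_Ksub hx) ?_))
      (Submodule.smul_mem _ _ (Submodule.mul_mem_mul ht' ?_))
    · exact Submodule.subset_span ⟨(i, k), ⟨h1, h2, h3, h4⟩, rfl⟩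
    · refine Submodule.subset_span ⟨(i', k' - 1), ?_, ?_⟩
      · simp only [Set.mem_ofPred_eq, inPhiR]; omega
      · rw [Fp_eq, Nat.sub_add_cancel (by omega)]
  | zero => simp
  | add a b _ _ ha hb => rw [add_mul]; exact add_mem ha hb
  | smul c a _ ha => rw [smul_mul_assoc]; exact Submodule.smul_mem _ _ ha

lemma Eb_mem_Ksub {r i k : ℕ} (hi : 1 ≤ i) (hik : i < k) (hk : k ≤ N) (h : k ≤ r ∨ r < i) :
    D.Eb i k ∈ D.Ksub r := by
  rw [Eb_eq]
  induction i, hik using interval_induction with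
  | base i _ hi' =>
    subst hi'
    rw [rootBr_self]
    exact isLeviLetter_mem_Ksub (Or.inl ⟨i, by simp; omega, by omega, Or.inl rfl⟩)
  | step i _ hi' ih =>
    have h1 := ih (by omega) (by omega)
    have h2 : D.E i ∈ D.Ksub r :=
      isLeviLetter_mem_Ksub (Or.inl ⟨i, by simp; omega, by omega, Or.inl rfl⟩)
    rw [rootBr_step hi']
    exact sub_mem (mul_mem h2 h1) (Subalgebra.smul_mem _ (mul_mem h1 h2) _)

lemma Fb_self (i : ℕ) : D.Fb i (i + 1) = D.F i := by
  simp [Fb, Fv]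

lemma Fb_step {i k : ℕ} (h : i + 1 < k) :
    D.Fb i k = D.Fb (i + 1) k * D.F i - (q : ℂ)⁻¹ • (D.F i * D.Fb (i + 1) k) := by
  rw [Fb_eq, rootBr_step h]; simp [Fb_eq]

lemma Eb_self (i : ℕ) : D.Eb i (i + 1) = D.E i := by
  simp [Eb, Ev]

lemma Eb_step {i k : ℕ} (h : i + 1 < k) :
    D.Eb i k = D.E i * D.Eb (i + 1) k - (q : ℂ)⁻¹ • (D.Eb (i + 1) k * D.E i) := by
  rw [Eb_eq, rootBr_step h, Eb_eq]

lemma Fb_mem_Ksub {r i k : ℕ} (hi : 1 ≤ i) (hik : i < k) (hk : k ≤ N) (h : k ≤ r ∨ r < i) :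
    D.Fb i k ∈ D.Ksub r := by
  induction i, hik using interval_induction with
  | base i _ hi' =>
    subst hi'
    rw [Fb_self]
    exact isLeviLetter_mem_Ksub (Or.inl ⟨i, by simp; omega, by omega, Or.inr rfl⟩)
  | step i _ hi' ih =>
    have h1 := ih (by omega) (by omega)
    have h2 : D.F i ∈ D.Ksub r :=
      isLeviLetter_mem_Ksub (Or.inl ⟨i, by simp; omega, by omega, Or.inr rfl⟩)
    rw [Fb_step hi']
    exact sub_mem (mul_mem h1 h2) (Subalgebra.smul_mem _ (mul_mem h2 h1) _)

lemma Kg_mem_Ksub {r j : ℕ} (hj : j ∈ Finset.Icc 1 (N - 1)) : D.Kg j ∈ D.Ksub r :=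
  isLeviLetter_mem_Ksub (Or.inr ⟨j, hj, Or.inl rfl⟩)

lemma Ki_mem_Ksub {r j : ℕ} (hj : j ∈ Finset.Icc 1 (N - 1)) : D.Ki j ∈ D.Ksub r :=
  isLeviLetter_mem_Ksub (Or.inr ⟨j, hj, Or.inr rfl⟩)

lemma span_Ep_mul_F_le (hq : Transcendental ℚ q) {r : ℕ} (hr : r ∈ Finset.Icc 1 (N - 1)) :
    Submodule.span ℂ (D.Ep '' {p | inPhiR N r p}) * Submodule.span ℂ {D.F r} ≤
      Submodule.span ℂ {D.F r} * Submodule.span ℂ (D.Ep '' {p | inPhiR N r p}) ⊔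
        (D.Ksub r).toSubmodule := by
  have hr' := Finset.mem_Icc.1 hr
  rw [Submodule.span_mul_span, Submodule.span_le]
  rintro _ ⟨_, ⟨⟨i, k⟩, ⟨h1, h2, h3, h4⟩, rfl⟩, _, rfl, rfl⟩
  simp only at h1 h2 h3 h4
  have hmem : D.F r * D.Ep (i, k) ∈ Submodule.span ℂ {D.F r} *
      Submodule.span ℂ (D.Ep '' {p | inPhiR N r p}) :=
    Submodule.mul_mem_mul (Submodule.mem_span_singleton_self _)
      (Submodule.subset_span ⟨(i, k), ⟨h1, h2, h3, h4⟩, rfl⟩)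
  suffices h : D.Ep (i, k) * D.F r - D.F r * D.Ep (i, k) ∈ D.Ksub r by
    have := Submodule.add_mem_sup hmem ((Subalgebra.mem_toSubmodule _).2 h)
    simpa only [add_sub_cancel, SetLike.mem_coe] using this
  have q0 := qc_ne_zero hq
  have q1 := qc_sub_inv_ne_zero hq
  rw [Ep_eq, Eb_eq]
  simp only
  by_cases hir : i = r
  · subst hir
    by_cases hkr : k = i
    · subst hkr
      rw [rootBr_self, D.rels.2.2.2.2.1 _ hr _ hr, if_pos rfl]
      exact Subalgebra.smul_mem _ (sub_mem (Kg_mem_Ksub hr) (Ki_mem_Ksub hr)) _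
    · rw [D.rels.rootBr_mul_f_self q0 q1 h1 (by omega) (by omega), sub_sub_cancel_left, ← Eb_eq]
      exact neg_mem (mul_mem (Eb_mem_Ksub (by omega) (by omega) (by omega) (by omega))
        (Ki_mem_Ksub hr))
  · by_cases hkr : k = r
    · subst hkr
      rw [D.rels.rootBr_mul_f_last q0 q1 h1 (by omega) (by omega), add_sub_cancel_left, ← Eb_eq]
      exact mul_mem (Kg_mem_Ksub hr) (Eb_mem_Ksub (by omega) (by omega) (by omega) (by omega))
    · rw [(D.rels.commute_rootBr_f_interior q0 q1 h1 (by omega) (by omega) (by omega)).eq, sub_self]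
      exact zero_mem _

end UqslData

lemma LeviWord.mul {V : Type*} [Ring V] [Algebra ℂ V] {K : Subalgebra ℂ V} {a b : V} {m n : ℕ}
    {x y : V} (hx : LeviWord K a b m x) (hy : LeviWord K a b n y) :
    LeviWord K a b (m + n) (x * y) := by
  induction hy with
  | one => simpa using hx
  | levi _ hk ih => rw [← mul_assoc]; exact ih.levi hk
  | left _ ih => rw [← mul_assoc, ← add_assoc]; exact ih.left
  | right _ ih => rw [← mul_assoc, ← add_assoc]; exact ih.right

namespace UqslData

variable {q : ℝ} {N : ℕ} (D : UqslData q N) (r : ℕ)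

/-- The filtration of `U` by the number of letters `E_r`, `F_r`. -/
def G (n : ℤ) : Submodule ℂ D.U :=
  Submodule.span ℂ {x | ∃ k : ℕ, (k : ℤ) ≤ n ∧ LeviWord (D.Ksub r) (D.E r) (D.F r) k x}

/-- The preimage in `U` of the image of `G` in `U/K⁺U`. -/
def Gh (n : ℤ) : Submodule ℂ D.U := D.G r n ⊔ D.Jsub r

variable {D r}

lemma leviWord_mem_G {k : ℕ} {n : ℤ} {x : D.U} (hk : (k : ℤ) ≤ n)
    (hx : LeviWord (D.Ksub r) (D.E r) (D.F r) k x) : x ∈ D.G r n :=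
  Submodule.subset_span ⟨k, hk, hx⟩

lemma G_mono {m n : ℤ} (h : m ≤ n) : D.G r m ≤ D.G r n :=
  Submodule.span_mono fun _ ⟨k, hk, hx⟩ => ⟨k, hk.trans h, hx⟩

lemma Gh_mono {m n : ℤ} (h : m ≤ n) : D.Gh r m ≤ D.Gh r n := sup_le_sup_right (G_mono h) _

lemma G_le_Gh (n : ℤ) : D.G r n ≤ D.Gh r n := le_sup_left

lemma Jsub_le_Gh (n : ℤ) : D.Jsub r ≤ D.Gh r n := le_sup_right

lemma mul_mem_G {m n : ℤ} {x y : D.U} (hx : x ∈ D.G r m) (hy : y ∈ D.G r n) :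
    x * y ∈ D.G r (m + n) := by
  have h : D.G r m * D.G r n ≤ D.G r (m + n) := by
    rw [G, G, Submodule.span_mul_span]
    refine Submodule.span_le.2 ?_
    rintro _ ⟨x, ⟨k, hk, hx⟩, y, ⟨l, hl, hy⟩, rfl⟩
    exact leviWord_mem_G (by push_cast; omega) (hx.mul hy)
  exact h (Submodule.mul_mem_mul hx hy)

lemma Ksub_le_G {x : D.U} (hx : x ∈ D.Ksub r) : x ∈ D.G r 0 := by
  simpa using leviWord_mem_G (by simp) (LeviWord.one.levi hx)

lemma E_mem_G : D.E r ∈ D.G r 1 := by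
  simpa using leviWord_mem_G (by simp) (LeviWord.one (K := D.Ksub r) (b := D.F r)).left

lemma F_mem_G : D.F r ∈ D.G r 1 := by
  simpa using leviWord_mem_G (by simp) (LeviWord.one (K := D.Ksub r) (a := D.E r)).right

lemma one_mem_G : (1 : D.U) ∈ D.G r 0 := Ksub_le_G (one_mem _)

lemma mul_mem_Jsub {x : D.U} (hx : x ∈ D.Jsub r) (u : D.U) : x * u ∈ D.Jsub r := by
  induction hx using Submodule.span_induction with
  | mem x hx =>
    obtain ⟨k, hk, hk', v, rfl⟩ := hx
    exact Submodule.subset_span ⟨k, hk, hk', v * u, by rw [mul_assoc]⟩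
  | zero => simp
  | add a b _ _ ha hb => rw [add_mul]; exact add_mem ha hb
  | smul c a _ ha => rw [smul_mul_assoc]; exact Submodule.smul_mem _ _ ha

lemma mul_sub_counit_mem_Jsub {k : D.U} (hk : k ∈ D.Ksub r) (u : D.U) :
    k * u - Coalgebra.counit (R := ℂ) k • u ∈ D.Jsub r := by
  refine Submodule.subset_span ⟨k - algebraMap ℂ _ (Coalgebra.counit (R := ℂ) k),
    sub_mem hk (Subalgebra.algebraMap_mem _ _), by simp, u, ?_⟩
  rw [sub_mul, ← Algebra.smul_def]

lemma G_zero_le : D.G r 0 ≤ Submodule.span ℂ {(1 : D.U)} ⊔ D.Jsub r := by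
  have h : ∀ {k : ℕ} {x : D.U}, LeviWord (D.Ksub r) (D.E r) (D.F r) k x → k = 0 →
      x ∈ D.Ksub r := by
    intro k x hx
    induction hx with
    | one => exact fun _ => one_mem _
    | levi _ hk ih => exact fun h => mul_mem (ih h) hk
    | left => simp
    | right => simp
  refine Submodule.span_le.2 ?_
  rintro x ⟨k, hk, hx⟩
  have hxK := h hx (by omega)
  have := mul_sub_counit_mem_Jsub hxK 1
  rw [mul_one] at this
  rw [← add_sub_cancel (Coalgebra.counit (R := ℂ) x • (1 : D.U)) x]
  exact Submodule.add_mem_sup (Submodule.smul_mem _ _ (Submodule.mem_span_singleton_self _)) this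

lemma mul_mem_Gh {m n : ℤ} {x y : D.U} (hx : x ∈ D.Gh r m) (hy : y ∈ D.G r n) :
    x * y ∈ D.Gh r (m + n) := by
  obtain ⟨a, ha, b, hb, rfl⟩ := Submodule.mem_sup.1 hx
  rw [add_mul]
  exact Submodule.add_mem_sup (mul_mem_G ha hy) (mul_mem_Jsub hb _)

lemma exists_mem_G (x : D.U) : ∃ n : ℕ, x ∈ D.G r n := by
  have hx : x ∈ Algebra.adjoin ℂ
    {x : D.U | ∃ i ∈ Finset.Icc 1 (N - 1), x = D.E i ∨ x = D.F i ∨ x = D.Kg i ∨ x = D.Ki i} := by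
    rw [D.gen]; trivial
  have h01 : D.G r 0 ≤ D.G r 1 := G_mono (by omega)
  induction hx using Algebra.adjoin_induction with
  | mem x hx =>
    refine ⟨1, ?_⟩
    obtain ⟨i, hi, h⟩ := hx
    by_cases hir : i = r
    · subst hir
      rcases h with rfl | rfl | rfl | rfl
      exacts [E_mem_G, F_mem_G, h01 (Ksub_le_G (Kg_mem_Ksub hi)), h01 (Ksub_le_G (Ki_mem_Ksub hi))]
    · refine h01 (Ksub_le_G (isLeviLetter_mem_Ksub ?_))
      rcases h with h | h | h | h
      exacts [Or.inl ⟨i, hi, hir, Or.inl h⟩, Or.inl ⟨i, hi, hir, Or.inr h⟩,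
        Or.inr ⟨i, hi, Or.inl h⟩, Or.inr ⟨i, hi, Or.inr h⟩]
  | algebraMap c =>
    exact ⟨0, by simpa using Ksub_le_G (Subalgebra.algebraMap_mem _ c)⟩
  | add x y _ _ hx hy =>
    obtain ⟨m, hm⟩ := hx
    obtain ⟨n, hn⟩ := hy
    exact ⟨m + n, add_mem (G_mono (by push_cast; omega) hm) (G_mono (by push_cast; omega) hn)⟩
  | mul x y _ _ hx hy =>
    obtain ⟨m, hm⟩ := hx
    obtain ⟨n, hn⟩ := hy
    exact ⟨m + n, by push_cast; exact mul_mem_G hm hn⟩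

lemma Eb_mem_G {i k : ℕ} (hi : 1 ≤ i) (hik : i < k) (hk : k ≤ N) : D.Eb i k ∈ D.G r 1 := by
  have h01 : D.G r 0 ≤ D.G r 1 := G_mono (by omega)
  by_cases h : k ≤ r ∨ r < i
  · exact h01 (Ksub_le_G (Eb_mem_Ksub hi hik hk h))
  · induction i, hik using interval_induction with
    | base i _ hi' =>
      subst hi'
      rw [Eb_self]
      obtain rfl : i = r := by omega
      exact E_mem_G
    | step i _ hi' ih =>
      rw [Eb_step hi']
      have key : ∀ {m n : ℤ}, m + n = 1 → D.E i ∈ D.G r m → D.Eb (i + 1) k ∈ D.G r n →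
          D.E i * D.Eb (i + 1) k - (q : ℂ)⁻¹ • (D.Eb (i + 1) k * D.E i) ∈ D.G r 1 :=
        fun hmn h1 h2 => sub_mem (hmn ▸ mul_mem_G h1 h2)
          (Submodule.smul_mem _ _ (by rw [← hmn, add_comm]; exact mul_mem_G h2 h1))
      by_cases hir : i = r
      · subst hir
        exact key (add_zero 1) E_mem_G
          (Ksub_le_G (Eb_mem_Ksub (by omega) hi' hk (by omega)))
      · exact key (zero_add 1) (Ksub_le_G (isLeviLetter_mem_Ksub
          (Or.inl ⟨i, by simp; omega, hir, Or.inl rfl⟩))) (ih (by omega) (by omega))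

lemma Fb_mem_G {i k : ℕ} (hi : 1 ≤ i) (hik : i < k) (hk : k ≤ N) : D.Fb i k ∈ D.G r 1 := by
  have h01 : D.G r 0 ≤ D.G r 1 := G_mono (by omega)
  by_cases h : k ≤ r ∨ r < i
  · exact h01 (Ksub_le_G (Fb_mem_Ksub hi hik hk h))
  · induction i, hik using interval_induction with
    | base i _ hi' =>
      subst hi'
      rw [Fb_self]
      obtain rfl : i = r := by omega
      exact F_mem_G
    | step i _ hi' ih =>
      rw [Fb_step hi']
      have key : ∀ {m n : ℤ}, m + n = 1 → D.F i ∈ D.G r m → D.Fb (i + 1) k ∈ D.G r n →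
          D.Fb (i + 1) k * D.F i - (q : ℂ)⁻¹ • (D.F i * D.Fb (i + 1) k) ∈ D.G r 1 :=
        fun hmn h1 h2 => sub_mem (by rw [← hmn, add_comm]; exact mul_mem_G h2 h1)
          (Submodule.smul_mem _ _ (by rw [← hmn]; exact mul_mem_G h1 h2))
      by_cases hir : i = r
      · subst hir
        exact key (add_zero 1) F_mem_G
          (Ksub_le_G (Fb_mem_Ksub (by omega) hi' hk (by omega)))
      · exact key (zero_add 1) (Ksub_le_G (isLeviLetter_mem_Ksub
          (Or.inl ⟨i, by simp; omega, hir, Or.inr rfl⟩))) (ih (by omega) (by omega))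

variable (D) in
/-- The letters `F_β` (left summand) and `E_β` (right summand). -/
def letter : (ℕ × ℕ) ⊕ (ℕ × ℕ) → D.U := Sum.elim D.Fp D.Ep

lemma letter_mem_G (hr2 : r ≤ N - 1) {p : (ℕ × ℕ) ⊕ (ℕ × ℕ)}
    (hp : inPhiR N r (p.elim id id)) : D.letter p ∈ D.G r 1 := by
  rcases p with p | p <;> obtain ⟨h1, h2, h3, h4⟩ := hp <;> simp only [Sum.elim, id] at h1 h2 h3 h4
  · rw [letter, Sum.elim_inl, Fp_eq]
    exact Fb_mem_G h1 (by omega) (by omega)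
  · rw [letter, Sum.elim_inr, Ep_eq]
    exact Eb_mem_G h1 (by omega) (by omega)

lemma pow_mem_G {x : D.U} (hx : x ∈ D.G r 1) (n : ℕ) : x ^ n ∈ D.G r n := by
  induction n with
  | zero => simpa using one_mem_G
  | succ n ih => rw [pow_succ]; push_cast; exact mul_mem_G ih hx

lemma sortedSpan_le_G {ι : Type*} {y : ι → D.U} {l : List ι} (hl : ∀ p ∈ l, y p ∈ D.G r 1)
    (n : ℕ) : sortedSpan y l n ≤ D.G r n := by
  refine Submodule.span_le.2 ?_
  rintro _ ⟨c, rfl, rfl⟩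
  induction l with
  | nil => simpa using one_mem_G
  | cons p l ih =>
    simp only [List.map_cons, List.prod_cons, List.sum_cons, Nat.cast_add]
    exact mul_mem_G (pow_mem_G (hl p (by simp)) _) (ih fun p hp => hl p (by simp [hp]))

lemma sortedSpan_mul_le (lF lE : List (ℕ × ℕ)) (a b : ℕ) :
    sortedSpan D.Fp lF a * sortedSpan D.Ep lE b ≤
      sortedSpan D.letter (lF.map Sum.inl ++ lE.map Sum.inr) (a + b) := by
  rw [sortedSpan, sortedSpan, Submodule.span_mul_span]
  refine Submodule.span_mono ?_
  rintro _ ⟨_, ⟨c, rfl, rfl⟩, _, ⟨d, rfl, rfl⟩, rfl⟩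
  exact ⟨Sum.elim c d, by simp [Function.comp_def], by simp [Function.comp_def, letter]⟩

theorem G_le_sortedSpan (hq : Transcendental ℚ q) (hr1 : 1 ≤ r) (hr2 : r ≤ N - 1)
    {lF lE : List (ℕ × ℕ)} (hlFnd : lF.Nodup) (hlF : ∀ p, p ∈ lF ↔ inPhiR N r p)
    (hlEnd : lE.Nodup) (hlE : ∀ p, p ∈ lE ↔ inPhiR N r p) (n : ℕ) :
    D.G r n ≤ (⨆ (k : ℕ), ⨆ (_ : k ≤ n),
      sortedSpan D.letter (lF.map Sum.inl ++ lE.map Sum.inr) k) ⊔ D.Jsub r := by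
  have hr : inPhiR N r (r, r) := ⟨hr1, le_rfl, le_rfl, hr2⟩
  have hE : D.E r ∈ Submodule.span ℂ (D.Ep '' {p | inPhiR N r p}) :=
    Submodule.subset_span ⟨(r, r), hr, by rw [Ep_eq, Eb_self]⟩
  have hF : D.F r ∈ Submodule.span ℂ (D.Fp '' {p | inPhiR N r p}) :=
    Submodule.subset_span ⟨(r, r), hr, by rw [Fp_eq, Fb_self]⟩
  refine Submodule.span_le.2 ?_
  rintro x ⟨k, hk, hx⟩
  have h := mem_triSpan_of_leviWord hE hF (span_Ep_mul_Ksub_le hq r) (span_Fp_mul_Ksub_le hq r)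
    (span_Ep_mul_F_le hq (by simp; omega)) hx
  refine (iSup₂_le fun p hp => ?_ : triSpan _ _ _ k ≤ _) h
  rw [mul_assoc, Submodule.mul_le]
  intro κ hκ m hm
  have hm' := sortedSpan_mul_le lF lE _ _
    (mul_le_mul' ((span_pow_le_wordSpan _).trans
        (wordSpan_le_sortedSpan (reorderable_Fp hq r) hlFnd hlF _))
      ((span_pow_le_wordSpan _).trans
        (wordSpan_le_sortedSpan (reorderable_Ep hq r) hlEnd hlE _)) hm)
  have hJ := mul_sub_counit_mem_Jsub hκ m
  rw [← add_sub_cancel (Coalgebra.counit (R := ℂ) κ • m) (κ * m)]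
  refine Submodule.add_mem_sup (Submodule.smul_mem _ _ ?_) hJ
  exact Submodule.mem_iSup_of_mem (p.1 + p.2) (Submodule.mem_iSup_of_mem (by omega) hm')

theorem Gh_eq_monSpanLe (hq : Transcendental ℚ q) (hr1 : 1 ≤ r) (hr2 : r ≤ N - 1)
    {lF lE : List (ℕ × ℕ)} (hlFnd : lF.Nodup) (hlF : ∀ p, p ∈ lF ↔ inPhiR N r p)
    (hlEnd : lE.Nodup) (hlE : ∀ p, p ∈ lE ↔ inPhiR N r p) (n : ℕ) :
    D.Gh r n = monSpanLe D lF lE n ⊔ D.Jsub r := by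
  have hletter : ∀ p ∈ lF.map Sum.inl ++ lE.map Sum.inr, D.letter p ∈ D.G r 1 := by
    intro p hp
    refine letter_mem_G hr2 ?_
    simp only [List.mem_append, List.mem_map] at hp
    rcases hp with ⟨p, hp, rfl⟩ | ⟨p, hp, rfl⟩
    exacts [(hlF p).1 hp, (hlE p).1 hp]
  refine le_antisymm (sup_le ((G_le_sortedSpan hq hr1 hr2 hlFnd hlF hlEnd hlE n).trans
    (sup_le_sup_right (iSup₂_le fun k hk => ?_) _)) le_sup_right) (sup_le_sup_right ?_ _)
  · refine Submodule.span_mono ?_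
    rintro _ ⟨c, hc, rfl⟩
    refine ⟨c ∘ Sum.inl, c ∘ Sum.inr, ?_, ?_⟩
    · simp only [List.map_append, List.map_map, List.sum_append] at hc
      omega
    · simp [Function.comp_def, letter, Fp, Ep]
  · refine Submodule.span_le.2 ?_
    rintro _ ⟨c, d, hcd, rfl⟩
    refine G_mono (by exact_mod_cast hcd) (sortedSpan_le_G hletter _
      (Submodule.subset_span ⟨Sum.elim c d, ?_, ?_⟩))
    · simp [Function.comp_def]
    · simp [Function.comp_def, letter, Fp, Ep]

theorem Gh_le_sortedSpan_sup (hq : Transcendental ℚ q) (hr1 : 1 ≤ r) (hr2 : r ≤ N - 1)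
    {lF lE : List (ℕ × ℕ)} (hlFnd : lF.Nodup) (hlF : ∀ p, p ∈ lF ↔ inPhiR N r p)
    (hlEnd : lE.Nodup) (hlE : ∀ p, p ∈ lE ↔ inPhiR N r p) (n : ℕ) :
    D.Gh r n ≤ sortedSpan D.letter (lF.map Sum.inl ++ lE.map Sum.inr) n ⊔ D.Gh r (n - 1) := by
  have hletter : ∀ p ∈ lF.map Sum.inl ++ lE.map Sum.inr, D.letter p ∈ D.G r 1 := by
    intro p hp
    refine letter_mem_G hr2 ?_
    simp only [List.mem_append, List.mem_map] at hp
    rcases hp with ⟨p, hp, rfl⟩ | ⟨p, hp, rfl⟩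
    exacts [(hlF p).1 hp, (hlE p).1 hp]
  refine sup_le ((G_le_sortedSpan hq hr1 hr2 hlFnd hlF hlEnd hlE n).trans
    (sup_le (iSup₂_le fun k hk => ?_) ((Jsub_le_Gh _).trans le_sup_right)))
    ((Jsub_le_Gh _).trans le_sup_right)
  rcases hk.eq_or_lt with rfl | hk
  · exact le_sup_left
  · exact (sortedSpan_le_G hletter k).trans ((G_mono (by omega)).trans
      ((G_le_Gh _).trans le_sup_right))

end UqslData

lemma range_map_id_subtype {V : Type*} [AddCommGroup V] [Module ℂ V] (S : Submodule ℂ V) :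
    LinearMap.range (TensorProduct.map (LinearMap.id : V →ₗ[ℂ] V) S.subtype) =
      Submodule.map₂ (TensorProduct.mk ℂ V V) ⊤ S := by
  refine le_antisymm ?_ (Submodule.map₂_le.2 fun a _ b hb => ⟨a ⊗ₜ ⟨b, hb⟩, by simp⟩)
  rintro _ ⟨z, rfl⟩
  induction z using TensorProduct.induction_on with
  | zero => simp
  | tmul a b => exact Submodule.apply_mem_map₂ _ trivial b.2
  | add x y hx hy => rw [map_add]; exact add_mem hx hy

lemma range_map_subtype_id {V : Type*} [AddCommGroup V] [Module ℂ V] (S : Submodule ℂ V) :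
    LinearMap.range (TensorProduct.map S.subtype (LinearMap.id : V →ₗ[ℂ] V)) =
      Submodule.map₂ (TensorProduct.mk ℂ V V) S ⊤ := by
  refine le_antisymm ?_ (Submodule.map₂_le.2 fun a ha b _ => ⟨⟨a, ha⟩ ⊗ₜ b, by simp⟩)
  rintro _ ⟨z, rfl⟩
  induction z using TensorProduct.induction_on with
  | zero => simp
  | tmul a b => exact Submodule.apply_mem_map₂ _ a.2 trivial
  | add x y hx hy => rw [map_add]; exact add_mem hx hy

lemma map₂_mk_mul_le {V : Type*} [Ring V] [Algebra ℂ V] {A B A' B' A'' B'' : Submodule ℂ V}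
    (hA : A * A' ≤ A'') (hB : B * B' ≤ B'') :
    Submodule.map₂ (TensorProduct.mk ℂ V V) A B * Submodule.map₂ (TensorProduct.mk ℂ V V) A' B' ≤
      Submodule.map₂ (TensorProduct.mk ℂ V V) A'' B'' := by
  rw [Submodule.map₂_eq_span_image2, Submodule.map₂_eq_span_image2, Submodule.span_mul_span,
    Submodule.span_le]
  rintro _ ⟨_, ⟨a, ha, b, hb, rfl⟩, _, ⟨a', ha', b', hb', rfl⟩, rfl⟩
  simp only [TensorProduct.mk_apply, Algebra.TensorProduct.tmul_mul_tmul]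
  exact Submodule.apply_mem_map₂ _ (hA (Submodule.mul_mem_mul ha ha'))
    (hB (Submodule.mul_mem_mul hb hb'))

namespace UqslData

variable {q : ℝ} {N : ℕ} (D : UqslData q N) (r : ℕ)

/-- The filtration of `U ⊗ U` that is compatible with the coproduct and the filtration `G`. -/
def T (n : ℤ) : Submodule ℂ (D.U ⊗[ℂ] D.U) :=
  Submodule.map₂ (TensorProduct.mk ℂ D.U D.U) (D.G r 0) (D.G r n) ⊔
    Submodule.map₂ (TensorProduct.mk ℂ D.U D.U) ⊤ (D.G r (n - 1))

variable {D r}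

lemma G_mul_le (m n : ℤ) : D.G r m * D.G r n ≤ D.G r (m + n) :=
  Submodule.mul_le.2 fun _ hx _ hy => mul_mem_G hx hy

lemma T_mul_le (m n : ℤ) : D.T r m * D.T r n ≤ D.T r (m + n) := by
  have h0 : D.G r 0 * D.G r 0 ≤ D.G r 0 := by simpa using G_mul_le (D := D) (r := r) 0 0
  rw [T, T, Submodule.sup_mul, Submodule.mul_sup, Submodule.mul_sup]
  refine sup_le (sup_le ?_ ?_) (sup_le ?_ ?_)
  · exact (map₂_mk_mul_le h0 (G_mul_le _ _)).trans le_sup_left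
  · exact (map₂_mk_mul_le le_top ((G_mul_le _ _).trans (G_mono (by omega)))).trans le_sup_right
  · exact (map₂_mk_mul_le le_top ((G_mul_le _ _).trans (G_mono (by omega)))).trans le_sup_right
  · exact (map₂_mk_mul_le le_top ((G_mul_le _ _).trans (G_mono (by omega)))).trans le_sup_right

lemma T_mono {m n : ℤ} (h : m ≤ n) : D.T r m ≤ D.T r n :=
  sup_le_sup (Submodule.map₂_le_map₂_right (G_mono h))
    (Submodule.map₂_le_map₂_right (G_mono (by omega)))

lemma comul_mem_of_mem_Ksub {k : D.U} (hk : k ∈ D.Ksub r) :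
    Coalgebra.comul (R := ℂ) k ∈ Submodule.map₂ (TensorProduct.mk ℂ D.U D.U)
      (Subalgebra.toSubmodule (D.Ksub r)) (Subalgebra.toSubmodule (D.Ksub r)) := by
  have tm : ∀ {a b : D.U}, a ∈ D.Ksub r → b ∈ D.Ksub r →
      a ⊗ₜ[ℂ] b ∈ Submodule.map₂ (TensorProduct.mk ℂ D.U D.U)
      (Subalgebra.toSubmodule (D.Ksub r)) (Subalgebra.toSubmodule (D.Ksub r)) :=
    fun ha hb => Submodule.apply_mem_map₂ _ ((Subalgebra.mem_toSubmodule _).2 ha)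
      ((Subalgebra.mem_toSubmodule _).2 hb)
  induction hk using Algebra.adjoin_induction with
  | mem x hx =>
    rcases hx with ⟨i, hi, hir, rfl | rfl⟩ | ⟨j, hj, rfl | rfl⟩
    · rw [D.comul_E i hi]
      exact add_mem (tm (Algebra.subset_adjoin (Or.inl ⟨i, hi, hir, Or.inl rfl⟩)) (one_mem _))
        (tm (Kg_mem_Ksub hi) (Algebra.subset_adjoin (Or.inl ⟨i, hi, hir, Or.inl rfl⟩)))
    · rw [D.comul_F i hi]
      exact add_mem (tm (Algebra.subset_adjoin (Or.inl ⟨i, hi, hir, Or.inr rfl⟩)) (Ki_mem_Ksub hi))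
        (tm (one_mem _) (Algebra.subset_adjoin (Or.inl ⟨i, hi, hir, Or.inr rfl⟩)))
    · rw [D.comul_Kg j hj]; exact tm (Kg_mem_Ksub hj) (Kg_mem_Ksub hj)
    · rw [D.comul_Ki j hj]; exact tm (Ki_mem_Ksub hj) (Ki_mem_Ksub hj)
  | algebraMap c =>
    rw [Bialgebra.comul_algebraMap, Algebra.TensorProduct.algebraMap_apply]
    exact tm (Subalgebra.algebraMap_mem _ c) (one_mem _)
  | add x y _ _ hx hy => rw [map_add]; exact add_mem hx hy
  | mul x y _ _ hx hy =>
    rw [Bialgebra.comul_mul]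
    have hKK : Subalgebra.toSubmodule (D.Ksub r) * Subalgebra.toSubmodule (D.Ksub r) ≤
        Subalgebra.toSubmodule (D.Ksub r) := Submodule.mul_le.2 fun _ ha _ hb =>
        (Subalgebra.mem_toSubmodule _).2 (mul_mem (S := Subalgebra ℂ D.U) ha hb)
    exact map₂_mk_mul_le hKK hKK (Submodule.mul_mem_mul hx hy)

lemma comul_mem_T (hr : r ∈ Finset.Icc 1 (N - 1)) {n : ℤ} {x : D.U} (hx : x ∈ D.G r n) :
    Coalgebra.comul (R := ℂ) x ∈ D.T r n := by
  have tm : ∀ {a b : D.U} {m : ℤ}, a ∈ D.G r 0 → b ∈ D.G r m → a ⊗ₜ[ℂ] b ∈ D.T r m :=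
    fun ha hb => Submodule.mem_sup_left (Submodule.apply_mem_map₂ _ ha hb)
  have tm' : ∀ {a b : D.U} {m : ℤ}, b ∈ D.G r (m - 1) → a ⊗ₜ[ℂ] b ∈ D.T r m :=
    fun hb => Submodule.mem_sup_right (Submodule.apply_mem_map₂ _ trivial hb)
  have hK : ∀ {k : D.U}, k ∈ D.Ksub r → Coalgebra.comul (R := ℂ) k ∈ D.T r 0 := fun hk =>
    ((Submodule.map₂_le_map₂ (fun _ h => Ksub_le_G h) (fun _ h => Ksub_le_G h)).trans
      le_sup_left : _ ≤ D.T r 0) (comul_mem_of_mem_Ksub hk)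
  have hE : Coalgebra.comul (R := ℂ) (D.E r) ∈ D.T r 1 := by
    rw [D.comul_E r hr]
    exact add_mem (tm' (by simpa using one_mem_G)) (tm (Ksub_le_G (Kg_mem_Ksub hr)) E_mem_G)
  have hF : Coalgebra.comul (R := ℂ) (D.F r) ∈ D.T r 1 := by
    rw [D.comul_F r hr]
    exact add_mem (tm' (by simpa using Ksub_le_G (Ki_mem_Ksub hr))) (tm one_mem_G F_mem_G)
  have key : ∀ {k : ℕ} {x : D.U}, LeviWord (D.Ksub r) (D.E r) (D.F r) k x →
      Coalgebra.comul (R := ℂ) x ∈ D.T r k := by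
    intro k x hx
    induction hx with
    | one => simpa using hK (one_mem _)
    | levi _ hk ih =>
      rw [Bialgebra.comul_mul]
      simpa using T_mul_le _ _ (Submodule.mul_mem_mul ih (hK hk))
    | left _ ih =>
      rw [Bialgebra.comul_mul]
      simpa using T_mul_le _ _ (Submodule.mul_mem_mul ih hE)
    | right _ ih =>
      rw [Bialgebra.comul_mul]
      simpa using T_mul_le _ _ (Submodule.mul_mem_mul ih hF)
  refine (Submodule.span_le.2 ?_ : D.G r n ≤ (D.T r n).comap (Coalgebra.comul (R := ℂ))) hx
  rintro x ⟨k, hk, hx⟩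
  exact T_mono hk (key hx)

lemma comul_mul_sub_mem {k : D.U} (hk : k ∈ D.Ksub r) (t : D.U ⊗[ℂ] D.U) :
    Coalgebra.comul (R := ℂ) k * t - Coalgebra.counit (R := ℂ) k • t ∈
      Submodule.map₂ (TensorProduct.mk ℂ D.U D.U) (D.Jsub r) ⊤ ⊔
        Submodule.map₂ (TensorProduct.mk ℂ D.U D.U) ⊤ (D.Jsub r) := by
  set P := Submodule.map₂ (TensorProduct.mk ℂ D.U D.U) (D.Jsub r) ⊤ ⊔
        Submodule.map₂ (TensorProduct.mk ℂ D.U D.U) ⊤ (D.Jsub r) with hP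
  let e : D.U ⊗[ℂ] D.U →ₗ[ℂ] ℂ := Coalgebra.counit (R := ℂ) ∘ₗ (TensorProduct.lid ℂ D.U).toLinearMap
    ∘ₗ LinearMap.rTensor D.U (Coalgebra.counit (R := ℂ))
  have he : e (Coalgebra.comul (R := ℂ) k) = Coalgebra.counit (R := ℂ) k := by
    simp [e, Coalgebra.rTensor_counit_comul]
  rw [← he]
  have h := comul_mem_of_mem_Ksub hk
  rw [Submodule.map₂_eq_span_image2] at h
  generalize Coalgebra.comul (R := ℂ) k = z at h
  induction h using Submodule.span_induction with
  | mem z hz =>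
    obtain ⟨x, hx, y, hy, rfl⟩ := hz
    induction t using TensorProduct.induction_on with
    | zero => simp
    | add s t hs ht =>
      rw [mul_add, smul_add, add_sub_add_comm]; exact add_mem hs ht
    | tmul a b =>
      have h1 : (x * a - Coalgebra.counit (R := ℂ) x • a) ⊗ₜ[ℂ] (y * b) ∈ P :=
        Submodule.mem_sup_left (Submodule.apply_mem_map₂ _ (mul_sub_counit_mem_Jsub hx a) trivial)
      have h2 : (Coalgebra.counit (R := ℂ) x • a) ⊗ₜ[ℂ] (y * b - Coalgebra.counit (R := ℂ) y • b)
          ∈ P :=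
        Submodule.mem_sup_right (Submodule.apply_mem_map₂ _ trivial (mul_sub_counit_mem_Jsub hy b))
      convert add_mem h1 h2 using 1
      simp [e, TensorProduct.sub_tmul, TensorProduct.tmul_sub, TensorProduct.smul_tmul', smul_smul,
        mul_comm]
  | zero => simp
  | add x y _ _ hx hy =>
    rw [add_mul, map_add, add_smul, add_sub_add_comm]; exact add_mem hx hy
  | smul c x _ hx =>
    rw [smul_mul_assoc, map_smul, smul_assoc, ← smul_sub]; exact Submodule.smul_mem _ _ hx

lemma coradSeq_succ (k : ℕ) : coradSeq D r (k + 1) = Submodule.comap (Coalgebra.comul (R := ℂ))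
    (Submodule.map₂ (TensorProduct.mk ℂ D.U D.U) ⊤ (coradSeq D r k) ⊔
      Submodule.map₂ (TensorProduct.mk ℂ D.U D.U) (coradSeq D r 0) ⊤) := by
  rw [← range_map_id_subtype, ← range_map_subtype_id]
  rfl

lemma Jsub_le_coradSeq (k : ℕ) : D.Jsub r ≤ coradSeq D r k := by
  induction k with
  | zero => exact le_sup_right
  | succ k ih =>
    rw [coradSeq_succ]
    refine Submodule.span_le.2 ?_
    rintro _ ⟨x, hx, hx0, u, rfl⟩
    have h := comul_mul_sub_mem hx (Coalgebra.comul (R := ℂ) u)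
    rw [hx0, zero_smul, sub_zero, ← Bialgebra.comul_mul] at h
    rw [SetLike.mem_coe, Submodule.mem_comap]
    rw [sup_comm] at h
    refine SetLike.le_def.1 (sup_le_sup (Submodule.map₂_le_map₂_right ih)
      (Submodule.map₂_le_map₂_left ?_)) h
    exact le_sup_right

lemma G_le_coradSeq (hr : r ∈ Finset.Icc 1 (N - 1)) (k : ℕ) : D.G r k ≤ coradSeq D r k := by
  induction k with
  | zero => exact G_zero_le
  | succ k ih =>
    rw [coradSeq_succ]
    intro x hx
    have h := comul_mem_T hr hx
    rw [T, sup_comm] at h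
    rw [Submodule.mem_comap]
    refine SetLike.le_def.1 (sup_le_sup (Submodule.map₂_le_map₂_right ?_)
      (Submodule.map₂_le_map₂ G_zero_le le_top)) h
    simpa using ih

lemma Gh_le_coradSeq (hr : r ∈ Finset.Icc 1 (N - 1)) (k : ℕ) : D.Gh r k ≤ coradSeq D r k :=
  sup_le (G_le_coradSeq hr k) (Jsub_le_coradSeq k)

/-- Contraction of the first tensor factor with a functional. -/
def Sop (f : D.U →ₗ[ℂ] ℂ) : D.U ⊗[ℂ] D.U →ₗ[ℂ] D.U :=
  (TensorProduct.lid ℂ D.U).toLinearMap ∘ₗ LinearMap.rTensor D.U f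

@[simp] lemma Sop_tmul (f : D.U →ₗ[ℂ] ℂ) (a b : D.U) : Sop f (a ⊗ₜ[ℂ] b) = f a • b := by
  simp [Sop]

/-- The action of a functional on `U` through the first tensor factor of the coproduct. -/
def Rop (f : D.U →ₗ[ℂ] ℂ) : D.U →ₗ[ℂ] D.U := Sop f ∘ₗ Coalgebra.comul (R := ℂ)

lemma Rop_apply (f : D.U →ₗ[ℂ] ℂ) (x : D.U) : Rop f x = Sop f (Coalgebra.comul (R := ℂ) x) := rfl

lemma Rop_counit (x : D.U) : Rop (Coalgebra.counit (R := ℂ)) x = x := by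
  simp [Rop, Sop, Coalgebra.rTensor_counit_comul]

lemma Sop_add (f g : D.U →ₗ[ℂ] ℂ) : Sop (f + g) = Sop f + Sop g := by
  ext; simp [add_smul]

lemma Sop_smul (c : ℂ) (f : D.U →ₗ[ℂ] ℂ) : Sop (c • f) = c • Sop f := by
  ext; simp [smul_smul]

lemma Rop_add (f g : D.U →ₗ[ℂ] ℂ) (x : D.U) : Rop (f + g) x = Rop f x + Rop g x := by
  simp [Rop_apply, Sop_add]

lemma Rop_smul (c : ℂ) (f : D.U →ₗ[ℂ] ℂ) (x : D.U) : Rop (c • f) x = c • Rop f x := by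
  simp [Rop_apply, Sop_smul]

lemma Sop_mul_tmul (f : D.U →ₗ[ℂ] ℂ) (z : D.U ⊗[ℂ] D.U) (a b : D.U) :
    Sop f (z * a ⊗ₜ[ℂ] b) = Sop (f ∘ₗ LinearMap.mulRight ℂ a) z * b := by
  induction z using TensorProduct.induction_on with
  | zero => simp
  | tmul x y => simp
  | add x y hx hy => simp only [add_mul, map_add, hx, hy]

variable (r) in
/-- Functionals that vanish on `K⁺U`. -/
def VanishJ (f : D.U →ₗ[ℂ] ℂ) : Prop := ∀ x ∈ D.Jsub r, f x = 0

lemma vanishJ_counit : VanishJ r (Coalgebra.counit (R := ℂ) : D.U →ₗ[ℂ] ℂ) := fun x hx => by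
  induction hx using Submodule.span_induction with
  | mem x hx => obtain ⟨k, _, hk, u, rfl⟩ := hx; simp [hk]
  | zero => simp
  | add x y _ _ hx hy => simp [hx, hy]
  | smul c x _ hx => simp [hx]

lemma VanishJ.apply_mul {f : D.U →ₗ[ℂ] ℂ} (hf : VanishJ r f) {k : D.U} (hk : k ∈ D.Ksub r)
    (u : D.U) : f (k * u) = Coalgebra.counit (R := ℂ) k * f u := by
  have := hf _ (mul_sub_counit_mem_Jsub hk u)
  rw [map_sub, map_smul, smul_eq_mul] at this
  exact sub_eq_zero.1 this

lemma VanishJ.Sop_comul_mul {f : D.U →ₗ[ℂ] ℂ} (hf : VanishJ r f) {k : D.U} (hk : k ∈ D.Ksub r)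
    (t : D.U ⊗[ℂ] D.U) : Sop f (Coalgebra.comul (R := ℂ) k * t) = k * Sop f t := by
  have key : ∀ z ∈ Submodule.map₂ (TensorProduct.mk ℂ D.U D.U)
      (Subalgebra.toSubmodule (D.Ksub r)) (Subalgebra.toSubmodule (D.Ksub r)),
      Sop f (z * t) = Sop (Coalgebra.counit (R := ℂ)) z * Sop f t := by
    intro z hz
    rw [Submodule.map₂_eq_span_image2] at hz
    induction hz using Submodule.span_induction with
    | mem z hz =>
      obtain ⟨x, hx, y, hy, rfl⟩ := hz
      induction t using TensorProduct.induction_on with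
      | zero => simp
      | tmul a b =>
        simp [hf.apply_mul hx, smul_smul, mul_comm]
      | add s t hs ht => simp only [mul_add, map_add, hs, ht]
    | zero => simp
    | add x y _ _ hx hy => simp only [add_mul, map_add, hx, hy]
    | smul c x _ hx => simp only [smul_mul_assoc, map_smul, hx]
  rw [key _ (comul_mem_of_mem_Ksub hk), ← Rop_apply, Rop_counit]

lemma VanishJ.Rop_mem_Jsub {f : D.U →ₗ[ℂ] ℂ} (hf : VanishJ r f) {x : D.U} (hx : x ∈ D.Jsub r) :
    Rop f x ∈ D.Jsub r := by
  refine (Submodule.span_le.2 ?_ : D.Jsub r ≤ (D.Jsub r).comap (Rop f)) hx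
  rintro _ ⟨k, hk, hk0, u, rfl⟩
  rw [SetLike.mem_coe, Submodule.mem_comap, Rop_apply, Bialgebra.comul_mul, hf.Sop_comul_mul hk]
  exact Submodule.subset_span ⟨k, hk, hk0, _, rfl⟩

lemma VanishJ.eq_zero {f : D.U →ₗ[ℂ] ℂ} (hf : VanishJ r f) (h1 : f 1 = 0) {x : D.U}
    (hx : x ∈ Submodule.span ℂ {(1 : D.U)} ⊔ D.Jsub r) : f x = 0 := by
  obtain ⟨a, ha, b, hb, rfl⟩ := Submodule.mem_sup.1 hx
  obtain ⟨c, rfl⟩ := Submodule.mem_span_singleton.1 ha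
  simp [h1, hf b hb]

lemma Sop_mem_of_mem_map₂ {f : D.U →ₗ[ℂ] ℂ} {A B : Submodule ℂ D.U} {z : D.U ⊗[ℂ] D.U}
    (hz : z ∈ Submodule.map₂ (TensorProduct.mk ℂ D.U D.U) A B) : Sop f z ∈ B := by
  refine (Submodule.map₂_le.2 ?_ : _ ≤ B.comap (Sop f)) hz
  intro a _ b hb
  simpa using Submodule.smul_mem _ _ hb

lemma Sop_eq_zero_of_mem_map₂ {f : D.U →ₗ[ℂ] ℂ} {A B : Submodule ℂ D.U} (hA : ∀ a ∈ A, f a = 0)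
    {z : D.U ⊗[ℂ] D.U}
    (hz : z ∈ Submodule.map₂ (TensorProduct.mk ℂ D.U D.U) A B) : Sop f z = 0 := by
  refine (Submodule.map₂_le.2 ?_ : _ ≤ LinearMap.ker (Sop f)) hz
  intro a ha b _
  simp [hA a ha]

lemma VanishJ.Rop_mem_G (hr : r ∈ Finset.Icc 1 (N - 1)) {f : D.U →ₗ[ℂ] ℂ} (hf : VanishJ r f)
    (h1 : f 1 = 0) {n : ℤ} {x : D.U} (hx : x ∈ D.G r n) : Rop f x ∈ D.G r (n - 1) := by
  obtain ⟨a, ha, b, hb, hab⟩ := Submodule.mem_sup.1 (comul_mem_T hr hx)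
  rw [Rop_apply, ← hab, map_add,
    Sop_eq_zero_of_mem_map₂ (fun a ha => hf.eq_zero h1 (G_zero_le ha)) ha, zero_add]
  exact Sop_mem_of_mem_map₂ hb

lemma VanishJ.Rop_mem_Gh (hr : r ∈ Finset.Icc 1 (N - 1)) {f : D.U →ₗ[ℂ] ℂ} (hf : VanishJ r f)
    (h1 : f 1 = 0) {n : ℤ} {x : D.U} (hx : x ∈ D.Gh r n) : Rop f x ∈ D.Gh r (n - 1) := by
  obtain ⟨a, ha, b, hb, rfl⟩ := Submodule.mem_sup.1 hx
  rw [map_add]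
  exact Submodule.add_mem_sup (hf.Rop_mem_G hr h1 ha) (hf.Rop_mem_Jsub hb)

lemma VanishJ.Rop_sub_mem_Gh (hr : r ∈ Finset.Icc 1 (N - 1)) {f : D.U →ₗ[ℂ] ℂ}
    (hf : VanishJ r f) {n : ℤ} {x : D.U} (hx : x ∈ D.Gh r n) :
    Rop f x - f 1 • x ∈ D.Gh r (n - 1) := by
  have hf' : VanishJ r (f + (-f 1) • (Coalgebra.counit (R := ℂ) : D.U →ₗ[ℂ] ℂ)) := fun y hy => by
    simp [hf y hy, vanishJ_counit y hy]
  have := hf'.Rop_mem_Gh hr (by simp) hx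
  rwa [Rop_add, Rop_smul, Rop_counit, neg_smul, ← sub_eq_add_neg] at this

lemma VanishJ.Rop_mem_coradSeq {f : D.U →ₗ[ℂ] ℂ} (hf : VanishJ r f) (h1 : f 1 = 0) {k : ℕ}
    {x : D.U} (hx : x ∈ coradSeq D r (k + 1)) : Rop f x ∈ coradSeq D r k := by
  rw [coradSeq_succ, Submodule.mem_comap] at hx
  obtain ⟨a, ha, b, hb, hab⟩ := Submodule.mem_sup.1 hx
  rw [Rop_apply, ← hab, map_add, Sop_eq_zero_of_mem_map₂ (fun a ha => hf.eq_zero h1 ha) hb,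
    add_zero]
  exact Sop_mem_of_mem_map₂ ha

end UqslData

/-- `x` and `y` commute up to the scalar `c`. -/
def QComm {A : Type*} [Ring A] [Algebra ℂ A] (c : ℂ) (x y : A) : Prop := x * y = c • (y * x)

namespace QComm

variable {A : Type*} [Ring A] [Algebra ℂ A] {c d : ℂ} {x y z : A}

lemma mul_right (hy : QComm c x y) (hz : QComm d x z) : QComm (c * d) x (y * z) := by
  unfold QComm at *
  rw [← mul_assoc, hy, smul_mul_assoc, mul_assoc, hz, mul_smul_comm, smul_smul, mul_assoc]

lemma mul_left (hx : QComm c x z) (hy : QComm d y z) : QComm (c * d) (x * y) z := by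
  unfold QComm at *
  rw [mul_assoc, hy, mul_smul_comm, ← mul_assoc, hx, smul_mul_assoc, smul_smul, mul_assoc, mul_comm]

lemma sub_right (hy : QComm c x y) (hz : QComm c x z) : QComm c x (y - z) := by
  unfold QComm at *
  rw [mul_sub, hy, hz, ← smul_sub, sub_mul]

lemma smul_right (a : ℂ) (hy : QComm c x y) : QComm c x (a • y) := by
  unfold QComm at *
  rw [mul_smul_comm, hy, smul_mul_assoc, smul_comm]

lemma bracket (a : ℂ) (hy : QComm c x y) (hz : QComm d x z) :
    QComm (c * d) x (y * z - a • (z * y)) :=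
  (hy.mul_right hz).sub_right (mul_comm d c ▸ (hz.mul_right hy).smul_right a)

lemma congr (h : QComm c x y) (hcd : c = d) : QComm d x y := hcd ▸ h

lemma of_commute (h : Commute x y) : QComm 1 x y := by rw [QComm, h.eq, one_smul]

end QComm

namespace UqslData

variable {q : ℝ} {N : ℕ} (D : UqslData q N)

/-- Auxiliary product of `d` consecutive torus elements, starting at `i`. -/
def torVec (t : ℕ → D.U) : ℕ → ℕ → D.U
  | 0, _ => 1
  | d + 1, i => t i * torVec t d (i + 1)

/-- The torus element `K_i ⋯ K_{k-1}`. -/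
def Kb (i k : ℕ) : D.U := D.torVec D.Kg (k - i) i

/-- The torus element `K_i⁻¹ ⋯ K_{k-1}⁻¹`. -/
def Kib (i k : ℕ) : D.U := D.torVec D.Ki (k - i) i

variable {D}

lemma Kb_self (i : ℕ) : D.Kb i i = 1 := by simp [Kb, torVec]

lemma Kib_self (i : ℕ) : D.Kib i i = 1 := by simp [Kib, torVec]

lemma Kb_step {i k : ℕ} (h : i < k) : D.Kb i k = D.Kg i * D.Kb (i + 1) k := by
  obtain ⟨d, rfl⟩ := Nat.exists_eq_add_of_lt h
  rw [Kb, Kb, show i + d + 1 - i = d + 1 by omega, show i + d + 1 - (i + 1) = d by omega, torVec]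

lemma Kib_step {i k : ℕ} (h : i < k) : D.Kib i k = D.Ki i * D.Kib (i + 1) k := by
  obtain ⟨d, rfl⟩ := Nat.exists_eq_add_of_lt h
  rw [Kib, Kib, show i + d + 1 - i = d + 1 by omega, show i + d + 1 - (i + 1) = d by omega, torVec]

lemma cartanSL_self (i : ℕ) : cartanSL i i = 2 := if_pos rfl

lemma cartanSL_succ_left (i : ℕ) : cartanSL (i + 1) i = -1 := by
  rw [cartanSL, if_neg (by omega), if_pos (by omega)]

lemma cartanSL_succ_right (i : ℕ) : cartanSL i (i + 1) = -1 := by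
  rw [cartanSL, if_neg (by omega), if_pos (by omega)]

lemma cartanSL_far {i j : ℕ} (h : i + 1 < j ∨ j + 1 < i) : cartanSL i j = 0 := by
  rw [cartanSL, if_neg (by omega), if_neg (by omega)]

lemma qcomm_Kg_E {i j : ℕ} (hi : i ∈ Finset.Icc 1 (N - 1)) (hj : j ∈ Finset.Icc 1 (N - 1)) :
    QComm ((q : ℂ) ^ cartanSL i j) (D.Kg i) (D.E j) := D.rels.2.2.1 i hi j hj

lemma qcomm_Ki_F (hq : (q : ℂ) ≠ 0) {i j : ℕ} (hi : i ∈ Finset.Icc 1 (N - 1))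
    (hj : j ∈ Finset.Icc 1 (N - 1)) :
    QComm ((q : ℂ) ^ cartanSL i j) (D.Ki i) (D.F j) := by
  have h := congrArg (D.Ki i * · * D.Ki i) (D.rels.2.2.2.1 i hi j hj)
  have h1 := D.rels.1 i hi
  simp only [mul_smul_comm, smul_mul_assoc] at h
  rw [← mul_assoc, h1.2, one_mul, mul_assoc (D.Ki i), mul_assoc (D.F j), h1.1, mul_one] at h
  rw [QComm, h, smul_smul, ← zpow_add₀ hq]
  simp

lemma torVec_commute {t : ℕ → D.U} {x : D.U} (d : ℕ) {i : ℕ}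
    (h : ∀ s, i ≤ s → s < i + d → Commute (t s) x) : Commute (D.torVec t d i) x := by
  induction d generalizing i with
  | zero => exact Commute.one_left _
  | succ d ih =>
    exact (h i le_rfl (by omega)).mul_left (ih fun s hs hs' => h s (by omega) (by omega))

lemma Kb_commute {x : D.U} {i k : ℕ} (h : ∀ s, i ≤ s → s < k → Commute (D.Kg s) x) :
    Commute (D.Kb i k) x := torVec_commute _ fun s hs hs' => h s hs (by omega)

lemma Kib_commute {x : D.U} {i k : ℕ} (h : ∀ s, i ≤ s → s < k → Commute (D.Ki s) x) :
    Commute (D.Kib i k) x := torVec_commute _ fun s hs hs' => h s hs (by omega)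

lemma commute_Kg_Kg {i j : ℕ} (hi : i ∈ Finset.Icc 1 (N - 1)) (hj : j ∈ Finset.Icc 1 (N - 1)) :
    Commute (D.Kg i) (D.Kg j) := D.rels.2.1 i hi j hj

lemma commute_Ki_Kg {i j : ℕ} (hi : i ∈ Finset.Icc 1 (N - 1)) (hj : j ∈ Finset.Icc 1 (N - 1)) :
    Commute (D.Ki i) (D.Kg j) := by
  have h := congrArg (D.Ki i * · * D.Ki i) (D.rels.2.1 i hi j hj)
  have h1 := D.rels.1 i hi
  rw [← mul_assoc, h1.2, one_mul, mul_assoc (D.Ki i), mul_assoc (D.Kg j), h1.1, mul_one] at h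
  exact h.symm

lemma commute_Ki_Ki {i j : ℕ} (hi : i ∈ Finset.Icc 1 (N - 1)) (hj : j ∈ Finset.Icc 1 (N - 1)) :
    Commute (D.Ki i) (D.Ki j) := by
  have h := congrArg (D.Ki j * · * D.Ki j) (commute_Ki_Kg (D := D) hi hj).eq
  have h1 := D.rels.1 j hj
  rw [← mul_assoc (D.Ki j) (D.Kg j), h1.2, one_mul, mul_assoc (D.Ki j), mul_assoc (D.Ki i), h1.1,
    mul_one] at h
  exact h.symm

lemma commute_Kg_E {i j : ℕ} (hi : i ∈ Finset.Icc 1 (N - 1)) (hj : j ∈ Finset.Icc 1 (N - 1))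
    (h : i + 1 < j ∨ j + 1 < i) : Commute (D.Kg i) (D.E j) := by
  have := qcomm_Kg_E (D := D) hi hj
  rwa [cartanSL_far h, zpow_zero, QComm, one_smul] at this

lemma commute_Ki_F (hq : (q : ℂ) ≠ 0) {i j : ℕ} (hi : i ∈ Finset.Icc 1 (N - 1))
    (hj : j ∈ Finset.Icc 1 (N - 1)) (h : i + 1 < j ∨ j + 1 < i) :
    Commute (D.Ki i) (D.F j) := by
  have := qcomm_Ki_F (D := D) hq hi hj
  rwa [cartanSL_far h, zpow_zero, QComm, one_smul] at this

lemma Eb_commute {x : D.U} {i k : ℕ} (hik : i < k)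
    (h : ∀ s, i ≤ s → s < k → Commute x (D.E s)) : Commute x (D.Eb i k) := by
  rw [Eb_eq]; exact commute_rootBr hik h

lemma Fb_commute {x : D.U} {i k : ℕ} (hik : i < k)
    (h : ∀ s, i ≤ s → s < k → Commute x (D.F s)) : Commute x (D.Fb i k) := by
  induction i, hik using interval_induction with
  | base i _ hi => subst hi; rw [Fb_self]; exact h i le_rfl (by omega)
  | step i _ hi ih =>
    have h1 := ih fun s hs hs' => h s (by omega) hs'
    have h2 := h i le_rfl (by omega)
    rw [Fb_step hi]
    exact (h1.mul_right h2).sub_right ((h2.mul_right h1).smul_right _)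

lemma qcomm_Kb_E {i k : ℕ} (hi : 1 ≤ i) (hik : i + 1 < k) (hk : k ≤ N) :
    QComm (q : ℂ)⁻¹ (D.Kb (i + 1) k) (D.E i) := by
  rw [Kb_step hik]
  have h1 := qcomm_Kg_E (D := D) (i := i + 1) (j := i) (by simp; omega) (by simp; omega)
  rw [cartanSL_succ_left, zpow_neg_one] at h1
  simpa using h1.mul_left (.of_commute (Kb_commute (i := i + 1 + 1) (k := k) fun s hs hs' =>
    commute_Kg_E (by simp; omega) (by simp; omega) (by omega)))

lemma qcomm_Kib_F (hq : (q : ℂ) ≠ 0) {i k : ℕ} (hi : 1 ≤ i) (hik : i + 1 < k) (hk : k ≤ N) :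
    QComm (q : ℂ)⁻¹ (D.Kib (i + 1) k) (D.F i) := by
  rw [Kib_step hik]
  have h1 := qcomm_Ki_F (D := D) (i := i + 1) (j := i) hq (by simp; omega) (by simp; omega)
  rw [cartanSL_succ_left, zpow_neg_one] at h1
  simpa using h1.mul_left (.of_commute (Kib_commute (i := i + 1 + 1) (k := k) fun s hs hs' =>
    commute_Ki_F hq (by simp; omega) (by simp; omega) (by omega)))

lemma qcomm_Kg_Eb {i k : ℕ} (hi : 1 ≤ i) (hik : i + 1 < k) (hk : k ≤ N) :
    QComm (q : ℂ)⁻¹ (D.Kg i) (D.Eb (i + 1) k) := by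
  have h1 := qcomm_Kg_E (D := D) (i := i) (j := i + 1) (by simp; omega) (by simp; omega)
  rw [cartanSL_succ_right, zpow_neg_one] at h1
  by_cases h : i + 1 + 1 < k
  · rw [Eb_step h]
    simpa using h1.bracket (q : ℂ)⁻¹ (.of_commute (Eb_commute h fun s hs hs' =>
      commute_Kg_E (by simp; omega) (by simp; omega) (by omega)))
  · obtain rfl : k = i + 1 + 1 := by omega
    rwa [Eb_self]

lemma qcomm_Ki_Fb (hq : (q : ℂ) ≠ 0) {i k : ℕ} (hi : 1 ≤ i) (hik : i + 1 < k) (hk : k ≤ N) :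
    QComm (q : ℂ)⁻¹ (D.Ki i) (D.Fb (i + 1) k) := by
  have h1 := qcomm_Ki_F (D := D) (i := i) (j := i + 1) hq (by simp; omega) (by simp; omega)
  rw [cartanSL_succ_right, zpow_neg_one] at h1
  by_cases h : i + 1 + 1 < k
  · rw [Fb_step h]
    have h2 : QComm 1 (D.Ki i) (D.Fb (i + 1 + 1) k) := .of_commute (Fb_commute h fun s hs hs' =>
      commute_Ki_F hq (by simp; omega) (by simp; omega) (by omega))
    simpa using h2.bracket (q : ℂ)⁻¹ h1
  · obtain rfl : k = i + 1 + 1 := by omega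
    rwa [Fb_self]

lemma qcomm_Kib_Fb (hq : (q : ℂ) ≠ 0) {i k : ℕ} (hi : 1 ≤ i) (hik : i < k) (hk : k ≤ N) :
    QComm ((q : ℂ) ^ 2) (D.Kib i k) (D.Fb i k) := by
  induction i, hik using interval_induction with
  | base i _ hi' =>
    subst hi'
    have h1 := qcomm_Ki_F (D := D) (i := i) (j := i) hq (by simp; omega) (by simp; omega)
    rw [cartanSL_self] at h1
    rw [Fb_self, Kib_step (by omega), Kib_self, mul_one]
    exact_mod_cast h1
  | step i _ hi' ih =>
    have h1 := qcomm_Ki_F (D := D) (i := i) (j := i) hq (by simp; omega) (by simp; omega)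
    rw [cartanSL_self] at h1
    rw [Fb_step hi', Kib_step (by omega)]
    refine (((qcomm_Ki_Fb hq hi hi' hk).mul_left (ih (by omega))).bracket (q : ℂ)⁻¹
      (h1.mul_left (qcomm_Kib_F hq hi hi' hk))).congr ?_
    field_simp

lemma Kib_mul_Kb {i k : ℕ} (hi : 1 ≤ i) (hik : i ≤ k) (hk : k ≤ N) :
    D.Kib i k * D.Kb i k = 1 := by
  induction hik using Nat.decreasingInduction with
  | self => rw [Kib_self, Kb_self, one_mul]
  | of_succ i hi' ih =>
    have hi'' : i ∈ Finset.Icc 1 (N - 1) := by simp; omega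
    have hc : Commute (D.Kb (i + 1) k) (D.Kg i) := Kb_commute fun s hs hs' =>
      commute_Kg_Kg (by simp; omega) hi''
    rw [Kib_step hi', Kb_step hi', ← hc.eq, mul_assoc, ← mul_assoc (D.Kib (i + 1) k),
      ih (by omega), one_mul, (D.rels.1 i hi'').2]

lemma Kb_mem_Ksub {r i k : ℕ} (hi : 1 ≤ i) (hik : i ≤ k) (hk : k ≤ N) : D.Kb i k ∈ D.Ksub r := by
  induction hik using Nat.decreasingInduction with
  | self => rw [Kb_self]; exact one_mem _
  | of_succ i hi' ih =>
    rw [Kb_step hi']; exact mul_mem (Kg_mem_Ksub (by simp; omega)) (ih (by omega))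

lemma Kib_mem_Ksub {r i k : ℕ} (hi : 1 ≤ i) (hik : i ≤ k) (hk : k ≤ N) :
    D.Kib i k ∈ D.Ksub r := by
  induction hik using Nat.decreasingInduction with
  | self => rw [Kib_self]; exact one_mem _
  | of_succ i hi' ih =>
    rw [Kib_step hi']; exact mul_mem (Ki_mem_Ksub (by simp; omega)) (ih (by omega))

theorem comul_Eb {i k : ℕ} (hi : 1 ≤ i) (hik : i < k) (hk : k ≤ N) :
    Coalgebra.comul (R := ℂ) (D.Eb i k) = D.Eb i k ⊗ₜ[ℂ] 1 + D.Kb i k ⊗ₜ[ℂ] D.Eb i k +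
      (1 - (q : ℂ)⁻¹ ^ 2) • ∑ t ∈ Finset.Ico (i + 1) k,
        (D.Eb i t * D.Kb t k) ⊗ₜ[ℂ] D.Eb t k := by
  induction i, hik using interval_induction with
  | base i _ hi' =>
    subst hi'
    rw [Eb_self, Kb_step (by omega), Kb_self, mul_one, D.comul_E i (by simp; omega)]
    simp
  | step i _ hi' ih =>
    have hi'' : i ∈ Finset.Icc 1 (N - 1) := by simp; omega
    have h1 := qcomm_Kb_E (D := D) hi hi' hk
    have h2 := qcomm_Kg_Eb (D := D) hi hi' hk
    have hterm : ∀ t ∈ Finset.Ico (i + 1 + 1) k,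
        (D.E i ⊗ₜ[ℂ] 1 + D.Kg i ⊗ₜ[ℂ] D.E i) * (D.Eb (i + 1) t * D.Kb t k) ⊗ₜ[ℂ] D.Eb t k -
        (q : ℂ)⁻¹ • ((D.Eb (i + 1) t * D.Kb t k) ⊗ₜ[ℂ] D.Eb t k *
          (D.E i ⊗ₜ[ℂ] 1 + D.Kg i ⊗ₜ[ℂ] D.E i)) = (D.Eb i t * D.Kb t k) ⊗ₜ[ℂ] D.Eb t k := by
      intro t ht
      rw [Finset.mem_Ico] at ht
      have h3 : Commute (D.Kb t k) (D.E i) := Kb_commute fun s hs hs' =>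
        commute_Kg_E (by simp; omega) hi'' (by omega)
      have h4 := qcomm_Kg_Eb (D := D) (k := t) hi (by omega) (by omega)
      have h5 : Commute (D.Kb t k) (D.Kg i) := Kb_commute fun s hs hs' =>
        commute_Kg_Kg (by simp; omega) hi''
      have h6 : Commute (D.E i) (D.Eb t k) := Eb_commute ht.2 fun s hs hs' =>
        D.rels.2.2.2.2.2.2.1 i hi'' s (by simp; omega) (by omega)
      rw [Eb_step (i := i) (k := t) (by omega)]
      simp only [add_mul, mul_add, Algebra.TensorProduct.tmul_mul_tmul, one_mul, mul_one, sub_mul,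
        mul_assoc, h3.eq, h5.eq, h6.eq, smul_add, TensorProduct.sub_tmul, smul_mul_assoc,
        TensorProduct.smul_tmul']
      rw [← mul_assoc (D.Kg i), h4, smul_mul_assoc, mul_assoc]
      abel
    have hsum : ∑ t ∈ Finset.Ico (i + 1) k, (D.Eb i t * D.Kb t k) ⊗ₜ[ℂ] D.Eb t k =
        (D.E i * D.Kb (i + 1) k) ⊗ₜ[ℂ] D.Eb (i + 1) k +
        ∑ t ∈ Finset.Ico (i + 1 + 1) k, (D.Eb i t * D.Kb t k) ⊗ₜ[ℂ] D.Eb t k := by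
      rw [Finset.sum_eq_sum_Ico_succ_bot hi', Eb_self]
    rw [hsum, ← Finset.sum_congr rfl hterm, Finset.sum_sub_distrib, ← Finset.mul_sum,
      ← Finset.smul_sum, ← Finset.sum_mul]
    set S := ∑ t ∈ Finset.Ico (i + 1 + 1) k, (D.Eb (i + 1) t * D.Kb t k) ⊗ₜ[ℂ] D.Eb t k
    rw [Eb_step hi', map_sub, map_smul, Bialgebra.comul_mul, Bialgebra.comul_mul,
      D.comul_E i hi'', ih (by omega), Kb_step (i := i) (by omega)]
    unfold QComm at h1 h2
    have h7 : Commute (D.Kg i) (D.Kb (i + 1) k) := (Kb_commute fun s hs hs' =>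
        commute_Kg_Kg (by simp; omega) hi'').symm
    simp only [add_mul, mul_add, Algebra.TensorProduct.tmul_mul_tmul, one_mul, mul_one, smul_add,
      TensorProduct.sub_tmul, TensorProduct.tmul_sub, h1, h2, ← TensorProduct.smul_tmul',
      TensorProduct.tmul_smul, h7.eq, mul_smul_comm, smul_mul_assoc, smul_sub, smul_smul]
    module

theorem comul_Fb (hq : (q : ℂ) ≠ 0) {i k : ℕ} (hi : 1 ≤ i) (hik : i < k) (hk : k ≤ N) :
    Coalgebra.comul (R := ℂ) (D.Fb i k) = D.Fb i k ⊗ₜ[ℂ] D.Kib i k + 1 ⊗ₜ[ℂ] D.Fb i k +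
      (1 - (q : ℂ)⁻¹ ^ 2) • ∑ t ∈ Finset.Ico (i + 1) k,
        D.Fb i t ⊗ₜ[ℂ] (D.Fb t k * D.Kib i t) := by
  induction i, hik using interval_induction with
  | base i _ hi' =>
    subst hi'
    rw [Fb_self, Kib_step (by omega), Kib_self, mul_one, D.comul_F i (by simp; omega)]
    simp
  | step i _ hi' ih =>
    have hi'' : i ∈ Finset.Icc 1 (N - 1) := by simp; omega
    have h1 := qcomm_Kib_F (D := D) hq hi hi' hk
    have h2 := qcomm_Ki_Fb (D := D) hq hi hi' hk
    have hterm : ∀ t ∈ Finset.Ico (i + 1 + 1) k,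
        D.Fb (i + 1) t ⊗ₜ[ℂ] (D.Fb t k * D.Kib (i + 1) t) *
          (D.F i ⊗ₜ[ℂ] D.Ki i + 1 ⊗ₜ[ℂ] D.F i) -
        (q : ℂ)⁻¹ • ((D.F i ⊗ₜ[ℂ] D.Ki i + 1 ⊗ₜ[ℂ] D.F i) *
          D.Fb (i + 1) t ⊗ₜ[ℂ] (D.Fb t k * D.Kib (i + 1) t)) =
        D.Fb i t ⊗ₜ[ℂ] (D.Fb t k * D.Kib i t) := by
      intro t ht
      rw [Finset.mem_Ico] at ht
      have h3 : Commute (D.Ki i) (D.Fb t k) := Fb_commute ht.2 fun s hs hs' =>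
        commute_Ki_F hq hi'' (by simp; omega) (by omega)
      have h4 := qcomm_Kib_F (D := D) (k := t) hq hi (by omega) (by omega)
      have h5 : Commute (D.Kib (i + 1) t) (D.Ki i) := Kib_commute fun s hs hs' =>
        commute_Ki_Ki (by simp; omega) hi''
      have h6 : Commute (D.F i) (D.Fb t k) := Fb_commute ht.2 fun s hs hs' =>
        D.rels.2.2.2.2.2.2.2.2 i hi'' s (by simp; omega) (by omega)
      rw [Fb_step (i := i) (k := t) (by omega), Kib_step (i := i) (k := t) (by omega)]
      simp only [add_mul, mul_add, Algebra.TensorProduct.tmul_mul_tmul, one_mul, mul_one,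
        smul_add, TensorProduct.sub_tmul]
      rw [← mul_assoc (D.Ki i), h3.eq, mul_assoc _ (D.Kib (i + 1) t) (D.Ki i), h5.eq,
        mul_assoc _ (D.Kib (i + 1) t) (D.F i), h4, ← mul_assoc (D.F i), h6.eq, mul_smul_comm,
        TensorProduct.tmul_smul, mul_assoc _ (D.F i), mul_assoc _ (D.Ki i),
        TensorProduct.smul_tmul']
      abel
    have hsum : ∑ t ∈ Finset.Ico (i + 1) k, D.Fb i t ⊗ₜ[ℂ] (D.Fb t k * D.Kib i t) =
        D.F i ⊗ₜ[ℂ] (D.Fb (i + 1) k * D.Ki i) +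
        ∑ t ∈ Finset.Ico (i + 1 + 1) k, D.Fb i t ⊗ₜ[ℂ] (D.Fb t k * D.Kib i t) := by
      rw [Finset.sum_eq_sum_Ico_succ_bot hi', Fb_self, Kib_step (i := i) (k := i + 1) (by omega),
        Kib_self, mul_one]
    rw [hsum, ← Finset.sum_congr rfl hterm, Finset.sum_sub_distrib, ← Finset.sum_mul,
      ← Finset.smul_sum, ← Finset.mul_sum]
    set S := ∑ t ∈ Finset.Ico (i + 1 + 1) k,
      D.Fb (i + 1) t ⊗ₜ[ℂ] (D.Fb t k * D.Kib (i + 1) t)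
    rw [Fb_step hi', map_sub, map_smul, Bialgebra.comul_mul, Bialgebra.comul_mul,
      D.comul_F i hi'', ih (by omega), Kib_step (i := i) (by omega)]
    unfold QComm at h1 h2
    have h7 : Commute (D.Ki i) (D.Kib (i + 1) k) := (Kib_commute fun s hs hs' =>
        commute_Ki_Ki (by simp; omega) hi'').symm
    simp only [add_mul, mul_add, Algebra.TensorProduct.tmul_mul_tmul, one_mul, mul_one, smul_add,
      TensorProduct.sub_tmul, TensorProduct.tmul_sub, h1, h2, ← TensorProduct.smul_tmul',
      TensorProduct.tmul_smul, h7.eq, mul_smul_comm, smul_mul_assoc, smul_sub, smul_smul]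
    module

end UqslData

section VectorRepresentation

/-- The matrix unit `e_{ab}` as an operator on `ℕ → ℂ`. -/
def matUnit (a b : ℕ) : Module.End ℂ (ℕ → ℂ) :=
  LinearMap.single ℂ (fun _ : ℕ => ℂ) a ∘ₗ LinearMap.proj b

/-- The diagonal operator on `ℕ → ℂ` with eigenvalues `c`. -/
def diagOp (c : ℕ → ℂ) : Module.End ℂ (ℕ → ℂ) := LinearMap.mulLeft ℂ c

lemma matUnit_apply (a b : ℕ) (v : ℕ → ℂ) : matUnit a b v = Pi.single a (v b) := rfl

lemma diagOp_apply (c v : ℕ → ℂ) : diagOp c v = c * v := rfl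

lemma matUnit_mul (a b c d : ℕ) :
    matUnit a b * matUnit c d = if b = c then matUnit a d else 0 := by
  refine LinearMap.ext fun v => ?_
  split_ifs with h
  · subst h; simp [matUnit_apply]
  · simp [matUnit_apply, h]

lemma diagOp_mul_matUnit (c : ℕ → ℂ) (a b : ℕ) : diagOp c * matUnit a b = c a • matUnit a b := by
  refine LinearMap.ext fun v => ?_
  ext x
  by_cases h : x = a
  · subst h; simp [matUnit_apply, diagOp_apply]
  · simp [matUnit_apply, diagOp_apply, h]

lemma matUnit_mul_diagOp (c : ℕ → ℂ) (a b : ℕ) : matUnit a b * diagOp c = c b • matUnit a b := by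
  refine LinearMap.ext fun v => ?_
  ext x
  by_cases h : x = a
  · subst h; simp [matUnit_apply, diagOp_apply]
  · simp [matUnit_apply, diagOp_apply, h]

lemma diagOp_mul_diagOp (c d : ℕ → ℂ) : diagOp c * diagOp d = diagOp (c * d) := by
  refine LinearMap.ext fun v => ?_
  simp [diagOp_apply, mul_assoc]

/-- The eigenvalues of the torus element `K_s` in the vector representation. -/
def vecWeight (Q : ℂ) (s x : ℕ) : ℂ := if x = s then Q else if x = s + 1 then Q⁻¹ else 1

lemma vecWeight_ne_zero {Q : ℂ} (hQ : Q ≠ 0) (s x : ℕ) : vecWeight Q s x ≠ 0 := by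
  unfold vecWeight; split_ifs <;> simp [hQ]

lemma vecWeight_cartan (Q : ℂ) (i j : ℕ) :
    vecWeight Q i j * (vecWeight Q i (j + 1))⁻¹ = Q ^ cartanSL i j := by
  unfold vecWeight cartanSL
  split_ifs <;> first | omega | (simp; done) | (simp; exact (sq Q).symm)

lemma matUnit_sub_matUnit {Q : ℂ} (h1 : Q - Q⁻¹ ≠ 0) (i : ℕ) :
    matUnit i i - matUnit (i + 1) (i + 1) =
      (Q - Q⁻¹)⁻¹ • (diagOp (vecWeight Q i) - diagOp (vecWeight Q i)⁻¹) := by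
  refine LinearMap.ext fun v => ?_
  ext x
  by_cases hx : x = i
  · subst hx
    simp [matUnit_apply, diagOp_apply, vecWeight, ← sub_mul, h1]
  by_cases hx' : x = i + 1
  · subst hx'
    simp [matUnit_apply, diagOp_apply, vecWeight, ← sub_mul]
    rw [← neg_sub Q, neg_mul, mul_neg, ← mul_assoc, inv_mul_cancel₀ h1, one_mul]
  · simp [matUnit_apply, diagOp_apply, vecWeight, hx, hx']

/-- The vector representation satisfies the defining relations. -/
lemma uqslRels_vec {q : ℝ} (N : ℕ) (hq : (q : ℂ) ≠ 0) (h1 : (q : ℂ) - (q : ℂ)⁻¹ ≠ 0) :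
    UqslRels q N (fun i => matUnit i (i + 1)) (fun i => matUnit (i + 1) i)
      (fun i => diagOp (vecWeight q i)) (fun i => diagOp (vecWeight q i)⁻¹) := by
  have hw : ∀ i, vecWeight (q : ℂ) i * (vecWeight (q : ℂ) i)⁻¹ = 1 := fun i => by
    ext x; exact mul_inv_cancel₀ (vecWeight_ne_zero hq i x)
  have h1' : diagOp 1 = 1 := by
    refine LinearMap.ext fun v => ?_
    simp [diagOp_apply]
  refine ⟨fun i _ => ?_, fun i _ j _ => ?_, fun i _ j _ => ?_, fun i _ j _ => ?_,
    fun i _ j _ => ?_, fun i _ j _ h => ?_, fun i _ j _ h => ?_, fun i _ j _ h => ?_,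
    fun i _ j _ h => ?_⟩
  · simp only [diagOp_mul_diagOp]
    rw [hw, mul_comm, hw, h1', and_self]
  · simp only [diagOp_mul_diagOp, mul_comm]
  · simp only [diagOp_mul_matUnit, matUnit_mul_diagOp, smul_smul]
    rw [← vecWeight_cartan, inv_mul_cancel_right₀ (vecWeight_ne_zero hq _ _)]
  · simp only [diagOp_mul_matUnit, matUnit_mul_diagOp, smul_smul]
    rw [zpow_neg, ← vecWeight_cartan, mul_inv, inv_inv, mul_assoc, mul_comm,
      mul_assoc, mul_inv_cancel₀ (vecWeight_ne_zero hq _ _), mul_one]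
  · simp only [matUnit_mul, add_left_inj]
    by_cases h : i = j
    · subst h
      simpa using matUnit_sub_matUnit h1 i
    · simp [h, Ne.symm h]
  all_goals
    simp only [matUnit_mul, ite_mul, zero_mul]
    split_ifs <;> first | omega | simp

/-- The dual of the vector representation satisfies the defining relations. -/
lemma uqslRels_dual {q : ℝ} (N : ℕ) (hq : (q : ℂ) ≠ 0) (h1 : (q : ℂ) - (q : ℂ)⁻¹ ≠ 0) :
    UqslRels q N (fun i => -(q : ℂ) • matUnit (i + 1) i) (fun i => -(q : ℂ)⁻¹ • matUnit i (i + 1))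
      (fun i => diagOp (vecWeight q i)⁻¹) (fun i => diagOp (vecWeight q i)) := by
  have hw : ∀ i, vecWeight (q : ℂ) i * (vecWeight (q : ℂ) i)⁻¹ = 1 := fun i => by
    ext x; exact mul_inv_cancel₀ (vecWeight_ne_zero hq i x)
  have h1' : diagOp 1 = 1 := by
    refine LinearMap.ext fun v => ?_
    simp [diagOp_apply]
  refine ⟨fun i _ => ?_, fun i _ j _ => ?_, fun i _ j _ => ?_, fun i _ j _ => ?_,
    fun i _ j _ => ?_, fun i _ j _ h => ?_, fun i _ j _ h => ?_, fun i _ j _ h => ?_,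
    fun i _ j _ h => ?_⟩
  · simp only [diagOp_mul_diagOp]
    rw [hw, mul_comm, hw, h1', and_self]
  · simp only [diagOp_mul_diagOp, mul_comm]
  · simp only [diagOp_mul_matUnit, matUnit_mul_diagOp, smul_smul, mul_smul_comm, smul_mul_assoc,
      Pi.inv_apply]
    rw [← vecWeight_cartan]
    have := vecWeight_ne_zero hq i j
    have := vecWeight_ne_zero hq i (j + 1)
    congr 1
    field_simp
  · simp only [diagOp_mul_matUnit, matUnit_mul_diagOp, smul_smul, mul_smul_comm, smul_mul_assoc,
      Pi.inv_apply]
    rw [zpow_neg, ← vecWeight_cartan]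
    have := vecWeight_ne_zero hq i j
    have := vecWeight_ne_zero hq i (j + 1)
    congr 1
    field_simp
  · simp only [matUnit_mul, add_left_inj, smul_mul_assoc, mul_smul_comm, smul_smul]
    by_cases h : i = j
    · subst h
      simp only [if_true, neg_mul_neg, mul_inv_cancel₀ hq, inv_mul_cancel₀ hq, one_smul]
      rw [← neg_sub, matUnit_sub_matUnit h1 i]
      module
    · simp [h, Ne.symm h]
  all_goals
    simp only [matUnit_mul, smul_mul_assoc, mul_smul_comm, ite_mul, zero_mul]
    split_ifs <;> first | omega | simp

end VectorRepresentation

namespace UqslData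

variable {q : ℝ} {N : ℕ}

/-- A representation of `U` on a space spanned by vectors `δ x y` (a model for the tensor product
of the vector representation and its dual) with a functional invariant under the Levi part. -/
structure Probe (D : UqslData q N) (r : ℕ) where
  /-- The representation space. -/
  W : Type
  [grp : AddCommGroup W]
  [mod : Module ℂ W]
  /-- The action. -/
  act : D.U →ₐ[ℂ] Module.End ℂ W
  /-- The spanning vectors. -/
  δ : ℕ → ℕ → W
  /-- The invariant functional. -/
  w : W →ₗ[ℂ] ℂ
  act_E : ∀ s ∈ Finset.Icc 1 (N - 1), ∀ x y, act (D.E s) (δ x y) =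
    (if x = s + 1 then δ s y else 0) +
      (if y = s then (-(q : ℂ) * vecWeight q s x) • δ x (s + 1) else 0)
  act_F : ∀ s ∈ Finset.Icc 1 (N - 1), ∀ x y, act (D.F s) (δ x y) =
    (if x = s then vecWeight q s y • δ (s + 1) y else 0) +
      (if y = s + 1 then -(q : ℂ)⁻¹ • δ x s else 0)
  act_Kg : ∀ s ∈ Finset.Icc 1 (N - 1), ∀ x y, act (D.Kg s) (δ x y) =
    (vecWeight q s x * (vecWeight q s y)⁻¹) • δ x y
  w_δ : ∀ x y, w (δ x y) = if x = y ∧ 1 ≤ x ∧ x ≤ r then 1 else 0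
  w_act : ∀ k ∈ D.Ksub r, ∀ X, w (act k X) = Coalgebra.counit (R := ℂ) k * w X

attribute [instance] Probe.grp Probe.mod

/-- The pairing of the first `r` coordinates. -/
def coordPairing (r : ℕ) : (ℕ → ℂ) ⊗[ℂ] (ℕ → ℂ) →ₗ[ℂ] ℂ :=
  ∑ s ∈ Finset.Icc 1 r, LinearMap.mul' ℂ ℂ ∘ₗ
    TensorProduct.map (LinearMap.proj (R := ℂ) (φ := fun _ : ℕ => ℂ) s)
      (LinearMap.proj (R := ℂ) (φ := fun _ : ℕ => ℂ) s)

lemma coordPairing_tmul (r : ℕ) (x y : ℕ → ℂ) :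
    coordPairing r (x ⊗ₜ y) = ∑ s ∈ Finset.Icc 1 r, x s * y s := by
  simp [coordPairing]

lemma sum_single_mul {r a : ℕ} (c : ℂ) (y : ℕ → ℂ) :
    ∑ s ∈ Finset.Icc 1 r, (Pi.single a c : ℕ → ℂ) s * y s =
      if 1 ≤ a ∧ a ≤ r then c * y a else 0 := by
  simp only [Pi.single_apply, ite_mul, zero_mul]
  rw [Finset.sum_ite_eq']
  simp [Finset.mem_Icc]

lemma sum_mul_single {r a : ℕ} (c : ℂ) (y : ℕ → ℂ) :
    ∑ s ∈ Finset.Icc 1 r, y s * (Pi.single a c : ℕ → ℂ) s =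
      if 1 ≤ a ∧ a ≤ r then y a * c else 0 := by
  simp only [Pi.single_apply, mul_ite, mul_zero]
  rw [Finset.sum_ite_eq']
  simp [Finset.mem_Icc]

variable (D : UqslData q N) (r : ℕ)

lemma nonempty_probe (hq : (q : ℂ) ≠ 0) (h1 : (q : ℂ) - (q : ℂ)⁻¹ ≠ 0) :
    Nonempty (D.Probe r) := by
  obtain ⟨ρ, hρ⟩ := D.univ _ _ _ _ _ (uqslRels_vec N hq h1)
  obtain ⟨σ, hσ⟩ := D.univ _ _ _ _ _ (uqslRels_dual N hq h1)
  let act : D.U →ₐ[ℂ] Module.End ℂ ((ℕ → ℂ) ⊗[ℂ] (ℕ → ℂ)) :=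
    (Module.endTensorEndAlgHom (R := ℂ) (S := ℂ) (A := ℂ)).comp
      ((Algebra.TensorProduct.map ρ σ).comp (Bialgebra.comulAlgHom ℂ D.U))
  have hact : ∀ u, act u = Module.endTensorEndAlgHom (R := ℂ) (S := ℂ) (A := ℂ)
      (Algebra.TensorProduct.map ρ σ
      (Coalgebra.comul (R := ℂ) u)) := fun u => rfl
  have hten : ∀ (a b : Module.End ℂ (ℕ → ℂ)) (x y : ℕ → ℂ),
      Module.endTensorEndAlgHom (R := ℂ) (S := ℂ) (A := ℂ) (a ⊗ₜ[ℂ] b) (x ⊗ₜ y) = a x ⊗ₜ b y :=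
    fun a b x y => rfl
  have actE : ∀ s ∈ Finset.Icc 1 (N - 1), ∀ x y : ℕ → ℂ, act (D.E s) (x ⊗ₜ y) =
      Pi.single s (x (s + 1)) ⊗ₜ y +
        (vecWeight q s * x) ⊗ₜ (-(q : ℂ) • Pi.single (s + 1) (y s)) := fun s hs x y => by
    rw [hact, D.comul_E s hs]
    simp only [map_add, Algebra.TensorProduct.map_tmul, LinearMap.add_apply, hten, map_one]
    rw [(hρ s hs).1, (hρ s hs).2.2.1, (hσ s hs).1]
    rfl
  have actF : ∀ s ∈ Finset.Icc 1 (N - 1), ∀ x y : ℕ → ℂ, act (D.F s) (x ⊗ₜ y) =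
      Pi.single (s + 1) (x s) ⊗ₜ (vecWeight q s * y) +
        x ⊗ₜ (-(q : ℂ)⁻¹ • Pi.single s (y (s + 1))) := fun s hs x y => by
    rw [hact, D.comul_F s hs]
    simp only [map_add, Algebra.TensorProduct.map_tmul, LinearMap.add_apply, hten, map_one]
    rw [(hρ s hs).2.1, (hσ s hs).2.2.2, (hσ s hs).2.1]
    rfl
  have actKg : ∀ s ∈ Finset.Icc 1 (N - 1), ∀ x y : ℕ → ℂ, act (D.Kg s) (x ⊗ₜ y) =
      (vecWeight q s * x) ⊗ₜ ((vecWeight q s)⁻¹ * y) := fun s hs x y => by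
    rw [hact, D.comul_Kg s hs]
    rw [Algebra.TensorProduct.map_tmul, hten, (hρ s hs).2.2.1, (hσ s hs).2.2.1]
    rfl
  have actKi : ∀ s ∈ Finset.Icc 1 (N - 1), ∀ x y : ℕ → ℂ, act (D.Ki s) (x ⊗ₜ y) =
      ((vecWeight q s)⁻¹ * x) ⊗ₜ (vecWeight q s * y) := fun s hs x y => by
    rw [hact, D.comul_Ki s hs]
    rw [Algebra.TensorProduct.map_tmul, hten, (hρ s hs).2.2.2, (hσ s hs).2.2.2]
    rfl
  have hmul : ∀ (c : ℕ → ℂ) (x : ℕ), c * Pi.single x 1 = c x • (Pi.single x 1 : ℕ → ℂ) :=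
    fun c x => by
      ext t
      by_cases h : t = x
      · subst h; simp
      · simp [h]
  have hsingle : ∀ a b x : ℕ, (Pi.single a ((Pi.single x 1 : ℕ → ℂ) b) : ℕ → ℂ) =
      if x = b then Pi.single a 1 else 0 := fun a b x => by
    split_ifs with h
    · subst h; simp
    · simp [Pi.single_eq_of_ne (Ne.symm h)]
  have hgen : ∀ k : D.U, (∀ x y : ℕ → ℂ, coordPairing r (act k (x ⊗ₜ y)) =
      Coalgebra.counit (R := ℂ) k * coordPairing r (x ⊗ₜ y)) → ∀ X, coordPairing r (act k X) =
        Coalgebra.counit (R := ℂ) k * coordPairing r X := fun k hk X => by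
    induction X using TensorProduct.induction_on with
    | zero => simp
    | tmul x y => exact hk x y
    | add x y hx hy => simp only [map_add, hx, hy, mul_add]
  refine ⟨{
    W := (ℕ → ℂ) ⊗[ℂ] (ℕ → ℂ)
    act := act
    δ := fun x y => Pi.single x 1 ⊗ₜ Pi.single y 1
    w := coordPairing r
    act_E := ?_
    act_F := ?_
    act_Kg := ?_
    w_δ := ?_
    w_act := ?_ }⟩
  · intro s hs x y
    rw [actE s hs, hmul, hsingle, hsingle]
    split_ifs <;> simp only [TensorProduct.tmul_zero, TensorProduct.zero_tmul, smul_zero,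
      TensorProduct.tmul_smul, ← TensorProduct.smul_tmul', smul_smul, add_zero, zero_add]
  · intro s hs x y
    rw [actF s hs, hmul, hsingle, hsingle]
    split_ifs <;> simp only [TensorProduct.tmul_zero, TensorProduct.zero_tmul, smul_zero,
      TensorProduct.tmul_smul, add_zero, zero_add]
  · intro s hs x y
    rw [actKg s hs, hmul, hmul]
    simp [TensorProduct.smul_tmul', TensorProduct.tmul_smul, smul_smul, mul_comm]
  · intro x y
    rw [coordPairing_tmul, sum_single_mul, one_mul]
    by_cases h : x = y
    · subst h; simp
    · simp [h]
  · intro k hk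
    induction hk using Algebra.adjoin_induction with
    | mem k hk =>
      refine hgen k fun x y => ?_
      rcases hk with ⟨s, hs, hsr, rfl | rfl⟩ | ⟨s, hs, rfl | rfl⟩
      · have := Finset.mem_Icc.1 hs
        rw [actE s hs, D.counit_E s hs, map_add, coordPairing_tmul, coordPairing_tmul,
          sum_single_mul, ← Pi.single_smul', sum_mul_single]
        by_cases h : s + 1 ≤ r
        · rw [if_pos ⟨by omega, by omega⟩, if_pos ⟨by omega, h⟩]
          simp [vecWeight]
          field_simp
          ring
        · rw [if_neg (by omega), if_neg (by omega)]; simp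
      · have := Finset.mem_Icc.1 hs
        rw [actF s hs, D.counit_F s hs, map_add, coordPairing_tmul, coordPairing_tmul,
          sum_single_mul, ← Pi.single_smul', sum_mul_single]
        by_cases h : s + 1 ≤ r
        · rw [if_pos ⟨by omega, by omega⟩, if_pos ⟨by omega, by omega⟩]
          simp [vecWeight]
        · rw [if_neg (by omega), if_neg (by omega)]; simp
      · rw [actKg s hs, D.counit_Kg s hs, coordPairing_tmul, coordPairing_tmul, one_mul]
        refine Finset.sum_congr rfl fun t _ => ?_
        have := vecWeight_ne_zero hq s t
        simp; field_simp
      · rw [actKi s hs, D.counit_Ki s hs, coordPairing_tmul, coordPairing_tmul, one_mul]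
        refine Finset.sum_congr rfl fun t _ => ?_
        have := vecWeight_ne_zero hq s t
        simp; field_simp
    | algebraMap c => intro X; simp
    | add a b _ _ ha hb => intro X; simp [ha X, hb X, add_mul]
    | mul a b _ _ ha hb =>
      intro X
      rw [map_mul, Module.End.mul_apply, ha, hb, Bialgebra.counit_mul, mul_assoc]

end UqslData

namespace UqslData

variable {q : ℝ} {N : ℕ} {D : UqslData q N} {r : ℕ}

lemma counit_Eb {i k : ℕ} (hi : 1 ≤ i) (hik : i < k) (hk : k ≤ N) :
    Coalgebra.counit (R := ℂ) (D.Eb i k) = 0 := by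
  induction i, hik using interval_induction with
  | base i _ hi' => subst hi'; rw [Eb_self, D.counit_E i (by simp; omega)]
  | step i _ hi' ih => rw [Eb_step hi']; simp [ih (by omega)]

lemma counit_Fb {i k : ℕ} (hi : 1 ≤ i) (hik : i < k) (hk : k ≤ N) :
    Coalgebra.counit (R := ℂ) (D.Fb i k) = 0 := by
  induction i, hik using interval_induction with
  | base i _ hi' => subst hi'; rw [Fb_self, D.counit_F i (by simp; omega)]
  | step i _ hi' ih => rw [Fb_step hi']; simp [ih (by omega)]

lemma E_mem_Ksub {s : ℕ} (hs : s ∈ Finset.Icc 1 (N - 1)) (hsr : s ≠ r) : D.E s ∈ D.Ksub r :=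
  isLeviLetter_mem_Ksub (Or.inl ⟨s, hs, hsr, Or.inl rfl⟩)

lemma F_mem_Ksub {s : ℕ} (hs : s ∈ Finset.Icc 1 (N - 1)) (hsr : s ≠ r) : D.F s ∈ D.Ksub r :=
  isLeviLetter_mem_Ksub (Or.inl ⟨s, hs, hsr, Or.inr rfl⟩)

lemma vecWeight_of_ne {Q : ℂ} {s x : ℕ} (h : x ≠ s) (h' : x ≠ s + 1) : vecWeight Q s x = 1 := by
  simp [vecWeight, h, h']

lemma vecWeight_self (Q : ℂ) (s : ℕ) : vecWeight Q s s = Q := by simp [vecWeight]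

lemma vecWeight_succ (Q : ℂ) (s : ℕ) : vecWeight Q s (s + 1) = Q⁻¹ := by simp [vecWeight]

namespace Probe

variable (P : D.Probe r)

/-- The functional on `U` attached to a vector of the representation space. -/
def fn (X : P.W) : D.U →ₗ[ℂ] ℂ := P.w ∘ₗ LinearMap.applyₗ X ∘ₗ P.act.toLinearMap

variable {P}

lemma fn_apply (X : P.W) (u : D.U) : P.fn X u = P.w (P.act u X) := rfl

lemma fn_mul (X : P.W) (u v : D.U) : P.fn X (u * v) = P.fn (P.act v X) u := by
  simp [fn_apply]

lemma fn_one (X : P.W) : P.fn X 1 = P.w X := by simp [fn_apply]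

lemma fn_comp_mulRight (X : P.W) (v : D.U) :
    P.fn X ∘ₗ LinearMap.mulRight ℂ v = P.fn (P.act v X) := by
  ext u; simp [fn_mul]

lemma fn_add (X Y : P.W) : P.fn (X + Y) = P.fn X + P.fn Y := by
  ext u; simp [fn_apply]

lemma fn_smul (c : ℂ) (X : P.W) : P.fn (c • X) = c • P.fn X := by
  ext u; simp [fn_apply]

lemma fn_zero : P.fn 0 = 0 := by
  ext u; simp [fn_apply]

lemma vanishJ_fn (X : P.W) : VanishJ r (P.fn X) := fun x hx => by
  refine (Submodule.span_le.2 ?_ : D.Jsub r ≤ LinearMap.ker (P.fn X)) hx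
  rintro _ ⟨k, hk, hk0, u, rfl⟩
  simp [fn_apply, P.w_act k hk, hk0]

lemma fn_mul_of_mem_Ksub (X : P.W) {k : D.U} (hk : k ∈ D.Ksub r) (u : D.U) :
    P.fn X (k * u) = Coalgebra.counit (R := ℂ) k * P.fn X u :=
  (vanishJ_fn X).apply_mul hk u

lemma act_Eb_mem {V V' : Submodule ℂ P.W} (hV : V' ≤ V) {i k : ℕ} (hik : i < k)
    (h : ∀ s, i ≤ s → s < k → ∀ X ∈ V, P.act (D.E s) X ∈ V') {X : P.W} (hX : X ∈ V) :
    P.act (D.Eb i k) X ∈ V' := by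
  induction i, hik using interval_induction generalizing X with
  | base i _ hi' => subst hi'; rw [Eb_self]; exact h i le_rfl (by omega) X hX
  | step i hik hi' ih =>
    have ih' : ∀ {X}, X ∈ V → P.act (D.Eb (i + 1) k) X ∈ V' := fun hX =>
      ih (fun s hs => h s (by omega)) hX
    rw [Eb_step hi', map_sub, map_smul, map_mul, map_mul]
    exact sub_mem (h i le_rfl hik _ (hV (ih' hX)))
      (Submodule.smul_mem _ _ (ih' (hV (h i le_rfl hik _ hX))))

lemma act_Fb_mem {V V' : Submodule ℂ P.W} (hV : V' ≤ V) {i k : ℕ} (hik : i < k)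
    (h : ∀ s, i ≤ s → s < k → ∀ X ∈ V, P.act (D.F s) X ∈ V') {X : P.W} (hX : X ∈ V) :
    P.act (D.Fb i k) X ∈ V' := by
  induction i, hik using interval_induction generalizing X with
  | base i _ hi' => subst hi'; rw [Fb_self]; exact h i le_rfl (by omega) X hX
  | step i hik hi' ih =>
    have ih' : ∀ {X}, X ∈ V → P.act (D.Fb (i + 1) k) X ∈ V' := fun hX =>
      ih (fun s hs => h s (by omega)) hX
    rw [Fb_step hi', map_sub, map_smul, map_mul, map_mul]
    exact sub_mem (ih' (hV (h i le_rfl hik _ hX)))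
      (Submodule.smul_mem _ _ (h i le_rfl hik _ (hV (ih' hX))))

lemma act_Kb_mem {V : Submodule ℂ P.W} {i k : ℕ} (hik : i ≤ k)
    (h : ∀ s, i ≤ s → s < k → ∀ X ∈ V, P.act (D.Kg s) X ∈ V) {X : P.W} (hX : X ∈ V) :
    P.act (D.Kb i k) X ∈ V := by
  induction hik using Nat.decreasingInduction with
  | self => rw [Kb_self]; simpa
  | of_succ i hi' ih =>
    rw [Kb_step hi', map_mul]
    exact h i le_rfl hi' _ (ih fun s hs => h s (by omega))

lemma act_Eb_δ {j k : ℕ} (hj : 1 ≤ j) (hjk : j < k) (hk : k ≤ N) {y : ℕ} (hy : y < j) (x : ℕ) :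
    P.act (D.Eb j k) (P.δ x y) = if x = k then P.δ j y else 0 := by
  induction j, hjk using interval_induction generalizing x with
  | base j _ hj' =>
    subst hj'
    rw [Eb_self, P.act_E j (by simp; omega), if_neg (show y ≠ j by omega), add_zero]
  | step j _ hj' ih =>
    have ih' := ih (by omega) (by omega)
    rw [Eb_step hj', map_sub, map_smul, map_mul, map_mul, LinearMap.sub_apply,
      LinearMap.smul_apply, Module.End.mul_apply, Module.End.mul_apply,
      P.act_E j (by simp; omega) x, if_neg (show y ≠ j by omega), add_zero, ih']
    have h2 : P.act (D.Eb (j + 1) k) (if x = j + 1 then P.δ j y else 0) = 0 := by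
      split_ifs
      · rw [ih', if_neg (by omega)]
      · simp
    rw [h2, smul_zero, sub_zero]
    split_ifs
    · rw [P.act_E j (by simp; omega), if_pos rfl, if_neg (by omega), add_zero]
    · simp

lemma fn_E {x y : ℕ} (hr : r ∈ Finset.Icc 1 (N - 1)) :
    P.fn (P.δ x y) (D.E r) = if x = r + 1 ∧ y = r then 1 else 0 := by
  have hr' := Finset.mem_Icc.1 hr
  rw [fn_apply, P.act_E r hr, map_add]
  have h1 : P.w (P.δ x (r + 1)) = 0 := by rw [P.w_δ, if_neg (by omega)]
  have h2 : P.w (P.δ r y) = if y = r then 1 else 0 := by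
    rw [P.w_δ]; congr 1; rw [eq_iff_iff]; omega
  by_cases hx' : x = r + 1 <;> by_cases hy' : y = r <;> simp [hx', hy', h1, h2]
  all_goals simp_all

/-- The `E`-type functionals detect the root vectors `E_{i,k}`. -/
lemma fn_Eb (hq : (q : ℂ) ≠ 0) (hr : r ∈ Finset.Icc 1 (N - 1)) {i k : ℕ}
    (hi : 1 ≤ i) (hir : i ≤ r) (hrk : r < k)
    (hk : k ≤ N) {x y : ℕ} (hyr : y ≤ r) (hx : r < x) :
    P.fn (P.δ x y) (D.Eb i k) = if x = k ∧ y = i then 1 else 0 := by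
  have hik : i < k := by omega
  induction i, hik using interval_induction generalizing y with
  | base i _ hi' =>
    obtain rfl : i = r := by omega
    subst hi'
    rw [Eb_self, fn_E hr]
  | step i _ hi' ih =>
    have hi'' : i ∈ Finset.Icc 1 (N - 1) := by simp; omega
    rw [Eb_step hi', map_sub, map_smul, smul_eq_mul]
    by_cases h : i = r
    · subst h
      rw [fn_mul, act_Eb_δ (by omega) hi' hk (by omega),
        fn_mul_of_mem_Ksub _ (Eb_mem_Ksub (by omega) hi' hk (by omega)),
        counit_Eb (by omega) hi' hk, zero_mul, mul_zero, sub_zero]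
      split_ifs with h1 h2 h2
      · rw [fn_E hr, if_pos ⟨rfl, h2.2⟩]
      · rw [fn_E hr, if_neg (by tauto)]
      · tauto
      · simp [fn_zero]
    · rw [fn_mul_of_mem_Ksub _ (E_mem_Ksub hi'' h), D.counit_E i hi'', zero_mul, zero_sub, fn_mul,
        P.act_E i hi'', if_neg (by omega), zero_add, vecWeight_of_ne (by omega) (by omega), mul_one]
      by_cases hy : y = i
      · rw [if_pos hy, fn_smul, LinearMap.smul_apply, ih (by omega) (by omega) (by omega)]
        by_cases hxk : x = k
        · simp [hxk, hy, hq]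
        · simp [hxk]
      · simp [hy, fn_zero]


lemma fn_F {x y : ℕ} (hr : r ∈ Finset.Icc 1 (N - 1)) :
    P.fn (P.δ x y) (D.F r) = if x = r ∧ y = r + 1 then -(q : ℂ)⁻¹ else 0 := by
  have hr' := Finset.mem_Icc.1 hr
  rw [fn_apply, P.act_F r hr, map_add]
  have h1 : P.w (P.δ (r + 1) y) = 0 := by rw [P.w_δ, if_neg (by omega)]
  have h2 : P.w (P.δ x r) = if x = r then 1 else 0 := by
    rw [P.w_δ]; congr 1; rw [eq_iff_iff]; omega
  by_cases hx' : x = r <;> by_cases hy' : y = r + 1 <;> simp [hx', hy', h1, h2]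
  all_goals simp_all

lemma fn_eq_zero_of_span {S : Set P.W} {u : D.U} (h : ∀ X ∈ S, P.fn X u = 0) {X : P.W}
    (hX : X ∈ Submodule.span ℂ S) : P.fn X u = 0 := by
  induction hX using Submodule.span_induction with
  | mem X hX => exact h X hX
  | zero => simp [fn_zero]
  | add X Y _ _ hX hY => simp [fn_add, hX, hY]
  | smul c X _ hX => simp [fn_smul, hX]

/-- The coefficient in the action of `F_{j,j+d+1}` on a matrix unit. -/
def fCoef (q : ℝ) (d : ℕ) : ℂ := -(q : ℂ)⁻¹ * ((q : ℂ)⁻¹ ^ 2) ^ d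

lemma fCoef_ne_zero (hq : (q : ℂ) ≠ 0) (d : ℕ) : fCoef q d ≠ 0 := by
  simp [fCoef, hq]

lemma act_Fb_δ {j k : ℕ} (hj : 1 ≤ j) (hjk : j < k) (hk : k ≤ N) {y : ℕ} (hy : y < j) (x : ℕ) :
    P.act (D.Fb j k) (P.δ y x) = if x = k then fCoef q (k - j - 1) • P.δ y j else 0 := by
  induction j, hjk using interval_induction generalizing x with
  | base j _ hj' =>
    subst hj'
    rw [Fb_self, P.act_F j (by simp; omega), if_neg (show y ≠ j by omega), zero_add]
    simp [fCoef]
  | step j _ hj' ih =>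
    have ih' := ih (by omega) (by omega)
    have hF : ∀ x, P.act (D.F j) (P.δ y x) = if x = j + 1 then -(q : ℂ)⁻¹ • P.δ y j else 0 := by
      intro x
      rw [P.act_F j (by simp; omega), if_neg (show y ≠ j by omega), zero_add]
    rw [Fb_step hj', map_sub, map_smul, map_mul, map_mul, LinearMap.sub_apply,
      LinearMap.smul_apply, Module.End.mul_apply, Module.End.mul_apply, hF, ih']
    have h2 : P.act (D.Fb (j + 1) k) (if x = j + 1 then -(q : ℂ)⁻¹ • P.δ y j else 0) = 0 := by
      split_ifs
      · rw [map_smul, ih', if_neg (by omega), smul_zero]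
      · simp
    rw [h2, zero_sub]
    split_ifs
    · rw [map_smul, hF, if_pos rfl, smul_smul, smul_smul, ← neg_smul]
      congr 1
      obtain ⟨d, rfl⟩ : ∃ d, k = j + 2 + d := ⟨k - (j + 2), by omega⟩
      rw [show j + 2 + d - (j + 1) - 1 = d by omega, show j + 2 + d - j - 1 = d + 1 by omega]
      simp only [fCoef]; ring
    · simp

/-- The value of the `F`-type functionals on the root vector `F_{i,k}` that they detect. -/
def fVal (q : ℝ) (r k : ℕ) : ℂ :=
  if k = r + 1 then -(q : ℂ)⁻¹ else (q : ℂ)⁻¹ ^ 2 * fCoef q (k - r - 2)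

lemma fVal_ne_zero (hq : (q : ℂ) ≠ 0) (k : ℕ) : fVal q r k ≠ 0 := by
  unfold fVal; split_ifs <;> simp [hq, fCoef_ne_zero hq]

/-- The `F`-type functionals detect the root vectors `F_{i,k}`. -/
lemma fn_Fb (hr : r ∈ Finset.Icc 1 (N - 1)) {i k : ℕ}
    (hi : 1 ≤ i) (hir : i ≤ r) (hrk : r < k)
    (hk : k ≤ N) {x y : ℕ} (hyr : y ≤ r) (hx : r < x) :
    P.fn (P.δ y x) (D.Fb i k) = if x = k ∧ y = i then fVal q r k else 0 := by
  have hik : i < k := by omega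
  induction i, hik using interval_induction generalizing y with
  | base i _ hi' =>
    obtain rfl : i = r := by omega
    subst hi'
    rw [Fb_self, fn_F hr, fVal, if_pos rfl]
    simp only [and_comm]
  | step i _ hi' ih =>
    have hi'' : i ∈ Finset.Icc 1 (N - 1) := by simp; omega
    rw [Fb_step hi', map_sub, map_smul, smul_eq_mul]
    by_cases h : i = r
    · subst h
      rw [fn_mul_of_mem_Ksub _ (Fb_mem_Ksub (by omega) hi' hk (by omega)),
        counit_Fb (by omega) hi' hk, zero_mul, zero_sub, fn_mul,
        act_Fb_δ (by omega) hi' hk (by omega), fVal, if_neg (show k ≠ i + 1 by omega),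
        show k - (i + 1) - 1 = k - i - 2 by omega]
      by_cases hxk : x = k
      · rw [if_pos hxk, fn_smul, LinearMap.smul_apply, fn_F hr]
        by_cases hy : y = i
        · simp only [hxk, hy, and_self, if_true, smul_eq_mul]; ring
        · simp [hy]
      · simp [hxk, fn_zero]
    · rw [fn_mul_of_mem_Ksub _ (F_mem_Ksub hi'' h), D.counit_F i hi'', zero_mul, mul_zero, sub_zero,
        fn_mul, P.act_F i hi'', if_neg (show x ≠ i + 1 by omega), add_zero,
        vecWeight_of_ne (by omega) (by omega), one_smul]
      by_cases hy : y = i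
      · rw [if_pos hy, ih (by omega) (by omega) (by omega)]
        simp [hy]
      · simp [hy, fn_zero]

variable (P) in
/-- The span of all matrix units below the diagonal block cut out by `r`. -/
def lowerBlock : Submodule ℂ P.W := Submodule.span ℂ {X | ∃ x y, y ≤ r ∧ r < x ∧ X = P.δ x y}

lemma act_F_mem_lowerBlock {s : ℕ} (hs : s ∈ Finset.Icc 1 (N - 1)) {X : P.W}
    (hX : X ∈ P.lowerBlock) : P.act (D.F s) X ∈ P.lowerBlock := by
  refine (Submodule.span_le.2 ?_ : _ ≤ P.lowerBlock.comap (P.act (D.F s))) hX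
  rintro _ ⟨x, y, hy, hx, rfl⟩
  rw [SetLike.mem_coe, Submodule.mem_comap, P.act_F s hs]
  refine add_mem ?_ ?_ <;> split_ifs
  · exact Submodule.smul_mem _ _ (Submodule.subset_span ⟨s + 1, y, hy, by omega, rfl⟩)
  · exact zero_mem _
  · exact Submodule.smul_mem _ _ (Submodule.subset_span ⟨x, s, by omega, hx, rfl⟩)
  · exact zero_mem _

lemma fn_F_lowerBlock (hr : r ∈ Finset.Icc 1 (N - 1)) {X : P.W} (hX : X ∈ P.lowerBlock) :
    P.fn X (D.F r) = 0 := by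
  refine fn_eq_zero_of_span ?_ hX
  rintro _ ⟨x, y, hy, hx, rfl⟩
  rw [fn_F hr, if_neg (by omega)]

/-- The `E`-type functionals vanish on the root vectors `F_{i,k}`. -/
lemma fn_Fb_lowerBlock (hr : r ∈ Finset.Icc 1 (N - 1)) {i k : ℕ} (hi : 1 ≤ i) (hir : i ≤ r)
    (hrk : r < k) (hk : k ≤ N) {X : P.W} (hX : X ∈ P.lowerBlock) : P.fn X (D.Fb i k) = 0 := by
  have hik : i < k := by omega
  induction i, hik using interval_induction generalizing X with
  | base i _ hi' =>
    obtain rfl : i = r := by omega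
    rw [← hi', Fb_self, fn_F_lowerBlock hr hX]
  | step i _ hi' ih =>
    have hi'' : i ∈ Finset.Icc 1 (N - 1) := by simp; omega
    rw [Fb_step hi', map_sub, map_smul, smul_eq_mul]
    by_cases h : i = r
    · subst h
      rw [fn_mul_of_mem_Ksub _ (Fb_mem_Ksub (by omega) hi' hk (by omega)),
        counit_Fb (by omega) hi' hk, zero_mul, zero_sub, fn_mul, fn_F_lowerBlock hr, mul_zero,
        neg_zero]
      exact act_Fb_mem le_rfl hi' (fun s hs hsk X hX =>
        act_F_mem_lowerBlock (by simp; omega) hX) hX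
    · rw [fn_mul_of_mem_Ksub _ (F_mem_Ksub hi'' h), D.counit_F i hi'', zero_mul, mul_zero, sub_zero,
        fn_mul]
      exact ih (by omega) (by omega) (act_F_mem_lowerBlock hi'' hX)

lemma act_Kb_δ_of_lt {j k y : ℕ} (hj : 1 ≤ j) (hjk : j ≤ k) (hk : k ≤ N) (hy : y < j) :
    P.act (D.Kb j k) (P.δ k y) = (if j = k then 1 else (q : ℂ)⁻¹) • P.δ k y := by
  induction hjk using Nat.decreasingInduction with
  | self => simp [Kb_self]
  | of_succ j hj' ih =>
    rw [Kb_step hj', map_mul, Module.End.mul_apply, ih (by omega) (by omega), map_smul,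
      P.act_Kg j (by simp; omega), vecWeight_of_ne (x := y) (by omega) (by omega), smul_smul,
      if_neg (show j ≠ k by omega)]
    congr 1
    by_cases h : j + 1 = k
    · rw [if_pos h, ← h, vecWeight_succ]; simp
    · rw [if_neg h, vecWeight_of_ne (by omega) (by omega)]; simp

lemma act_Kb_δ {a k : ℕ} (ha : 1 ≤ a) (hak : a < k) (hk : k ≤ N) :
    P.act (D.Kb a k) (P.δ k a) = ((q : ℂ)⁻¹ ^ 2) • P.δ k a := by
  have : ∀ {j}, a < j → j ≤ k →
      P.act (D.Kb j k) (P.δ k a) = (if j = k then 1 else (q : ℂ)⁻¹) • P.δ k a :=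
    fun h h' => act_Kb_δ_of_lt (by omega) h' hk h
  rw [Kb_step hak, map_mul, Module.End.mul_apply, this (by omega) hak, map_smul,
      P.act_Kg a (by simp; omega), vecWeight_self, smul_smul]
  congr 1
  by_cases h : a + 1 = k
  · rw [if_pos h, ← h, vecWeight_succ]; ring
  · rw [if_neg h, vecWeight_of_ne (by omega) (by omega)]; ring

variable (P) in
/-- The span of the matrix units in row `k` and columns from `a` to `r`. -/
def rowSpan (a k : ℕ) : Submodule ℂ P.W :=
  Submodule.span ℂ {X | ∃ y, a ≤ y ∧ y ≤ r ∧ X = P.δ k y}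

variable (P) in
/-- The span of the matrix units in column `k` and rows from `a` to `r`. -/
def colSpan (a k : ℕ) : Submodule ℂ P.W :=
  Submodule.span ℂ {X | ∃ y, a ≤ y ∧ y ≤ r ∧ X = P.δ y k}

lemma δ_mem_rowSpan {a k y : ℕ} (hy : a ≤ y) (hyr : y ≤ r) : P.δ k y ∈ P.rowSpan a k :=
  Submodule.subset_span ⟨y, hy, hyr, rfl⟩

lemma δ_mem_colSpan {a k y : ℕ} (hy : a ≤ y) (hyr : y ≤ r) : P.δ y k ∈ P.colSpan a k :=
  Submodule.subset_span ⟨y, hy, hyr, rfl⟩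

lemma rowSpan_anti {a b k : ℕ} (h : a ≤ b) : P.rowSpan b k ≤ P.rowSpan a k :=
  Submodule.span_mono fun _ ⟨y, hy, hyr, e⟩ => ⟨y, h.trans hy, hyr, e⟩

lemma colSpan_anti {a b k : ℕ} (h : a ≤ b) : P.colSpan b k ≤ P.colSpan a k :=
  Submodule.span_mono fun _ ⟨y, hy, hyr, e⟩ => ⟨y, h.trans hy, hyr, e⟩

lemma rowSpan_le_lowerBlock {a k : ℕ} (hk : r < k) : P.rowSpan a k ≤ P.lowerBlock :=
  Submodule.span_mono fun _ ⟨y, _, hyr, e⟩ => ⟨k, y, hyr, hk, e⟩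

lemma w_rowSpan {a k : ℕ} (hk : r < k) {X : P.W} (hX : X ∈ P.rowSpan a k) : P.w X = 0 := by
  rw [← fn_one]
  refine fn_eq_zero_of_span ?_ hX
  rintro _ ⟨y, _, hyr, rfl⟩
  rw [fn_one, P.w_δ, if_neg (by omega)]

lemma w_colSpan {a k : ℕ} (hk : r < k) {X : P.W} (hX : X ∈ P.colSpan a k) : P.w X = 0 := by
  rw [← fn_one]
  refine fn_eq_zero_of_span ?_ hX
  rintro _ ⟨y, _, hyr, rfl⟩
  rw [fn_one, P.w_δ, if_neg (by omega)]

lemma act_Kg_mem_rowSpan {a k s : ℕ} (hs : s ∈ Finset.Icc 1 (N - 1)) {X : P.W}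
    (hX : X ∈ P.rowSpan a k) : P.act (D.Kg s) X ∈ P.rowSpan a k := by
  refine (Submodule.span_le.2 ?_ : _ ≤ (P.rowSpan a k).comap (P.act (D.Kg s))) hX
  rintro _ ⟨y, hy, hyr, rfl⟩
  rw [SetLike.mem_coe, Submodule.mem_comap, P.act_Kg s hs]
  exact Submodule.smul_mem _ _ (δ_mem_rowSpan hy hyr)

lemma act_E_mem_rowSpan {a k s : ℕ} (hk : r < k) (hs : s ∈ Finset.Icc 1 (N - 1)) (hsr : s < r)
    {X : P.W} (hX : X ∈ P.rowSpan a k) : P.act (D.E s) X ∈ P.rowSpan (a + 1) k := by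
  refine (Submodule.span_le.2 ?_ : _ ≤ (P.rowSpan (a + 1) k).comap (P.act (D.E s))) hX
  rintro _ ⟨y, hy, hyr, rfl⟩
  rw [SetLike.mem_coe, Submodule.mem_comap, P.act_E s hs, if_neg (by omega), zero_add]
  split_ifs with h
  · exact Submodule.smul_mem _ _ (δ_mem_rowSpan (by omega) (by omega))
  · exact zero_mem _

lemma act_F_mem_rowSpan {k s : ℕ} (hk : r < k) (hs : s ∈ Finset.Icc 1 (N - 1)) (hsr : s < r)
    {X : P.W} (hX : X ∈ P.rowSpan 1 k) : P.act (D.F s) X ∈ P.rowSpan 1 k := by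
  refine (Submodule.span_le.2 ?_ : _ ≤ (P.rowSpan 1 k).comap (P.act (D.F s))) hX
  rintro _ ⟨y, hy, hyr, rfl⟩
  rw [SetLike.mem_coe, Submodule.mem_comap, P.act_F s hs, if_neg (by omega), zero_add]
  split_ifs with h
  · exact Submodule.smul_mem _ _ (δ_mem_rowSpan (Finset.mem_Icc.1 hs).1 (by omega))
  · exact zero_mem _

lemma act_F_mem_colSpan {a k s : ℕ} (hk : r < k) (hs : s ∈ Finset.Icc 1 (N - 1)) (hsr : s < r)
    {X : P.W} (hX : X ∈ P.colSpan a k) : P.act (D.F s) X ∈ P.colSpan (a + 1) k := by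
  refine (Submodule.span_le.2 ?_ : _ ≤ (P.colSpan (a + 1) k).comap (P.act (D.F s))) hX
  rintro _ ⟨y, hy, hyr, rfl⟩
  rw [SetLike.mem_coe, Submodule.mem_comap, P.act_F s hs, if_neg (show k ≠ s + 1 by omega),
    add_zero]
  split_ifs with h
  · exact Submodule.smul_mem _ _ (δ_mem_colSpan (by omega) (by omega))
  · exact zero_mem _

/-- Row functionals vanish on the earlier root vectors of `E`-type. -/
lemma fn_Eb_rowSpan (hq : (q : ℂ) ≠ 0) (hr : r ∈ Finset.Icc 1 (N - 1)) {a i j k : ℕ} (hi : 1 ≤ i)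
    (hir : i ≤ r) (hrj : r < j) (hj : j ≤ N) (hk : r < k) (h : j < k ∨ j = k ∧ i < a) {X : P.W}
    (hX : X ∈ P.rowSpan a k) : P.fn X (D.Eb i j) = 0 := by
  refine fn_eq_zero_of_span ?_ hX
  rintro _ ⟨y, hy, hyr, rfl⟩
  rw [fn_Eb hq hr hi hir hrj hj hyr hk, if_neg (by omega)]

/-- Column functionals vanish on the earlier root vectors of `F`-type. -/
lemma fn_Fb_colSpan (hr : r ∈ Finset.Icc 1 (N - 1)) {a i j k : ℕ} (hi : 1 ≤ i)
    (hir : i ≤ r) (hrj : r < j) (hj : j ≤ N) (hk : r < k) (h : j < k ∨ j = k ∧ i < a) {X : P.W}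
    (hX : X ∈ P.colSpan a k) : P.fn X (D.Fb i j) = 0 := by
  refine fn_eq_zero_of_span ?_ hX
  rintro _ ⟨y, hy, hyr, rfl⟩
  rw [fn_Fb hr hi hir hrj hj hyr hk, if_neg (by omega)]

end Probe

end UqslData

namespace UqslData

variable {q : ℝ} {N : ℕ} {D : UqslData q N} {r : ℕ}

lemma Kb_mul_Kib {i k : ℕ} (hi : 1 ≤ i) (hik : i ≤ k) (hk : k ≤ N) :
    D.Kb i k * D.Kib i k = 1 := by
  have h : Commute (D.Kb i k) (D.Kib i k) := Kb_commute fun s hs hsk =>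
    (Kib_commute fun t ht htk => commute_Ki_Kg (by simp; omega) (by simp; omega)).symm
  rw [h.eq, Kib_mul_Kb hi hik hk]

lemma Fb_mul_Kb (hq : (q : ℂ) ≠ 0) {i k : ℕ} (hi : 1 ≤ i) (hik : i < k) (hk : k ≤ N) :
    D.Fb i k * D.Kb i k = (q : ℂ) ^ 2 • (D.Kb i k * D.Fb i k) := by
  have h := qcomm_Kib_Fb hq hi hik hk (D := D)
  rw [QComm] at h
  calc D.Fb i k * D.Kb i k = D.Kb i k * (D.Kib i k * D.Fb i k) * D.Kb i k := by
        rw [← mul_assoc, Kb_mul_Kib hi hik.le hk, one_mul]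
    _ = _ := by
        rw [h, mul_smul_comm, smul_mul_assoc, ← mul_assoc, mul_assoc, Kib_mul_Kb hi hik.le hk,
          mul_one]

namespace Probe

variable {P : D.Probe r}

lemma Rop_mul_Eb {i k : ℕ} (hi : 1 ≤ i) (hik : i < k) (hk : k ≤ N) (X : P.W) (u : D.U) :
    Rop (P.fn X) (u * D.Eb i k) = Rop (P.fn (P.act (D.Eb i k) X)) u +
      Rop (P.fn (P.act (D.Kb i k) X)) u * D.Eb i k + (1 - (q : ℂ)⁻¹ ^ 2) •
        ∑ t ∈ Finset.Ico (i + 1) k,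
          Rop (P.fn (P.act (D.Eb i t) (P.act (D.Kb t k) X))) u * D.Eb t k := by
  rw [Rop_apply, Bialgebra.comul_mul, comul_Eb hi hik hk, mul_add, mul_add, mul_smul_comm,
    Finset.mul_sum, map_add, map_add, map_smul, map_sum]
  simp only [Sop_mul_tmul, fn_comp_mulRight, ← Rop_apply, mul_one, map_mul, Module.End.mul_apply]

lemma Rop_mul_Fb (hq : (q : ℂ) ≠ 0) {i k : ℕ} (hi : 1 ≤ i) (hik : i < k) (hk : k ≤ N) (X : P.W)
    (u : D.U) :
    Rop (P.fn X) (u * D.Fb i k) = Rop (P.fn (P.act (D.Fb i k) X)) u * D.Kib i k +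
      Rop (P.fn X) u * D.Fb i k + (1 - (q : ℂ)⁻¹ ^ 2) •
        ∑ t ∈ Finset.Ico (i + 1) k,
          Rop (P.fn (P.act (D.Fb i t) X)) u * (D.Fb t k * D.Kib i t) := by
  rw [Rop_apply, Bialgebra.comul_mul, comul_Fb hq hi hik hk, mul_add, mul_add, mul_smul_comm,
    Finset.mul_sum, map_add, map_add, map_smul, map_sum]
  simp only [Sop_mul_tmul, fn_comp_mulRight, ← Rop_apply, map_one, Module.End.one_apply]

variable (P) in
/-- The element `u` of degree `m` is sent to degree `m - 2` by the functionals in `V`. -/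
def Kill (V : Submodule ℂ P.W) (m : ℤ) (u : D.U) : Prop :=
  u ∈ D.G r m ∧ ∀ X ∈ V, Rop (P.fn X) u ∈ D.Gh r (m - 2)

lemma Kill.mono {V V' : Submodule ℂ P.W} (h : V' ≤ V) {m : ℤ} {u : D.U} (hu : P.Kill V m u) :
    P.Kill V' m u := ⟨hu.1, fun X hX => hu.2 X (h hX)⟩

lemma kill_one {V : Submodule ℂ P.W} (hw : ∀ X ∈ V, P.w X = 0) : P.Kill V 0 1 := by
  refine ⟨one_mem_G, fun X hX => ?_⟩
  have : Rop (P.fn X) (1 : D.U) = P.w X • 1 := by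
    rw [Rop_apply, Bialgebra.comul_one, Algebra.TensorProduct.one_def, Sop_tmul, fn_one]
  rw [this, hw X hX, zero_smul]
  exact zero_mem _

lemma Rop_fn_mem_Gh (hr : r ∈ Finset.Icc 1 (N - 1)) {X : P.W} (hX : P.w X = 0) {m : ℤ} {u : D.U}
    (hu : u ∈ D.G r m) : Rop (P.fn X) u ∈ D.Gh r (m - 1) :=
  (vanishJ_fn X).Rop_mem_Gh hr (by rw [fn_one, hX]) (G_le_Gh _ hu)

lemma mul_mem_Gh' {m n l : ℤ} {x y : D.U} (hx : x ∈ D.Gh r m) (hy : y ∈ D.G r n)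
    (h : m + n = l) : x * y ∈ D.Gh r l := h ▸ mul_mem_Gh hx hy

lemma mul_Ksub_mem_Gh {m : ℤ} {x y : D.U} (hx : x ∈ D.Gh r m) (hy : y ∈ D.Ksub r) :
    x * y ∈ D.Gh r m := mul_mem_Gh' hx (Ksub_le_G hy) (add_zero m)

lemma sum_Eb_mem {V : Submodule ℂ P.W} {m : ℤ} {u : D.U} (hr : r ∈ Finset.Icc 1 (N - 1))
    (hu : P.Kill V m u) {i k : ℕ} (hi : 1 ≤ i) (hk : k ≤ N) {X : P.W}
    (h1 : ∀ t, i < t → t ≤ r → t < k → P.act (D.Eb i t) (P.act (D.Kb t k) X) ∈ V)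
    (h2 : ∀ t, r < t → t < k → i < t → P.fn (P.act (D.Kb t k) X) (D.Eb i t) = 0) :
    (1 - (q : ℂ)⁻¹ ^ 2) • ∑ t ∈ Finset.Ico (i + 1) k,
          Rop (P.fn (P.act (D.Eb i t) (P.act (D.Kb t k) X))) u * D.Eb t k ∈ D.Gh r (m - 1) := by
  refine Submodule.smul_mem _ _ (Submodule.sum_mem _ fun t ht => ?_)
  rw [Finset.mem_Ico] at ht
  rcases le_or_gt t r with htr | htr
  · exact mul_mem_Gh' (hu.2 _ (h1 t ht.1 htr ht.2)) (Eb_mem_G (by omega) ht.2 hk) (by ring)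
  · exact mul_Ksub_mem_Gh (Rop_fn_mem_Gh hr (h2 t htr ht.2 ht.1) hu.1)
      (Eb_mem_Ksub (by omega) ht.2 hk (by omega))

lemma sum_Fb_mem {V : Submodule ℂ P.W} {m : ℤ} {u : D.U} (hr : r ∈ Finset.Icc 1 (N - 1))
    (hu : P.Kill V m u) {i k : ℕ} (hi : 1 ≤ i) (hk : k ≤ N) {X : P.W}
    (h1 : ∀ t, i < t → t ≤ r → t < k → P.act (D.Fb i t) X ∈ V)
    (h2 : ∀ t, r < t → t < k → i < t → P.fn X (D.Fb i t) = 0) :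
    (1 - (q : ℂ)⁻¹ ^ 2) • ∑ t ∈ Finset.Ico (i + 1) k,
          Rop (P.fn (P.act (D.Fb i t) X)) u * (D.Fb t k * D.Kib i t) ∈ D.Gh r (m - 1) := by
  refine Submodule.smul_mem _ _ (Submodule.sum_mem _ fun t ht => ?_)
  rw [Finset.mem_Ico] at ht
  have hKi : D.Kib i t ∈ D.Ksub r := Kib_mem_Ksub hi (by omega) (by omega)
  rw [← mul_assoc]
  refine mul_Ksub_mem_Gh ?_ hKi
  rcases le_or_gt t r with htr | htr
  · exact mul_mem_Gh' (hu.2 _ (h1 t ht.1 htr ht.2)) (Fb_mem_G (by omega) ht.2 hk) (by ring)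
  · exact mul_Ksub_mem_Gh (Rop_fn_mem_Gh hr (h2 t htr ht.2 ht.1) hu.1)
      (Fb_mem_Ksub (by omega) ht.2 hk (by omega))

lemma Kill.mul_Eb {V : Submodule ℂ P.W} {m : ℤ} {u : D.U} (hr : r ∈ Finset.Icc 1 (N - 1))
    (hu : P.Kill V m u) {i k : ℕ} (hi : 1 ≤ i) (hir : i ≤ r) (hrk : r < k) (hk : k ≤ N)
    (hE : ∀ s, 1 ≤ s → s < r → ∀ X ∈ V, P.act (D.E s) X ∈ V)
    (hK : ∀ s, s ∈ Finset.Icc 1 (N - 1) → ∀ X ∈ V, P.act (D.Kg s) X ∈ V)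
    (h : ∀ t, r < t → t ≤ k → ∀ X ∈ V, P.fn X (D.Eb i t) = 0) :
    P.Kill V (m + 1) (u * D.Eb i k) := by
  have hKb : ∀ {j}, i ≤ j → j ≤ k → ∀ {X}, X ∈ V → P.act (D.Kb j k) X ∈ V := fun hj hjk _ hX =>
    act_Kb_mem hjk (fun s hs hsk => hK s (by simp; omega)) hX
  have hG : D.Eb i k ∈ D.G r 1 := Eb_mem_G hi (by omega) hk
  refine ⟨mul_mem_G hu.1 hG, fun X hX => ?_⟩
  rw [Rop_mul_Eb hi (by omega) hk, show m + 1 - 2 = m - 1 by ring]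
  refine add_mem (add_mem (Rop_fn_mem_Gh hr (h k hrk le_rfl X hX) hu.1) ?_) ?_
  · exact mul_mem_Gh' (hu.2 _ (hKb le_rfl (by omega) hX)) hG (by ring)
  · refine sum_Eb_mem hr hu hi hk (fun t hit htr htk => ?_) fun t hrt htk hit => ?_
    · exact act_Eb_mem le_rfl hit (fun s hs hst => hE s (by omega) (by omega))
        (hKb hit.le htk.le hX)
    · exact h t hrt htk.le _ (hKb hit.le htk.le hX)

lemma Kill.mul_Fb (hq : (q : ℂ) ≠ 0) {V : Submodule ℂ P.W} {m : ℤ} {u : D.U}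
    (hr : r ∈ Finset.Icc 1 (N - 1))
    (hu : P.Kill V m u) {i k : ℕ} (hi : 1 ≤ i) (hir : i ≤ r) (hrk : r < k) (hk : k ≤ N)
    (hF : ∀ s, 1 ≤ s → s < r → ∀ X ∈ V, P.act (D.F s) X ∈ V)
    (h : ∀ t, r < t → t ≤ k → ∀ X ∈ V, P.fn X (D.Fb i t) = 0) :
    P.Kill V (m + 1) (u * D.Fb i k) := by
  have hG : D.Fb i k ∈ D.G r 1 := Fb_mem_G hi (by omega) hk
  refine ⟨mul_mem_G hu.1 hG, fun X hX => ?_⟩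
  rw [Rop_mul_Fb hq hi (by omega) hk, show m + 1 - 2 = m - 1 by ring]
  refine add_mem (add_mem (mul_Ksub_mem_Gh (Rop_fn_mem_Gh hr (h k hrk le_rfl X hX) hu.1)
    (Kib_mem_Ksub hi (by omega) hk)) ?_) ?_
  · exact mul_mem_Gh' (hu.2 _ hX) hG (by ring)
  · exact sum_Fb_mem hr hu hi hk (fun t hit htr htk =>
      act_Fb_mem le_rfl hit (fun s hs hst => hF s (by omega) (by omega)) hX)
      fun t hrt htk hit => h t hrt htk.le _ hX

/-- The leading term of the `E`-type derivation. -/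
lemma leading_Eb (hq : (q : ℂ) ≠ 0) (hr : r ∈ Finset.Icc 1 (N - 1)) {a k : ℕ} (ha : 1 ≤ a)
    (har : a ≤ r) (hrk : r < k) (hk : k ≤ N) {m : ℤ} {u : D.U}
    (hu : P.Kill (P.rowSpan (a + 1) k) m u) :
    Rop (P.fn (P.δ k a)) (u * D.Eb a k) -
      (u + ((q : ℂ)⁻¹ ^ 2) • (Rop (P.fn (P.δ k a)) u * D.Eb a k)) ∈ D.Gh r (m - 1) := by
  have hδ : P.δ k a ∈ P.rowSpan a k := δ_mem_rowSpan le_rfl har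
  have hKb : ∀ {j}, a ≤ j → j ≤ k → P.act (D.Kb j k) (P.δ k a) ∈ P.rowSpan a k := fun hj hjk =>
    act_Kb_mem hjk (fun s hs hsk X hX => act_Kg_mem_rowSpan (by simp; omega) hX) hδ
  have h1 : Rop (P.fn (P.act (D.Eb a k) (P.δ k a))) u - u ∈ D.Gh r (m - 1) := by
    have := (vanishJ_fn (P.act (D.Eb a k) (P.δ k a))).Rop_sub_mem_Gh hr (G_le_Gh m hu.1)
    rwa [fn_one, ← fn_apply, fn_Eb hq hr ha har hrk hk har hrk, if_pos ⟨rfl, rfl⟩, one_smul] at this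
  have h2 := sum_Eb_mem (P := P) (X := P.δ k a) hr hu ha hk (fun t hit htr htk =>
      act_Eb_mem (rowSpan_anti a.le_succ) hit (fun s hs hst X hX =>
        act_E_mem_rowSpan hrk (by simp at hr ⊢; omega) (by omega) hX) (hKb hit.le htk.le))
      fun t hrt htk hit => fn_Eb_rowSpan hq hr ha har hrt (by omega) hrk (Or.inl htk)
        (hKb hit.le htk.le)
  rw [Rop_mul_Eb ha (by omega) hk, act_Kb_δ ha (by omega) hk, fn_smul, Rop_smul, smul_mul_assoc]
  convert add_mem h1 h2 using 1
  abel

/-- The leading term of the `F`-type derivation. -/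
lemma leading_Fb (hq : (q : ℂ) ≠ 0) (hr : r ∈ Finset.Icc 1 (N - 1)) {a k : ℕ} (ha : 1 ≤ a)
    (har : a ≤ r) (hrk : r < k) (hk : k ≤ N) {m : ℤ} {u : D.U}
    (hu : P.Kill (P.colSpan (a + 1) k) m u) :
    Rop (P.fn (P.δ a k)) (u * D.Fb a k) * D.Kb a k -
      (fVal q r k • u + (q : ℂ) ^ 2 • (Rop (P.fn (P.δ a k)) u * D.Kb a k * D.Fb a k)) ∈
        D.Gh r (m - 1) := by
  have hδ : P.δ a k ∈ P.colSpan a k := δ_mem_colSpan le_rfl har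
  have h1 : Rop (P.fn (P.act (D.Fb a k) (P.δ a k))) u - fVal q r k • u ∈ D.Gh r (m - 1) := by
    have := (vanishJ_fn (P.act (D.Fb a k) (P.δ a k))).Rop_sub_mem_Gh hr (G_le_Gh m hu.1)
    rwa [fn_one, ← fn_apply, fn_Fb hr ha har hrk hk har hrk, if_pos ⟨rfl, rfl⟩] at this
  have h2 := sum_Fb_mem (P := P) (X := P.δ a k) hr hu ha hk (fun t hit htr htk =>
      act_Fb_mem (colSpan_anti a.le_succ) hit (fun s hs hst X hX =>
        act_F_mem_colSpan hrk (by simp at hr ⊢; omega) (by omega) hX) hδ)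
      fun t hrt htk hit => fn_Fb_colSpan hr ha har hrt (by omega) hrk (Or.inl htk) hδ
  rw [Rop_mul_Fb hq ha (by omega) hk, add_mul, add_mul, mul_assoc _ (D.Kib a k),
    Kib_mul_Kb ha (by omega) hk, mul_one, mul_assoc _ (D.Fb a k),
    Fb_mul_Kb hq ha (by omega) hk, mul_smul_comm, ← mul_assoc]
  convert add_mem h1 (mul_Ksub_mem_Gh h2 (Kb_mem_Ksub ha (show a ≤ k by omega) hk)) using 1
  abel

end Probe

end UqslData

lemma exists_eq_sum_of_mem_sortedSpan {ι V : Type*} [Ring V] [Algebra ℂ V] {y : ι → V} {l : List ι}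
    {p : ι} {m : ℕ} {z : V} (hz : z ∈ sortedSpan y (l ++ [p]) m) :
    ∃ u : ℕ → V, (∀ k ≤ m, u k ∈ sortedSpan y l (m - k)) ∧
      z = ∑ k ∈ Finset.range (m + 1), u k * y p ^ k := by
  induction hz using Submodule.span_induction with
  | mem z hz =>
    obtain ⟨c, hc, rfl⟩ := hz
    simp only [List.map_append, List.map_cons, List.map_nil, List.sum_append, List.sum_cons,
      List.sum_nil, add_zero] at hc
    refine ⟨fun k => if k = c p then (l.map fun p => y p ^ c p).prod else 0, fun k _ => ?_, ?_⟩
    · dsimp only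
      split_ifs with h
      · exact Submodule.subset_span ⟨c, by omega, rfl⟩
      · exact zero_mem _
    · simp only [ite_mul, zero_mul]
      rw [Finset.sum_ite_eq', if_pos (by simp; omega)]
      simp
  | zero => exact ⟨0, fun _ _ => zero_mem _, by simp⟩
  | add z z' _ _ h h' =>
    obtain ⟨u, hu, rfl⟩ := h
    obtain ⟨u', hu', rfl⟩ := h'
    exact ⟨u + u', fun k hk => add_mem (hu k hk) (hu' k hk), by
      simp [add_mul, Finset.sum_add_distrib]⟩
  | smul c z _ h =>
    obtain ⟨u, hu, rfl⟩ := h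
    exact ⟨c • u, fun k hk => Submodule.smul_mem _ _ (hu k hk), by simp [Finset.smul_sum]⟩

namespace UqslData

variable {q : ℝ} {N : ℕ} {D : UqslData q N} {r : ℕ}

variable (r) in
/-- An operator of degree `-1` that acts as a nondegenerate twisted derivative with respect to
the last letter `y` of a monomial and kills, to leading order, the span `S k` of the monomials of
degree `k` in the preceding letters. -/
structure IsLastDerivation (S : ℕ → Submodule ℂ D.U) (y : D.U) (R : D.U →ₗ[ℂ] D.U)
    (d : ℕ → ℂ) : Prop where
  ne_zero : ∀ n, d n ≠ 0
  mem_Gh : ∀ (n : ℤ) (x : D.U), x ∈ D.Gh r n → R x ∈ D.Gh r (n - 1)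
  kill : ∀ (k : ℕ), ∀ u ∈ S k, R u ∈ D.Gh r (k - 2)
  leading : ∀ (k : ℕ), ∀ u ∈ S k, ∀ n : ℕ,
    R (u * y ^ (n + 1)) - d n • (u * y ^ n) ∈ D.Gh r (k + n - 1)

/-- The leading coefficients `μ (1 + λ + ⋯ + λⁿ)`. -/
lemma leading_pow {y u : D.U} (hy : y ∈ D.G r 1) {R : D.U →ₗ[ℂ] D.U} {k : ℤ}
    (hu : R u ∈ D.Gh r (k - 2)) {μ c : ℂ}
    (h : ∀ n : ℕ, R (u * y ^ n * y) - (μ • (u * y ^ n) + c • (R (u * y ^ n) * y)) ∈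
      D.Gh r (k + n - 1)) (n : ℕ) :
    R (u * y ^ (n + 1)) - (μ * ∑ i ∈ Finset.range (n + 1), c ^ i) • (u * y ^ n) ∈
      D.Gh r (k + n - 1) := by
  induction n with
  | zero =>
    have h0 := h 0
    have h1 : R u * y ∈ D.Gh r (k - 1) := Probe.mul_mem_Gh' hu hy (by ring)
    simp only [pow_zero, mul_one, Nat.cast_zero, add_zero, zero_add, pow_one,
      Finset.range_one, Finset.sum_singleton] at h0 ⊢
    convert add_mem h0 (Submodule.smul_mem _ c h1) using 1
    abel
  | succ n ih =>
    have h0 := h (n + 1)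
    have h1 := Probe.mul_mem_Gh' (l := k + (n + 1 : ℕ) - 1) ih hy (by push_cast; ring)
    rw [sub_mul, smul_mul_assoc, mul_assoc u, ← pow_succ] at h1
    convert add_mem h0 (Submodule.smul_mem _ c h1) using 1
    rw [geom_sum_succ (n := n + 1), mul_assoc u, ← pow_succ]
    module

lemma IsLastDerivation.eliminate {S : ℕ → Submodule ℂ D.U} {y : D.U} {R : D.U →ₗ[ℂ] D.U}
    {d : ℕ → ℂ} (h : IsLastDerivation r S y R d) (hy : y ∈ D.G r 1) {m M : ℕ} (hM : M ≤ m)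
    {u : ℕ → D.U} (hu : ∀ k ≤ m, u k ∈ S (m - k)) {z : D.U}
    (hz : z - ∑ k ∈ Finset.range (M + 1), u k * y ^ k ∈ D.Gh r (m - 1))
    (hRz : R z ∈ D.Gh r (m - 2)) : z ∈ S m ⊔ D.Gh r (m - 1) := by
  induction M generalizing u with
  | zero =>
    rw [← sub_add_cancel z (u 0), add_comm]
    exact Submodule.add_mem_sup (hu 0 (by omega)) (by simpa using hz)
  | succ M ih =>
    have h1 : R (∑ k ∈ Finset.range (M + 2), u k * y ^ k) ∈ D.Gh r (m - 2) := by
      have := h.mem_Gh _ _ hz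
      rw [map_sub] at this
      have := sub_mem hRz (show _ ∈ D.Gh r ((m : ℤ) - 2) by convert this using 2; ring)
      rwa [sub_sub_cancel] at this
    rw [Finset.sum_range_succ', map_add, map_sum, pow_zero, mul_one] at h1
    have h2 : ∑ k ∈ Finset.range (M + 1), (R (u (k + 1) * y ^ (k + 1)) -
        d k • (u (k + 1) * y ^ k)) ∈ D.Gh r (m - 2) := Submodule.sum_mem _ fun k hk => by
      have hk' : k + 1 ≤ m := by have := Finset.mem_range.1 hk; omega
      have := h.leading _ _ (hu (k + 1) hk') k
      convert this using 2
      push_cast [Nat.cast_sub hk']; ring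
    have h3 : ∑ k ∈ Finset.range (M + 1), d k • (u (k + 1) * y ^ k) ∈ D.Gh r (m - 2) := by
      convert sub_mem (sub_mem h1 (h.kill _ _ (hu 0 (by omega)))) h2 using 1
      rw [Finset.sum_sub_distrib]; abel
    have h4 : ∑ k ∈ Finset.range (M + 1), d k • (u (k + 1) * y ^ (k + 1)) ∈ D.Gh r (m - 1) := by
      have := Probe.mul_mem_Gh' (l := (m : ℤ) - 1) h3 hy (by ring)
      simpa only [Finset.sum_mul, smul_mul_assoc, mul_assoc, ← pow_succ] using this
    refine ih (by omega)
      (u := fun k => if k = 0 then u 0 else (1 - (d M)⁻¹ * d (k - 1)) • u k) (fun k hk => ?_) ?_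
    · split_ifs with hk0
      · rw [hk0]; exact hu 0 (by omega)
      · exact Submodule.smul_mem _ _ (hu k hk)
    · have h5 := add_mem hz (Submodule.smul_mem _ (d M)⁻¹ h4)
      convert h5 using 1
      rw [Finset.sum_range_succ', Finset.sum_range_succ' _ (M + 1), Finset.sum_range_succ _ M,
        Finset.sum_range_succ _ M, smul_add, smul_smul, inv_mul_cancel₀ (h.ne_zero M), one_smul,
        Finset.smul_sum]
      simp only [Nat.add_one_ne_zero, if_false, if_true, Nat.add_sub_cancel, sub_smul, one_smul,
        sub_mul, smul_mul_assoc, Finset.sum_sub_distrib, smul_smul]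
      abel

/-- Iterated elimination of the last letters. -/
lemma eliminate_list {ι κ : Type*} {y : ι → D.U} {g : κ → ι} (B : List ι) {l : List κ}
    (hy : ∀ p ∈ l, y (g p) ∈ D.G r 1) {m : ℕ} {z : D.U}
    (H : ∀ l' p, l' ++ [p] <+: l → ∃ R d, R z ∈ D.Gh r (m - 2) ∧
      IsLastDerivation r (sortedSpan y (B ++ l'.map g)) (y (g p)) R d)
    (hz : z ∈ sortedSpan y (B ++ l.map g) m ⊔ D.Gh r (m - 1)) :
    z ∈ sortedSpan y B m ⊔ D.Gh r (m - 1) := by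
  induction l using List.reverseRecOn with
  | nil => simpa using hz
  | append_singleton l p ih =>
    refine ih (fun p' hp' => hy p' (by simp [hp']))
      (fun l' p' h => H l' p' (h.trans (List.prefix_append _ _))) ?_
    obtain ⟨R, d, hRz, h⟩ := H l p List.prefix_rfl
    obtain ⟨a, ha, b, hb, rfl⟩ := Submodule.mem_sup.1 hz
    rw [List.map_append, List.map_singleton, ← List.append_assoc] at ha
    obtain ⟨u, hu, rfl⟩ := exists_eq_sum_of_mem_sortedSpan ha
    exact h.eliminate (hy p (by simp)) le_rfl hu (by simpa using hb) hRz

lemma sortedSpan_nil {ι : Type*} {y : ι → D.U} {m : ℕ} (hm : m ≠ 0) : sortedSpan y [] m = ⊥ := by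
  refine (Submodule.eq_bot_iff _).2 fun x hx => ?_
  induction hx using Submodule.span_induction with
  | mem x hx => obtain ⟨c, hc, rfl⟩ := hx; exact absurd hc.symm (by simpa using hm)
  | zero => rfl
  | add x y _ _ hx hy => simp [hx, hy]
  | smul c x _ hx => simp [hx]

namespace Probe

variable {P : D.Probe r}

lemma Kill.mul_pow {V : Submodule ℂ P.W} {y : D.U}
    (h : ∀ (m : ℤ) (u : D.U), P.Kill V m u → P.Kill V (m + 1) (u * y)) {m : ℤ} {u : D.U}
    (hu : P.Kill V m u) (n : ℕ) : P.Kill V (m + n) (u * y ^ n) := by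
  induction n with
  | zero => simpa using hu
  | succ n ih =>
    rw [pow_succ, ← mul_assoc, Nat.cast_succ, ← add_assoc]
    exact h _ _ ih

lemma Kill.mul_list {ι : Type*} {V : Submodule ℂ P.W} {y : ι → D.U} {l : List ι}
    (h : ∀ p ∈ l, ∀ (m : ℤ) (u : D.U), P.Kill V m u → P.Kill V (m + 1) (u * y p)) {m : ℤ}
    {u : D.U} (hu : P.Kill V m u) (c : ι → ℕ) :
    P.Kill V (m + ((l.map c).sum : ℕ)) (u * (l.map fun p => y p ^ c p).prod) := by
  induction l generalizing m u with
  | nil => simpa using hu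
  | cons p l ih =>
    have := ih (fun p hp => h p (by simp [hp])) (hu.mul_pow (h p (by simp)) (c p))
    simpa [mul_assoc, add_assoc] using this

lemma kill_of_mem_sortedSpan {ι : Type*} {V V' : Submodule ℂ P.W} (hV : V ≤ V') {y : ι → D.U}
    {l l' : List ι} (hw : ∀ X ∈ V', P.w X = 0)
    (h : ∀ p ∈ l, ∀ (m : ℤ) (u : D.U), P.Kill V' m u → P.Kill V' (m + 1) (u * y p))
    (h' : ∀ p ∈ l', ∀ (m : ℤ) (u : D.U), P.Kill V m u → P.Kill V (m + 1) (u * y p)) {m : ℕ}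
    {u : D.U} (hu : u ∈ sortedSpan y (l ++ l') m) : P.Kill V m u := by
  induction hu using Submodule.span_induction with
  | mem u hu =>
    obtain ⟨c, rfl, rfl⟩ := hu
    simpa using (((kill_one hw).mul_list h c).mono hV).mul_list h' c
  | zero => exact ⟨zero_mem _, fun X _ => by simp⟩
  | add u v _ _ hu hv =>
    exact ⟨add_mem hu.1 hv.1, fun X hX => by rw [map_add]; exact add_mem (hu.2 X hX) (hv.2 X hX)⟩
  | smul c u _ hu =>
    exact ⟨Submodule.smul_mem _ _ hu.1, fun X hX => by
      rw [map_smul]; exact Submodule.smul_mem _ _ (hu.2 X hX)⟩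

end Probe

end UqslData

/-- The order in which the root vectors are arranged in the elimination argument. -/
def rootLT (p p' : ℕ × ℕ) : Prop := p.2 < p'.2 ∨ p.2 = p'.2 ∧ p.1 < p'.1

lemma exists_sorted_list (N r : ℕ) :
    ∃ l : List (ℕ × ℕ), l.Pairwise rootLT ∧ ∀ p, p ∈ l ↔ inPhiR N r p := by
  refine ⟨(List.range' r (N - r)).flatMap fun b => (List.range' 1 r).map fun a => (a, b),
    List.pairwise_flatMap.2 ⟨fun b _ => ?_, ?_⟩, fun p => ?_⟩
  · exact List.pairwise_map.2 ((List.pairwise_lt_range' 1).imp fun h => Or.inr ⟨rfl, h⟩)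
  · refine (List.pairwise_lt_range' 1).imp fun h x hx y hy => Or.inl ?_
    obtain ⟨_, _, rfl⟩ := List.mem_map.1 hx
    obtain ⟨_, _, rfl⟩ := List.mem_map.1 hy
    exact h
  · simp only [List.mem_flatMap, List.mem_map, List.mem_range'_1, inPhiR]
    constructor
    · rintro ⟨b, hb, a, ha, rfl⟩; dsimp only; omega
    · intro h; exact ⟨p.2, by omega, p.1, by omega, rfl⟩

lemma rootLT_of_append_singleton {l l' : List (ℕ × ℕ)} {p : ℕ × ℕ} (hl : l.Pairwise rootLT)
    (h : l' ++ [p] <+: l) : ∀ p' ∈ l', rootLT p' p := fun _ hp' =>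
  (List.pairwise_append.1 (hl.sublist h.sublist)).2.2 _ hp' _ (by simp)

lemma geom_sum_ofReal_ne_zero {x : ℝ} (hx : 0 < x) (n : ℕ) :
    ∑ i ∈ Finset.range (n + 1), (x : ℂ) ^ i ≠ 0 := by
  have : 0 < ∑ i ∈ Finset.range (n + 1), x ^ i :=
    Finset.sum_pos (fun i _ => pow_pos hx i) ⟨0, by simp⟩
  exact_mod_cast this.ne'

namespace UqslData

variable {q : ℝ} {N : ℕ} {D : UqslData q N} {r : ℕ}

namespace Probe

variable {P : D.Probe r}

lemma Kill.mul_Ep (hq : (q : ℂ) ≠ 0) (hr : r ∈ Finset.Icc 1 (N - 1)) {p : ℕ × ℕ}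
    (hp : inPhiR N r p) {a k : ℕ} (hk : r < k) (h : p.2 + 1 < k ∨ p.2 + 1 = k ∧ p.1 < a) {m : ℤ}
    {u : D.U} (hu : P.Kill (P.rowSpan a k) m u) :
    P.Kill (P.rowSpan a k) (m + 1) (u * D.Ep p) := by
  obtain ⟨h1, h2, h3, h4⟩ := hp
  have hr' := Finset.mem_Icc.1 hr
  rw [Ep_eq]
  exact hu.mul_Eb hr h1 h2 (by omega) (by omega)
    (fun s hs hsr X hX => rowSpan_anti a.le_succ
      (act_E_mem_rowSpan hk (by simp; omega) hsr hX))
    (fun s hs X hX => act_Kg_mem_rowSpan hs hX)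
    (fun t hrt ht X hX => fn_Eb_rowSpan hq hr h1 h2 hrt (by omega) hk (by omega) hX)

lemma Kill.mul_Fp_row (hq : (q : ℂ) ≠ 0) (hr : r ∈ Finset.Icc 1 (N - 1)) {p : ℕ × ℕ}
    (hp : inPhiR N r p) {k : ℕ} (hk : r < k) {m : ℤ}
    {u : D.U} (hu : P.Kill (P.rowSpan 1 k) m u) :
    P.Kill (P.rowSpan 1 k) (m + 1) (u * D.Fp p) := by
  obtain ⟨h1, h2, h3, h4⟩ := hp
  have hr' := Finset.mem_Icc.1 hr
  rw [Fp_eq]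
  exact hu.mul_Fb hq hr h1 h2 (by omega) (by omega)
    (fun s hs hsr X hX => act_F_mem_rowSpan hk (by simp; omega) hsr hX)
    (fun t hrt ht X hX => fn_Fb_lowerBlock hr h1 h2 hrt (by omega) (rowSpan_le_lowerBlock hk hX))

lemma Kill.mul_Fp_col (hq : (q : ℂ) ≠ 0) (hr : r ∈ Finset.Icc 1 (N - 1)) {p : ℕ × ℕ}
    (hp : inPhiR N r p) {a k : ℕ} (hk : r < k) (h : p.2 + 1 < k ∨ p.2 + 1 = k ∧ p.1 < a) {m : ℤ}
    {u : D.U} (hu : P.Kill (P.colSpan a k) m u) :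
    P.Kill (P.colSpan a k) (m + 1) (u * D.Fp p) := by
  obtain ⟨h1, h2, h3, h4⟩ := hp
  have hr' := Finset.mem_Icc.1 hr
  rw [Fp_eq]
  exact hu.mul_Fb hq hr h1 h2 (by omega) (by omega)
    (fun s hs hsr X hX => colSpan_anti a.le_succ
      (act_F_mem_colSpan hk (by simp; omega) hsr hX))
    (fun t hrt ht X hX => fn_Fb_colSpan hr h1 h2 hrt (by omega) hk (by omega) hX)

lemma isLastDerivation_row (hq : (q : ℂ) ≠ 0) (hr : r ∈ Finset.Icc 1 (N - 1))
    {lF l : List (ℕ × ℕ)} (hlF : ∀ p ∈ lF, inPhiR N r p) (hl : ∀ p ∈ l, inPhiR N r p)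
    {p : ℕ × ℕ} (hp : inPhiR N r p) (hlp : ∀ p' ∈ l, rootLT p' p) :
    IsLastDerivation r (sortedSpan D.letter (lF.map Sum.inl ++ l.map Sum.inr))
      (D.letter (Sum.inr p)) (Rop (P.fn (P.δ (p.2 + 1) p.1)))
      (fun n => 1 * ∑ i ∈ Finset.range (n + 1), ((q : ℂ)⁻¹ ^ 2) ^ i) := by
  have hrk : r < p.2 + 1 := Nat.lt_succ_of_le hp.2.2.1
  have hk : p.2 + 1 ≤ N := by have := hp.2.2.2; have := Finset.mem_Icc.1 hr; omega
  have hδ : P.δ (p.2 + 1) p.1 ∈ P.rowSpan p.1 (p.2 + 1) := δ_mem_rowSpan le_rfl hp.2.1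
  have hkill : ∀ (k : ℕ), ∀ u ∈ sortedSpan D.letter (lF.map Sum.inl ++ l.map Sum.inr) k,
      P.Kill (P.rowSpan p.1 (p.2 + 1)) k u := by
    intro k u hu
    refine kill_of_mem_sortedSpan (rowSpan_anti hp.1) (fun X hX => w_rowSpan hrk hX) ?_ ?_ hu
    · intro x hx m u hu
      obtain ⟨p', hp', rfl⟩ := List.mem_map.1 hx
      exact hu.mul_Fp_row hq hr (hlF p' hp') hrk
    · intro x hx m u hu
      obtain ⟨p', hp', rfl⟩ := List.mem_map.1 hx
      exact hu.mul_Ep hq hr (hl p' hp') hrk (by have := hlp p' hp'; unfold rootLT at this; omega)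
  refine ⟨fun n => ?_, fun n x hx => ?_, fun k u hu => (hkill k u hu).2 _ hδ, fun k u hu => ?_⟩
  · have hq' : q ≠ 0 := by exact_mod_cast hq
    have := geom_sum_ofReal_ne_zero (show 0 < q⁻¹ ^ 2 by positivity) n
    simpa using this
  · exact (vanishJ_fn _).Rop_mem_Gh hr (by rw [fn_one, w_rowSpan hrk hδ]) hx
  · refine leading_pow (letter_mem_G (p := Sum.inr p) (Finset.mem_Icc.1 hr).2 hp)
      ((hkill k u hu).2 _ hδ)
      fun n => ?_
    have h := ((hkill k u hu).mono (rowSpan_anti p.1.le_succ)).mul_pow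
      (fun m u hu => hu.mul_Ep hq hr hp hrk (Or.inr ⟨rfl, p.1.lt_succ_self⟩)) n
    have := leading_Eb hq hr hp.1 hp.2.1 hrk hk h
    rw [← Ep_eq] at this
    simp only [one_smul] at this ⊢
    exact this

lemma isLastDerivation_col (hq : (q : ℂ) ≠ 0) (hr : r ∈ Finset.Icc 1 (N - 1))
    {l : List (ℕ × ℕ)} (hl : ∀ p ∈ l, inPhiR N r p)
    {p : ℕ × ℕ} (hp : inPhiR N r p) (hlp : ∀ p' ∈ l, rootLT p' p) :
    IsLastDerivation r (sortedSpan D.letter ([] ++ l.map Sum.inl))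
      (D.letter (Sum.inl p)) (LinearMap.mulRight ℂ (D.Kb p.1 (p.2 + 1)) ∘ₗ
        Rop (P.fn (P.δ p.1 (p.2 + 1))))
      (fun n => fVal q r (p.2 + 1) * ∑ i ∈ Finset.range (n + 1), ((q : ℂ) ^ 2) ^ i) := by
  have hrk : r < p.2 + 1 := Nat.lt_succ_of_le hp.2.2.1
  have hk : p.2 + 1 ≤ N := by have := hp.2.2.2; have := Finset.mem_Icc.1 hr; omega
  have hKb : D.Kb p.1 (p.2 + 1) ∈ D.Ksub r :=
    Kb_mem_Ksub hp.1 (by have := hp.2.1; omega) hk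
  have hδ : P.δ p.1 (p.2 + 1) ∈ P.colSpan p.1 (p.2 + 1) := δ_mem_colSpan le_rfl hp.2.1
  have hkill : ∀ (k : ℕ), ∀ u ∈ sortedSpan D.letter ([] ++ l.map Sum.inl) k,
      P.Kill (P.colSpan p.1 (p.2 + 1)) k u := by
    intro k u hu
    refine kill_of_mem_sortedSpan le_rfl (fun X hX => w_colSpan hrk hX) (by simp) ?_ hu
    intro x hx m u hu
    obtain ⟨p', hp', rfl⟩ := List.mem_map.1 hx
    exact hu.mul_Fp_col hq hr (hl p' hp') hrk (by have := hlp p' hp'; unfold rootLT at this; omega)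
  refine ⟨fun n => ?_, fun n x hx => mul_Ksub_mem_Gh ?_ hKb,
    fun k u hu => mul_Ksub_mem_Gh ((hkill k u hu).2 _ hδ) hKb, fun k u hu => ?_⟩
  · have hq' : q ≠ 0 := by exact_mod_cast hq
    have := geom_sum_ofReal_ne_zero (show 0 < q ^ 2 by positivity) n
    exact mul_ne_zero (fVal_ne_zero hq _) (by simpa using this)
  · exact (vanishJ_fn _).Rop_mem_Gh hr (by rw [fn_one, w_colSpan hrk hδ]) hx
  · refine leading_pow (letter_mem_G (p := Sum.inl p) (Finset.mem_Icc.1 hr).2 hp)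
      (mul_Ksub_mem_Gh ((hkill k u hu).2 _ hδ) hKb) fun n => ?_
    have h := ((hkill k u hu).mono (colSpan_anti p.1.le_succ)).mul_pow
      (fun m u hu => hu.mul_Fp_col hq hr hp hrk (Or.inr ⟨rfl, p.1.lt_succ_self⟩)) n
    have := leading_Fb hq hr hp.1 hp.2.1 hrk hk h
    rw [← Fp_eq] at this
    exact this

end Probe

/-- If all functionals of positive degree lower the degree of `z` by two, then the component of
`z` of top degree vanishes. -/
lemma mem_Gh_of_Rop_mem (hq : Transcendental ℚ q) (hr1 : 1 ≤ r) (hr2 : r ≤ N - 1) {m : ℕ}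
    (hm : m ≠ 0) {z : D.U} (hz : z ∈ D.Gh r m)
    (h : ∀ f : D.U →ₗ[ℂ] ℂ, VanishJ r f → f 1 = 0 → Rop f z ∈ D.Gh r (m - 2)) :
    z ∈ D.Gh r (m - 1) := by
  have hr : r ∈ Finset.Icc 1 (N - 1) := Finset.mem_Icc.2 ⟨hr1, hr2⟩
  have hq0 := qc_ne_zero hq
  obtain ⟨P⟩ := nonempty_probe D r hq0 (qc_sub_inv_ne_zero hq)
  obtain ⟨l, hsort, hl⟩ := exists_sorted_list N r
  have hnd : l.Nodup := hsort.imp fun {p p'} h e => by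
    subst e; unfold rootLT at h; omega
  have hz1 := Gh_le_sortedSpan_sup hq hr1 hr2 hnd hl hnd hl m hz
  have hpre : ∀ {l' p}, l' ++ [p] <+: l → (∀ p' ∈ l', inPhiR N r p') ∧ inPhiR N r p :=
    fun h => ⟨fun p' hp' => (hl p').1 (h.subset (by simp [hp'])), (hl _).1 (h.subset (by simp))⟩
  have hz2 := eliminate_list (g := Sum.inr) (l := l) (l.map Sum.inl)
    (fun p hp => letter_mem_G (p := Sum.inr p) hr2 ((hl p).1 hp))
    (fun l' p hl' => ⟨_, _, h _ (Probe.vanishJ_fn (P.δ (p.2 + 1) p.1)) ?_,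
      Probe.isLastDerivation_row hq0 hr (fun p hp => (hl p).1 hp) (hpre hl').1 (hpre hl').2
        (rootLT_of_append_singleton hsort hl')⟩) hz1
  have hz3 := eliminate_list (g := Sum.inl) (l := l) []
    (fun p hp => letter_mem_G (p := Sum.inl p) hr2 ((hl p).1 hp))
    (fun l' p hl' => ⟨_, _,
      Probe.mul_Ksub_mem_Gh (h _ (Probe.vanishJ_fn (P.δ p.1 (p.2 + 1))) ?_) ?_,
      Probe.isLastDerivation_col hq0 hr (hpre hl').1 (hpre hl').2
        (rootLT_of_append_singleton hsort hl')⟩) (by simpa using hz2)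
  · rwa [sortedSpan_nil hm, bot_sup_eq] at hz3
  · obtain ⟨h1, h2, h3, h4⟩ := (hpre hl').2
    rw [Probe.fn_one, P.w_δ, if_neg (by omega)]
  · obtain ⟨h1, h2, h3, h4⟩ := (hpre hl').2
    exact Kb_mem_Ksub h1 (by omega) (by omega)
  · obtain ⟨h1, h2, h3, h4⟩ := (hpre hl').2
    rw [Probe.fn_one, P.w_δ, if_neg (by omega)]

lemma coradSeq_le_Gh (hq : Transcendental ℚ q) (hr1 : 1 ≤ r) (hr2 : r ≤ N - 1) (k : ℕ) :
    coradSeq D r k ≤ D.Gh r k := by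
  induction k with
  | zero =>
    refine sup_le (Submodule.span_le.2 ?_) (Jsub_le_Gh _)
    rw [Set.singleton_subset_iff]
    exact G_le_Gh _ one_mem_G
  | succ k ih =>
    intro z hz
    obtain ⟨m, hm⟩ := exists_mem_G (r := r) z
    have key : ∀ d : ℕ, z ∈ D.Gh r (k + 1 + d : ℕ) → z ∈ D.Gh r (k + 1 : ℕ) := by
      intro d
      induction d with
      | zero => exact id
      | succ d ihd =>
        intro h
        refine ihd ?_
        have := mem_Gh_of_Rop_mem hq hr1 hr2 (by omega) h fun f hf h1 =>
          Gh_mono (by push_cast; omega) (ih (hf.Rop_mem_coradSeq h1 hz))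
        convert this using 2
        push_cast; ring
    exact key m (Gh_mono (by push_cast; omega) (G_le_Gh _ hm))

end UqslData

/-- The coradical filtration of the connected coalgebra `Ū = U/K⁺U`
coincides with the filtration `F₁`: for every `k`, the `k`-th term of the coradical
filtration equals `Ū_k`, the span of the monomials `∏ F_{β_i}^{n_i} ∏ E_{β'_j}^{m_j}`
with `Σ n_i + Σ m_j ≤ k`.  (Stated on representatives in `U`.) -/
theorem coradical_filtration_eq_F1
    (q : ℝ) (hq : Transcendental ℚ q)
    (N r : ℕ) (hN : 2 ≤ N) (hr1 : 1 ≤ r) (hr2 : r ≤ N - 1)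
    (D : UqslData q N)
    (lF lE : List (ℕ × ℕ))
    (hlFnd : lF.Nodup) (hlF : ∀ p, p ∈ lF ↔ inPhiR N r p)
    (hlEnd : lE.Nodup) (hlE : ∀ p, p ∈ lE ↔ inPhiR N r p) :
    ∀ k : ℕ, coradSeq D r k = monSpanLe D lF lE k ⊔ D.Jsub r := by
  intro k
  rw [← UqslData.Gh_eq_monSpanLe hq hr1 hr2 hlFnd hlF hlEnd hlE k]
  exact le_antisymm (UqslData.coradSeq_le_Gh hq hr1 hr2 k)
    (UqslData.Gh_le_coradSeq (Finset.mem_Icc.2 ⟨hr1, hr2⟩) k)
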